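/- Let q be a prime power and n ≥ 3 a natural number. Then (q,n) ∈ B(3,2) in each of the following cases: q ≥ 3.74·10⁹ and n = 3; q ≥ 3.91·10⁷ and n = 4; q ≥ 2.5·10⁶ and n = 5; q ≥ 23 and n ≥ 6. -/

import Mathlib

open Polynomial

noncomputable section

/-- An element of a finite field is *primitive* if it generates the multiplicative group. -/
def IsPrimitiveElem {L : Type} [Field L] [Fintype L] (α : L) : Prop :=
  orderOf α = Fintype.card L - 1

/-- `β` is a *normal element* of `L` over `K`, where `n = [L : K]`:
the conjugates `β, β^q, …, β^(q^(n-1))` form a `K`-basis of `L`. -/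
def IsNormalElem (K : Type) {L : Type} [Field K] [Fintype K] [Field L] [Algebra K L]
    (n : ℕ) (β : L) : Prop :=
  LinearIndependent K (fun i : Fin n => β ^ Fintype.card K ^ (i : ℕ)) ∧
    Submodule.span K (Set.range fun i : Fin n => β ^ Fintype.card K ^ (i : ℕ)) = ⊤

/-- The set `Υ_Q(m₁, m₂)` of rational functions over the field `F` with `Q` elements. -/
def Upsilon (F : Type) [Field F] [Fintype F] (m₁ m₂ : ℕ) : Set (RatFunc F) :=
  {f | ∃ f₁ f₂ : F[X], f₂ ≠ 0 ∧
      f = algebraMap F[X] (RatFunc F) f₁ / algebraMap F[X] (RatFunc F) f₂ ∧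
      f₁.natDegree ≤ m₁ ∧ f₂.natDegree ≤ m₂ ∧ IsCoprime f₁ f₂ ∧
      ∃ (k : ℕ) (g : F[X]), 0 < k ∧ g.Monic ∧ Irreducible g ∧ g ≠ X ∧
        Nat.gcd k (Fintype.card F - 1) = 1 ∧
        g ^ k ∣ f₁ * f₂ ∧ ¬ g ^ (k + 1) ∣ f₁ * f₂}

/-- Evaluation of a rational function at a point of the same field (`0` if undefined). -/
def ratEval {F : Type} [Field F] (f : RatFunc F) (α : F) : F :=
  f.eval (RingHom.id F) α

/-- `α` is `s`-free. -/
def IsFree {F : Type} [Field F] (s : ℕ) (α : F) : Prop :=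
  α ≠ 0 ∧ ∀ d : ℕ, d ∣ s → d ≠ 1 → ¬ ∃ β : F, β ^ d = α

/-- The `F_q[x]`-module action `h ∘ β = ∑ hᵢ β^(qⁱ)` on `L`. -/
def polyAct {K L : Type} [Field K] [Fintype K] [Field L] [Algebra K L]
    (h : K[X]) (β : L) : L :=
  h.sum fun i a => algebraMap K L a * β ^ Fintype.card K ^ i

/-- `α` is `g`-free with respect to the `F_q[x]`-module structure of `L`. -/
def IsPolyFree (K : Type) {L : Type} [Field K] [Fintype K] [Field L] [Algebra K L]
    (g : K[X]) (α : L) : Prop :=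
  ∀ h : K[X], h.Monic → h ∣ g → (∃ lam : L, α = polyAct h lam) → h = 1

/-- `N_f(e₁, e₂, g)`: the number of `α ∈ L` such that `α` is `e₁`-free,
`f(α)` is `e₂`-free and `α` is `g`-free. -/
def NElems (K : Type) {L : Type} [Field K] [Fintype K] [Field L] [Fintype L] [Algebra K L]
    (f : RatFunc L) (e₁ e₂ : ℕ) (g : K[X]) : ℕ :=
  Nat.card {α : L | IsFree e₁ α ∧ IsFree e₂ (ratEval f α) ∧ IsPolyFree K g α}

/-- `W(ℓ)`: the number of squarefree divisors of `ℓ`. -/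
def Wnat (ℓ : ℕ) : ℕ := (ℓ.divisors.filter Squarefree).card

/-- `W_q(g)`: the number of monic squarefree divisors of `g` in `F_q[x]`. -/
def Wpoly {K : Type} [Field K] (g : K[X]) : ℕ :=
  Nat.card {h : K[X] // h.Monic ∧ Squarefree h ∧ h ∣ g}

/-- `Φ(g) = |(F_q[x]/(g))ˣ|`. -/
def PhiPoly {K : Type} [Field K] (g : K[X]) : ℕ :=
  Nat.card ((K[X] ⧸ Ideal.span ({g} : Set K[X]))ˣ)

/-- `(q, n) ∈ B(m₁, m₂)`: for every `f ∈ Υ_{qⁿ}(m₁, m₂)` there is a primitive element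
`α` of `F_{qⁿ}`, normal over `F_q`, with `f(α)` also primitive. -/
def memB (m₁ m₂ q n : ℕ) : Prop :=
  ∀ (K L : Type) [Field K] [Field L] [Fintype K] [Fintype L] [Algebra K L],
    Fintype.card K = q → Fintype.card L = q ^ n →
    ∀ f ∈ Upsilon L m₁ m₂,
      ∃ α : L, IsPrimitiveElem α ∧ IsNormalElem K n α ∧ IsPrimitiveElem (ratEval f α)

/-- `𝔑(q, n)`: the number of primitive elements of `F_{qⁿ}` that are normal over `F_q`. -/
def NNum (K L : Type) [Field K] [Fintype K] [Field L] [Fintype L] [Algebra K L] (n : ℕ) : ℕ :=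
  Nat.card {α : L | IsPrimitiveElem α ∧ IsNormalElem K n α}

end


section PartA1
open Polynomial

theorem irr_kummer {K : Type} [Field K] {d : ℕ} (hd : 0 < d) {ζ : K} (hζ : IsPrimitiveRoot ζ d)
    {u : K} (hu : u ≠ 0) (hb : ∀ b : ℕ, b.Prime → b ∣ d → ∀ v : K, v ^ b ≠ u) :
    Irreducible (X ^ d - C u : K[X]) := by
  haveI : NeZero d := ⟨hd.ne'⟩
  obtain ⟨y, hy⟩ := IsAlgClosed.exists_pow_nat_eq (algebraMap K (AlgebraicClosure K) u) hd
  have hu' : algebraMap K (AlgebraicClosure K) u ≠ 0 := by simpa using hu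
  have hy0 : y ≠ 0 := by
    rintro rfl
    rw [zero_pow hd.ne'] at hy
    exact hu' hy.symm
  have hyint : IsIntegral K y := Algebra.IsIntegral.isIntegral y
  set P := minpoly K y with hP
  have hPirr : Irreducible P := minpoly.irreducible hyint
  have hPm : P.Monic := minpoly.monic hyint
  have hdvd : P ∣ X ^ d - C u := minpoly.dvd K y (by simp [hy])
  have hroot : ∀ z ∈ P.aroots (AlgebraicClosure K), ∃ k : K, z = y * algebraMap K _ k := by
    intro z hz
    have hz' : aeval z P = 0 := (mem_aroots.1 hz).2
    have : aeval z (X ^ d - C u : K[X]) = 0 := by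
      obtain ⟨w, hw⟩ := hdvd
      rw [hw, map_mul, hz', zero_mul]
    simp only [map_sub, map_pow, aeval_X, aeval_C, sub_eq_zero] at this
    have h1 : (z / y) ^ d = 1 := by rw [div_pow, this, hy, div_self hu']
    obtain ⟨i, _, hi⟩ := (hζ.map_of_injective (algebraMap K (AlgebraicClosure K)).injective).eq_pow_of_pow_eq_one h1
    refine ⟨ζ ^ i, ?_⟩
    rw [map_pow, hi]; field_simp
  have hprod : ∀ s : Multiset (AlgebraicClosure K), (∀ z ∈ s, ∃ k : K, z = y * algebraMap K _ k) →
      ∃ k : K, s.prod = y ^ (Multiset.card s) * algebraMap K _ k := by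
    intro s
    induction s using Multiset.induction with
    | empty => intro _; exact ⟨1, by simp⟩
    | cons a s ih =>
      intro h
      obtain ⟨k, hk⟩ := ih (fun z hz => h z (Multiset.mem_cons_of_mem hz))
      obtain ⟨k', hk'⟩ := h a (Multiset.mem_cons_self a s)
      refine ⟨k' * k, ?_⟩
      rw [Multiset.prod_cons, hk, hk', Multiset.card_cons, map_mul]; ring
  obtain ⟨k, hk⟩ := hprod _ hroot
  have hs : (P.map (algebraMap K (AlgebraicClosure K))).Splits := IsAlgClosed.splits _
  have hc := hs.coeff_zero_eq_prod_roots_of_monic (hPm.map _)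
  have hcard : Multiset.card (P.aroots (AlgebraicClosure K)) = P.natDegree := by
    rw [aroots, ← hs.natDegree_eq_card_roots, natDegree_map]
  set e := P.natDegree with he
  have hye : ∃ c : K, c ≠ 0 ∧ y ^ e = algebraMap K _ c := by
    have h0 : P.coeff 0 ≠ 0 := minpoly.coeff_zero_ne_zero hyint hy0
    have h1 : algebraMap K (AlgebraicClosure K) (P.coeff 0) = (-1) ^ e * (y ^ e * algebraMap K _ k) := by
      rw [← coeff_map, hc, natDegree_map]
      congr 1
      change (P.aroots (AlgebraicClosure K)).prod = _
      rw [hk, hcard]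
    have hk0 : k ≠ 0 := by
      rintro rfl
      simp at h1; exact h0 h1
    refine ⟨(-1) ^ e * P.coeff 0 / k, div_ne_zero (mul_ne_zero (pow_ne_zero _ (by simp)) h0) hk0, ?_⟩
    have hk0' : algebraMap K (AlgebraicClosure K) k ≠ 0 := by simpa using hk0
    rw [map_div₀, map_mul, h1, eq_div_iff hk0']
    have : ((-1 : AlgebraicClosure K) ^ e) * (-1) ^ e = 1 := by rw [← mul_pow]; simp
    simp only [map_pow, map_neg, map_one]
    rw [← mul_assoc, this, one_mul]
  obtain ⟨c, hc0, hc⟩ := hye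
  have hg : ∃ c' : K, y ^ (Nat.gcd e d) = algebraMap K _ c' := by
    refine ⟨c ^ (Nat.gcdA e d) * u ^ (Nat.gcdB e d), ?_⟩
    rw [map_mul, map_zpow₀, map_zpow₀, ← hc, ← hy, ← zpow_natCast, ← zpow_natCast, ← zpow_natCast, ← zpow_mul, ← zpow_mul,
      ← zpow_add₀ hy0, Nat.gcd_eq_gcd_ab]
  obtain ⟨c', hc'⟩ := hg
  have hgd : Nat.gcd e d = d := by
    by_contra hne
    obtain ⟨f, hf⟩ := Nat.gcd_dvd_right e d
    have hf1 : f ≠ 1 := by rintro rfl; apply hne; simpa using hf.symm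
    obtain ⟨b, hbp, g, hg⟩ := Nat.exists_prime_and_dvd hf1
    apply hb b hbp ((Dvd.intro g hg.symm).trans (Dvd.intro_left _ hf.symm)) (c' ^ g)
    apply (algebraMap K (AlgebraicClosure K)).injective
    rw [← pow_mul, map_pow, ← hc', ← hy, ← pow_mul]
    congr 1
    conv_rhs => rw [hf, hg]
    ring
  have hde : d ≤ e := Nat.le_of_dvd (minpoly.natDegree_pos hyint) (hgd ▸ Nat.gcd_dvd_left e d)
  have : X ^ d - C u = P := by
    refine (eq_of_monic_of_dvd_of_natDegree_le hPm (monic_X_pow_sub_C u hd.ne') hdvd ?_)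
    rw [natDegree_X_pow_sub_C]; exact hde
  rw [this]; exact hPirr
end PartA1

section PartA2
open Polynomial

theorem natDegree_det_le {E : Type} [Field E] {N B : ℕ} (M : Matrix (Fin N) (Fin N) E[X])
    (hM : ∀ i j, (M i j).natDegree ≤ B) : M.det.natDegree ≤ N * B := by
  rw [Matrix.det_apply]
  refine natDegree_sum_le_of_forall_le _ _ ?_
  intro σ _
  have h1 : (∏ i, M (σ i) i).natDegree ≤ N * B := by
    refine (natDegree_prod_le _ _).trans ?_
    refine (Finset.sum_le_sum (fun i _ => hM (σ i) i)).trans ?_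
    simp
  rcases Int.units_eq_one_or (Equiv.Perm.sign σ) with h | h <;> rw [h] <;> simpa using h1

theorem natDegree_resultant_le {E : Type} [Field E] {m n B : ℕ} (f g : E[X][X])
    (hf : ∀ i, (f.coeff i).natDegree ≤ B) (hg : ∀ i, (g.coeff i).natDegree ≤ B) :
    (resultant f g m n).natDegree ≤ (m + n) * B := by
  unfold resultant
  apply natDegree_det_le
  intro i j
  unfold sylvester
  rw [Matrix.of_apply]
  refine Fin.addCases (fun j => ?_) (fun j => ?_) j
  · rw [Fin.addCases_left]; split_ifs
    · exact hg _
    · simp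
  · rw [Fin.addCases_right]; split_ifs
    · exact hf _
    · simp

theorem indep_core {E : Type} [Field E] {d : ℕ} (hd : 0 < d) {ζ : E} (hζ : IsPrimitiveRoot ζ d)
    (H : E[X]) (hH : ∀ b : ℕ, b.Prime → b ∣ d → ∀ (c : E) (V : E[X]), H ≠ C c * V ^ b)
    {s e : ℕ} (hs : s = 1 + d * e) {a : E} (ha : a ≠ 0) (hHs : X ^ s ∣ H ^ s - C a)
    {B : ℕ} (hB : 2 * d * B < s) (hHB : H.natDegree ≤ B)
    (k : ℕ → E[X]) (hk : ∀ i, (k i).natDegree ≤ B)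
    (hdvd : X ^ s ∣ ∑ i ∈ Finset.range d, k i * H ^ (e * i)) : ∀ i < d, k i = 0 := by
  have hH0 : H ≠ 0 := by
    rintro rfl
    rw [zero_pow (by omega), zero_sub, dvd_neg] at hHs
    have := natDegree_le_of_dvd hHs (by simpa using ha)
    simp at this; omega
  set P : E[X][X] := ∑ i ∈ Finset.range d, C (k i) * X ^ i with hPdef
  have hPc : ∀ j, P.coeff j = if j < d then k j else 0 := by
    intro j
    simp [hPdef, coeff_C_mul, coeff_X_pow]
  by_contra hcon
  push Not at hcon
  obtain ⟨i0, hi0, hki0⟩ := hcon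
  have hP0 : P ≠ 0 := by
    intro h
    have := hPc i0
    rw [h, if_pos hi0] at this
    exact hki0 (by simpa using this.symm)
  set Q : E[X][X] := C H * X ^ d - C (C a) with hQdef
  have hQdeg : Q.natDegree = d := by
    rw [hQdef, natDegree_sub_C, natDegree_C_mul_X_pow d H hH0]
  have hPdeg : P.natDegree < d := by
    rw [natDegree_lt_iff_degree_lt hP0, degree_lt_iff_coeff_zero]
    intro m hm
    rw [hPc, if_neg (by omega)]
  obtain ⟨p, q, -, -, hpq⟩ := exists_mul_add_mul_eq_C_resultant P Q le_rfl le_rfl (Or.inr (by omega))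
  set r := P.resultant Q P.natDegree Q.natDegree with hr
  have hrdeg : r.natDegree < s := by
    refine lt_of_le_of_lt (natDegree_resultant_le (B := B) P Q ?_ ?_) ?_
    · intro i; rw [hPc]; split_ifs
      · exact hk i
      · simp
    · intro i
      rw [hQdef, coeff_sub, coeff_C_mul, coeff_X_pow, coeff_C]
      refine (natDegree_sub_le _ _).trans ?_
      split_ifs <;> simp [hHB]
    · rw [hQdeg]
      refine lt_of_le_of_lt (Nat.mul_le_mul_right B (show P.natDegree + d ≤ 2 * d by omega)) hB
  have hXr : X ^ s ∣ r := by
    have h1 := congrArg (eval (H ^ e)) hpq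
    rw [eval_add, eval_mul, eval_mul, eval_C] at h1
    rw [← h1]
    refine dvd_add (Dvd.dvd.mul_right ?_ _) (Dvd.dvd.mul_right ?_ _)
    · rw [hPdef, eval_finsetSum]
      simpa [← pow_mul] using hdvd
    · rw [hQdef]
      have : eval (H ^ e) (C H * X ^ d - C (C a)) = H ^ s - C a := by
        rw [eval_sub, eval_mul, eval_C, eval_pow, eval_X, eval_C, ← pow_mul, hs, pow_add, pow_one, mul_comm e d]
      rw [this]; exact hHs
  have hr0 : r = 0 := by
    by_contra h
    have := natDegree_le_of_dvd hXr h
    simp at this; omega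
  let F := FractionRing E[X]
  have hinj : Function.Injective (algebraMap E[X] F) := IsFractionRing.injective _ _
  have hres : resultant (P.map (algebraMap E[X] F)) (Q.map (algebraMap E[X] F)) = 0 := by
    have := resultant_map_map P Q P.natDegree Q.natDegree (algebraMap E[X] F)
    rw [natDegree_map_eq_of_injective hinj, natDegree_map_eq_of_injective hinj, this, ← hr, hr0, map_zero]
  rw [resultant_eq_zero_iff] at hres
  apply hres.2
  set u : F := algebraMap E[X] F (C a) / algebraMap E[X] F H with hu
  have hHF : algebraMap E[X] F H ≠ 0 := by rwa [Ne, map_eq_zero_iff _ hinj]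
  have haF : algebraMap E[X] F (C a) ≠ 0 := by rw [Ne, map_eq_zero_iff _ hinj]; simpa using ha
  have hu0 : u ≠ 0 := div_ne_zero haF hHF
  have hirr : Irreducible (X ^ d - C u : F[X]) := by
    have hζ' : IsPrimitiveRoot (algebraMap E[X] F (C ζ)) d :=
      hζ.map_of_injective (f := (algebraMap E[X] F).comp C) (hinj.comp C_injective)
    refine irr_kummer hd hζ' hu0 ?_
    intro b hb hbd v hv
    obtain ⟨x, y, hy, rfl⟩ := IsFractionRing.div_surjective (A := E[X]) v
    have hy0 : y ≠ 0 := nonZeroDivisors.ne_zero hy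
    have hyF : algebraMap E[X] F y ≠ 0 := by rwa [Ne, map_eq_zero_iff _ hinj]
    rw [div_pow, hu, div_eq_div_iff (pow_ne_zero _ hyF) hHF, ← map_pow, ← map_pow, ← map_mul, ← map_mul] at hv
    have h1 := hinj hv
    have hx0 : x ≠ 0 := by
      rintro rfl
      rw [zero_pow hb.ne_zero, zero_mul] at h1
      exact (mul_ne_zero (by simpa using ha) (pow_ne_zero _ hy0)) h1.symm
    have hxy : x ^ b ∣ y ^ b := by
      have : x ^ b ∣ C a * y ^ b := ⟨H, h1.symm⟩
      have hua : IsUnit (C a : E[X]) := isUnit_C.2 ha.isUnit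
      exact hua.dvd_mul_left.1 this
    obtain ⟨w, hw⟩ := (UniqueFactorizationMonoid.pow_dvd_pow_iff_dvd hb.ne_zero).1 hxy
    apply hH b hb hbd a w
    apply mul_left_cancel₀ (pow_ne_zero b hx0)
    rw [h1, hw]; ring
  have hQF : Q.map (algebraMap E[X] F) = C (algebraMap E[X] F H) * (X ^ d - C u) := by
    rw [hQdef, mul_sub, ← C_mul, hu, mul_div_cancel₀ _ hHF]
    simp
  rw [hQF]
  have hun : IsUnit (C (algebraMap E[X] F H)) := isUnit_C.2 hHF.isUnit
  rw [isCoprime_mul_unit_left_right hun]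
  refine (hirr.coprime_iff_not_dvd.2 ?_).symm
  intro hdv
  have h2 := natDegree_le_of_dvd hdv (by rwa [Ne, Polynomial.map_eq_zero_iff hinj])
  rw [natDegree_X_pow_sub_C, natDegree_map_eq_of_injective hinj] at h2
  omega

theorem indep_full {E : Type} [Field E] {d : ℕ} (hd : 0 < d) {ζ : E} (hζ : IsPrimitiveRoot ζ d)
    (H : E[X]) (hH : ∀ b : ℕ, b.Prime → b ∣ d → ∀ (c : E) (V : E[X]), H ≠ C c * V ^ b)
    {s e : ℕ} (hs : s = 1 + d * e) {a : E} (ha : a ≠ 0) (hHs : X ^ s ∣ H ^ s - C a)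
    {B : ℕ} (hB : 2 * d * B < s) (hHB : H.natDegree ≤ B) (K : ℕ)
    (k : ℕ → ℕ → E[X]) (hk : ∀ i j, (k i j).natDegree ≤ B)
    (h0 : ∑ j ∈ Finset.range K, X ^ (j * s) * ∑ i ∈ Finset.range d, k i j * H ^ (e * i) = 0) :
    ∀ j < K, ∀ i < d, k i j = 0 := by
  induction K generalizing k with
  | zero => intro j hj; omega
  | succ K ih =>
    rw [Finset.sum_range_succ'] at h0
    have hz : ∀ i < d, k i 0 = 0 := by
      refine indep_core hd hζ H hH hs ha hHs hB hHB (fun i => k i 0) (fun i => hk i 0) ?_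
      have : ∑ i ∈ Finset.range d, k i 0 * H ^ (e * i) = - ∑ j ∈ Finset.range K, X ^ ((j + 1) * s) * ∑ i ∈ Finset.range d, k i (j + 1) * H ^ (e * i) := by
        rw [eq_neg_iff_add_eq_zero, add_comm]
        simpa using h0
      rw [this, dvd_neg]
      refine Finset.dvd_sum (fun j _ => Dvd.dvd.mul_right (pow_dvd_pow _ ?_) _)
      nlinarith
    have hz' : ∑ i ∈ Finset.range d, k i 0 * H ^ (e * i) = 0 :=
      Finset.sum_eq_zero (fun i hi => by rw [hz i (Finset.mem_range.1 hi), zero_mul])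
    rw [hz', mul_zero, add_zero] at h0
    have h1 := ih (fun i j => k i (j + 1)) (fun i j => hk i (j + 1)) (by
      have hX : (X : E[X]) ^ s ≠ 0 := pow_ne_zero _ X_ne_zero
      apply mul_left_cancel₀ hX
      rw [mul_zero, ← h0, Finset.mul_sum]
      refine Finset.sum_congr rfl (fun j _ => ?_)
      rw [← mul_assoc, ← pow_add]; congr 2; ring)
    intro j hj i hi
    rcases j with _ | j
    · exact hz i hi
    · exact h1 j (by omega) i hi
end PartA2

section PartA3
open Polynomial

theorem stepanov_count {E : Type} [Field E] [Fintype E] {p v : ℕ} [hp : Fact p.Prime] [CharP E p]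
    {d s e : ℕ} (hd : 0 < d) (hsv : s = p ^ v) (hs : s = 1 + d * e) (hR : Fintype.card E = s * s)
    (H : E[X]) (hH : ∀ b : ℕ, b.Prime → b ∣ d → ∀ (c : E) (V : E[X]), H ≠ C c * V ^ b)
    (hH0 : H.eval 0 ≠ 0) {B : ℕ} (hB : 2 * d * B < s) (hHB : H.natDegree ≤ B) (K : ℕ)
    (hK : s * B + K + H.natDegree * s < d * K * (B + 1)) (c : E) (A : Finset E)
    (hA : ∀ x ∈ A, H.eval x ≠ 0 ∧ H.eval x ^ (e * (s + 1)) = c) :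
    A.card ≤ B + K * s + H.natDegree * s := by
  classical
  have hs0 : 0 < s := by omega
  have hed : e * (d - 1) ≤ s := by
    rw [hs]; nlinarith [Nat.sub_le d 1]
  obtain ⟨ζ, hζ⟩ : ∃ ζ : E, IsPrimitiveRoot ζ d := by
    obtain ⟨g, hg⟩ := IsCyclic.exists_ofOrder_eq_natCard (α := Eˣ)
    have hcard : Nat.card Eˣ = d * (e * (s + 1)) := by
      rw [Nat.card_eq_fintype_card, Fintype.card_units, hR]
      have : s * s = d * (e * (s + 1)) + 1 := by rw [hs]; ring
      omega
    have hpos : 0 < Nat.card Eˣ := Nat.card_pos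
    have := (IsPrimitiveRoot.orderOf g)
    rw [hg] at this
    exact ⟨_, (IsPrimitiveRoot.coe_units_iff.2 this).pow hpos (hcard.trans (mul_comm _ _))⟩
  set N := s * B + K + H.natDegree * s with hN
  let ι := Fin d × Fin K × Fin (B + 1)
  let w : ι → E[X] := fun t => X ^ (s * (t.2.2 : ℕ)) * H ^ (e * (d - 1 - (t.1 : ℕ))) * X ^ (t.2.1 : ℕ) * C (c ^ (t.1 : ℕ))
  have hwdeg : ∀ t, w t ∈ degreeLT E N := by
    intro t
    rw [mem_degreeLT]
    refine lt_of_le_of_lt degree_le_natDegree ?_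
    rw [Nat.cast_lt]
    have h1 : (t.2.2 : ℕ) ≤ B := Nat.lt_succ_iff.1 t.2.2.2
    have h2 : (t.2.1 : ℕ) < K := t.2.1.2
    have h3 : (w t).natDegree ≤ s * (t.2.2 : ℕ) + (e * (d - 1 - (t.1 : ℕ))) * H.natDegree + (t.2.1 : ℕ) := by
      refine (natDegree_mul_C_le _ _).trans ?_
      refine natDegree_mul_le.trans ?_
      refine add_le_add (natDegree_mul_le.trans (add_le_add ?_ natDegree_pow_le)) ?_ <;> simp
    have h4 : e * (d - 1 - (t.1 : ℕ)) ≤ s := (Nat.mul_le_mul_left e (Nat.sub_le _ _)).trans hed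
    have h5 : (e * (d - 1 - (t.1 : ℕ))) * H.natDegree ≤ H.natDegree * s := by
      rw [mul_comm]; exact Nat.mul_le_mul_left _ h4
    have h6 : s * (t.2.2 : ℕ) ≤ s * B := Nat.mul_le_mul_left _ h1
    omega
  have hnot : ¬ LinearIndependent E (fun t : ι => (⟨w t, hwdeg t⟩ : degreeLT E N)) := by
    intro hli
    have h1 := hli.fintype_card_le_finrank
    rw [(degreeLTEquiv E N).finrank_eq, Module.finrank_fin_fun] at h1
    simp only [ι, Fintype.card_prod, Fintype.card_fin] at h1
    rw [← mul_assoc] at h1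
    omega
  rw [Fintype.not_linearIndependent_iff] at hnot
  obtain ⟨g, hg, t0, ht0⟩ := hnot
  have hg' : ∑ t : ι, g t • w t = 0 := by
    have := congrArg (Submodule.subtype (degreeLT E N)) hg
    simpa using this
  have hfrob : ∀ x : E, ∃ y : E, y ^ s = x := by
    intro x
    obtain ⟨y, hy⟩ := (bijective_iterateFrobenius E p v).2 x
    exact ⟨y, by rw [hsv]; simpa [iterateFrobenius_def] using hy⟩
  choose root hroot using hfrob
  let b : ι → E := fun t => root (g t)
  let kk : Fin d → Fin K → E[X] := fun i j => ∑ l : Fin (B + 1), C (b (i, j, l)) * X ^ (l : ℕ)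
  let k : ℕ → ℕ → E[X] := fun i j => if h : i < d ∧ j < K then kk ⟨i, h.1⟩ ⟨j, h.2⟩ else 0
  have hkdeg : ∀ i j, (k i j).natDegree ≤ B := by
    intro i j
    simp only [k]
    split_ifs
    · refine natDegree_sum_le_of_forall_le _ _ (fun l _ => ?_)
      exact (natDegree_C_mul_X_pow_le _ _).trans (Nat.lt_succ_iff.1 l.2)
    · simp
  set h : E[X] := ∑ j ∈ Finset.range K, X ^ (j * s) * ∑ i ∈ Finset.range d, k i j * H ^ (e * i) with hh
  have hne : h ≠ 0 := by
    intro h0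
    have hdv : X ^ s ∣ H ^ s - C (H.eval 0 ^ s) := by
      have h1 : (X : E[X]) ∣ H - C (H.eval 0) := by
        rw [X_dvd_iff]; simp [coeff_zero_eq_eval_zero]
      have h2 := pow_dvd_pow_of_dvd h1 s
      have h3 : (H - C (H.eval 0)) ^ s = H ^ s - C (H.eval 0 ^ s) := by
        rw [hsv, sub_pow_char_pow, C_pow]
      rwa [h3] at h2
    have hz := indep_full hd hζ H hH hs (pow_ne_zero s hH0) hdv hB hHB K k hkdeg h0
    have h1 := hz t0.2.1 t0.2.1.2 t0.1 t0.1.2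
    simp only [k, t0.1.2, t0.2.1.2, and_self, dif_pos] at h1
    have h2 : (kk t0.1 t0.2.1).coeff (t0.2.2 : ℕ) = b t0 := by
      simp only [kk, finsetSum_coeff, coeff_C_mul, coeff_X_pow]
      rw [Finset.sum_eq_single t0.2.2]
      · simp
      · intro l _ hl
        have : ¬ ((t0.2.2 : ℕ) = (l : ℕ)) := fun h => hl (Fin.ext h.symm)
        simp [this]
      · simp
    have h3 : b t0 = 0 := by rw [← h2]; simpa using congrArg (fun q => q.coeff (t0.2.2 : ℕ)) h1
    apply ht0
    rw [← hroot (g t0)]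
    change b t0 ^ s = 0
    rw [h3, zero_pow hs0.ne']
  have hdeg : h.natDegree ≤ B + K * s + H.natDegree * s := by
    refine natDegree_sum_le_of_forall_le _ _ (fun j hj => ?_)
    have hj' := Finset.mem_range.1 hj
    refine natDegree_mul_le.trans ?_
    have h1 : (∑ i ∈ Finset.range d, k i j * H ^ (e * i)).natDegree ≤ B + H.natDegree * s := by
      refine natDegree_sum_le_of_forall_le _ _ (fun i hi => ?_)
      have hi' := Finset.mem_range.1 hi
      refine natDegree_mul_le.trans (add_le_add (hkdeg i j) ?_)
      refine natDegree_pow_le.trans ?_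
      rw [mul_comm]
      exact Nat.mul_le_mul_left _ ((Nat.mul_le_mul_left e (by omega)).trans hed)
    have h2 : j * s ≤ K * s := Nat.mul_le_mul_right _ hj'.le
    have h3 : (X ^ (j * s) : E[X]).natDegree ≤ j * s := by simp
    omega
  have hzero : ∀ x ∈ A, h.IsRoot x := by
    intro x hx
    obtain ⟨hx0, hxc⟩ := hA x hx
    have hxR : x ^ (s * s) = x := by rw [← hR]; exact FiniteField.pow_card x
    rw [IsRoot]
    have hkeval : ∀ (i : Fin d) (j : Fin K), (eval x (k i j)) ^ s = ∑ l : Fin (B + 1), g (i, j, l) * x ^ (s * (l : ℕ)) := by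
      intro i j
      simp only [k, i.2, j.2, and_self, dif_pos, kk]
      rw [eval_finsetSum, hsv, sum_pow_char_pow, ← hsv]
      refine Finset.sum_congr rfl (fun l _ => ?_)
      simp only [eval_mul, eval_C, eval_pow, eval_X, mul_pow]
      rw [show b (i, j, l) ^ s = g (i, j, l) from hroot _, ← pow_mul, mul_comm s]
    have key : (eval x H) ^ (e * (d - 1)) * (eval x h) ^ s = 0 := by
      have h1 : (eval x h) ^ s = ∑ j : Fin K, ∑ i : Fin d, x ^ (j : ℕ) * ((eval x (k i j)) ^ s * (eval x H) ^ (e * i * s)) := by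
        rw [hh, eval_finsetSum, hsv, sum_pow_char_pow, ← hsv, Finset.sum_range]
        refine Finset.sum_congr rfl (fun j _ => ?_)
        rw [eval_mul, mul_pow, eval_pow, eval_X, eval_finsetSum, hsv, sum_pow_char_pow, ← hsv, Finset.sum_range, Finset.mul_sum]
        refine Finset.sum_congr rfl (fun i _ => ?_)
        rw [← pow_mul, eval_mul, mul_pow, eval_pow, ← pow_mul, mul_assoc (j : ℕ), mul_comm (j : ℕ), pow_mul x, hxR]
      have h2 := congrArg (eval x) hg'
      rw [eval_finsetSum, eval_zero] at h2
      rw [h1, ← h2, Finset.mul_sum, Fintype.sum_prod_type_right, Fintype.sum_prod_type]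
      refine Finset.sum_congr rfl (fun j _ => ?_)
      rw [Finset.mul_sum, Finset.sum_comm]
      refine Finset.sum_congr rfl (fun i _ => ?_)
      rw [hkeval i j, Finset.sum_mul, Finset.mul_sum, Finset.mul_sum]
      refine Finset.sum_congr rfl (fun l _ => ?_)
      simp only [w, eval_smul, eval_mul, eval_pow, eval_X, eval_C, smul_eq_mul]
      have h3 : (eval x H) ^ (e * (d - 1)) * (eval x H) ^ (e * i * s) = (eval x H) ^ (e * (d - 1 - (i : ℕ))) * c ^ (i : ℕ) := by
        rw [← hxc, ← pow_mul, ← pow_add, ← pow_add]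
        congr 1
        have hi := i.2
        obtain ⟨m, hm⟩ : ∃ m, d - 1 = m + i := ⟨d - 1 - i, by omega⟩
        rw [hm, Nat.add_sub_cancel]
        ring
      linear_combination (g (i, j, l) * x ^ (s * (l : ℕ)) * x ^ (j : ℕ)) * h3
    rcases mul_eq_zero.1 key with h1 | h1
    · exact absurd h1 (pow_ne_zero _ hx0)
    · exact pow_eq_zero_iff hs0.ne' |>.1 h1
  refine le_trans ?_ hdeg
  exact card_le_degree_of_subset_roots (Z := A) (fun x hx => by
    rw [mem_roots hne]; exact hzero x hx)
end PartA3

section PartA4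
open Polynomial

theorem not_pow_comp {E : Type} [Field E] {H : E[X]} {b : ℕ} (y : E)
    (hH : ∀ (c : E) (V : E[X]), H ≠ C c * V ^ b) (c : E) (V : E[X]) :
    H.comp (X + C y) ≠ C c * V ^ b := by
  intro h
  apply hH c (V.comp (X - C y))
  have := congrArg (fun q => q.comp (X - C y)) h
  simpa [comp_assoc] using this

/-- count for fibers -/
theorem fiber_count {E : Type} [Field E] [Fintype E] {p v : ℕ} [hp : Fact p.Prime] [CharP E p]
    {d s e δ : ℕ} (hd : 2 ≤ d) (hsv : s = p ^ v) (hs : s = 1 + d * e)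
    (hR : Fintype.card E = s * s)
    (H : E[X]) (hH : ∀ b : ℕ, b.Prime → b ∣ d → ∀ (c : E) (V : E[X]), H ≠ C c * V ^ b)
    (hδ : H.natDegree ≤ δ) (hbig : 2 * δ ≤ e) (c : E) (A : Finset E)
    (hA : ∀ x ∈ A, H.eval x ≠ 0 ∧ H.eval x ^ (e * (s + 1)) = c) :
    A.card ≤ e * s + (5 * δ + 9) * s := by
  classical
  rcases A.eq_empty_or_nonempty with rfl | ⟨y, hy⟩
  · simp
  have hdeg : (H.comp (X + C y)).natDegree = H.natDegree := by
    rw [natDegree_comp, natDegree_X_add_C, mul_one]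
  set B := e / 2 with hBdef
  have hB2 : 2 * B ≤ e := by omega
  have hB3 : e ≤ 2 * B + 1 := by omega
  have hmain := stepanov_count (E := E) (p := p) (v := v) (d := d) (s := s) (e := e) (by omega) hsv hs hR
    (H.comp (X + C y)) (fun b hb hbd => not_pow_comp y (hH b hb hbd)) (by simpa using (hA y hy).1)
    (B := B) (by rw [hs]; nlinarith) (by rw [hdeg]; omega) (e + (4 * δ + 8)) (by
      rw [hdeg]
      have h1 : d * (2 * B + 2) ≥ s + 1 := by rw [hs]; nlinarith
      have h2 : H.natDegree * s ≤ δ * s := Nat.mul_le_mul_right _ hδ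
      have h3 : d * B ≥ 2 * B := Nat.mul_le_mul_right _ hd
      have h4 : e + B + 1 ≤ 2 * s := by rw [hs]; nlinarith
      have h5 : 4 * (d * (B + 1)) ≥ s + 4 := by nlinarith
      have h6 : d * (e + (4 * δ + 8)) * (B + 1) = s * B + s - (B + 1) + (4 * δ + 8) * (d * (B + 1)) := by
        have : s * B + s - (B + 1) = d * e * (B + 1) := by
          have : s * B + s = d * e * (B + 1) + (B + 1) := by rw [hs]; ring
          omega
        rw [this]; ring
      rw [h6]
      have h7 : (4 * δ + 8) * (d * (B + 1)) ≥ (δ + 2) * (s + 4) := by nlinarith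
      have h8 : B + 1 ≤ s := by rw [hs]; nlinarith
      have h9 : (δ + 2) * (s + 4) = δ * s + 2 * s + 4 * δ + 8 := by ring
      have h10 : s * B + s - (B + 1) + (B + 1) = s * B + s := by omega
      have h11 : e + B + 1 < s + 1 := by rw [hs]; nlinarith
      omega) c (A.map ⟨fun x => x - y, fun a b h => by simpa using h⟩) (by
      intro x hx
      rw [Finset.mem_map] at hx
      obtain ⟨z, hz, rfl⟩ := hx
      have hz2 := hA z hz
      have hz3 : (H.comp (X + C y)).eval (z - y) = H.eval z := by simp
      change (H.comp (X + C y)).eval (z - y) ≠ 0 ∧ (H.comp (X + C y)).eval (z - y) ^ (e * (s + 1)) = c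
      rw [hz3]
      exact hz2)
  rw [Finset.card_map, hdeg] at hmain
  refine hmain.trans ?_
  have h2 : H.natDegree * s ≤ δ * s := Nat.mul_le_mul_right _ hδ
  have : B ≤ s := by rw [hs]; nlinarith
  nlinarith

theorem crude_prim {E : Type} [Field E] [Fintype E] {p v : ℕ} [hp : Fact p.Prime] [CharP E p]
    {d s e δ : ℕ} (hd : 2 ≤ d) (hsv : s = p ^ v) (hs : s = 1 + d * e)
    (hR : Fintype.card E = s * s)
    (H : E[X]) (hH : ∀ b : ℕ, b.Prime → b ∣ d → ∀ (c : E) (V : E[X]), H ≠ C c * V ^ b)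
    (hδ : H.natDegree ≤ δ) (hbig : 2 * δ ≤ e) (η : MulChar E ℂ) (hη : orderOf η = d) :
    ‖∑ y : E, η (H.eval y)‖ ≤ (d * (5 * δ + 9) + δ) * s := by
  classical
  have hs0 : 0 < s := by omega
  have hH0 : H ≠ 0 := by
    intro h
    obtain ⟨b, hb, hbd⟩ := Nat.exists_prime_and_dvd (n := d) (by omega)
    exact hH b hb hbd 0 0 (by simp [h])
  obtain ⟨g, hg⟩ := IsCyclic.exists_generator (α := Eˣ)
  set ζ : ℂ := η (g : E) with hζdef
  have hord : orderOf ζ = d := by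
    rw [← hη]
    apply Nat.dvd_antisymm
    · apply orderOf_dvd_of_pow_eq_one
      rw [hζdef, ← MulChar.pow_apply_coe, pow_orderOf_eq_one, MulChar.one_apply_coe]
    · apply orderOf_dvd_of_pow_eq_one
      ext u
      obtain ⟨k, rfl⟩ := Subgroup.mem_zpowers_iff.1 (hg u)
      obtain ⟨k, hk⟩ : ∃ m : ℕ, g ^ k = g ^ m := by
        obtain ⟨m, hm⟩ := (mem_powers_iff_mem_zpowers (x := g) (y := g ^ k)).2 ⟨k, rfl⟩
        exact ⟨m, hm.symm⟩
      rw [hk, MulChar.pow_apply_coe, MulChar.one_apply_coe, Units.val_pow_eq_pow_val, map_pow,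
        ← hζdef, ← pow_mul, mul_comm, pow_mul, pow_orderOf_eq_one, one_pow]
  have hprim : IsPrimitiveRoot ζ d := hord ▸ IsPrimitiveRoot.orderOf ζ
  have hcard : Fintype.card Eˣ = d * (e * (s + 1)) := by
    rw [Fintype.card_units, hR]
    have : s * s = d * (e * (s + 1)) + 1 := by rw [hs]; ring
    omega
  have hpw : ∀ u : Eˣ, ∃ m : ℕ, u = g ^ m := fun u => by
    obtain ⟨m, hm⟩ := (mem_powers_iff_mem_zpowers (x := g) (y := u)).2 (hg u)
    exact ⟨m, hm.symm⟩
  have hker : ∀ u : E, η u = 1 → u ^ (e * (s + 1)) = 1 := by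
    intro u hu
    have hu0 : u ≠ 0 := by
      rintro rfl
      rw [MulChar.map_zero] at hu
      exact zero_ne_one hu
    obtain ⟨m, hm⟩ := hpw (Units.mk0 u hu0)
    have hm' : u = (g : E) ^ m := by
      have := congrArg Units.val hm
      simpa using this
    rw [hm', map_pow] at hu
    obtain ⟨t, ht⟩ := hord ▸ orderOf_dvd_of_pow_eq_one hu
    rw [hm', ht, ← pow_mul, show d * t * (e * (s + 1)) = (d * (e * (s + 1))) * t by ring, pow_mul,
      ← hcard, ← Units.val_pow_eq_pow_val, pow_card_eq_one, Units.val_one, one_pow]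
  have hval : ∀ u : E, u ≠ 0 → ∃ j ∈ Finset.range d, η u = ζ ^ j := by
    intro u hu0
    obtain ⟨m, hm⟩ := hpw (Units.mk0 u hu0)
    have hm' : u = (g : E) ^ m := by
      have := congrArg Units.val hm
      simpa using this
    refine ⟨m % d, Finset.mem_range.2 (Nat.mod_lt _ (by omega)), ?_⟩
    rw [hm', map_pow, ← hord, pow_mod_orderOf]
  choose! J hJ1 hJ2 using hval
  set Y := Finset.univ.filter (fun y : E => H.eval y ≠ 0) with hY
  let N : ℕ → ℕ := fun j => (Y.filter (fun y => J (H.eval y) = j)).card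
  have hmaps : ∀ y ∈ Y, J (H.eval y) ∈ Finset.range d := fun y hy => by
    exact hJ1 _ (by simpa [hY] using hy)
  have hsum : ∑ y : E, η (H.eval y) = ∑ j ∈ Finset.range d, (N j : ℂ) * ζ ^ j := by
    rw [← Finset.sum_filter_add_sum_filter_not Finset.univ (fun y : E => H.eval y ≠ 0)]
    rw [Finset.sum_eq_zero (s := Finset.univ.filter (fun y : E => ¬ H.eval y ≠ 0)), add_zero,
      ← Finset.sum_fiberwise_of_maps_to hmaps]
    · refine Finset.sum_congr rfl (fun j _ => ?_)
      rw [Finset.sum_congr rfl (g := fun _ => ζ ^ j)]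
      · simp [N]
      · intro y hy
        rw [Finset.mem_filter] at hy
        rw [← hy.2]
        exact hJ2 _ (by simpa [hY] using hy.1)
    · intro y hy
      have : H.eval y = 0 := by simpa using hy
      rw [this, MulChar.map_zero]
  set M := e * s + (5 * δ + 9) * s with hM
  have hNM : ∀ j ∈ Finset.range d, N j ≤ M := by
    intro j _
    rcases (Y.filter (fun y => J (H.eval y) = j)).eq_empty_or_nonempty with h0 | ⟨y0, hy0⟩
    · simp [N, h0]
    refine fiber_count hd hsv hs hR H hH hδ hbig (H.eval y0 ^ (e * (s + 1))) _ ?_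
    intro x hx
    rw [Finset.mem_filter] at hx hy0
    have hx0 : H.eval x ≠ 0 := by simpa [hY] using hx.1
    have hy00 : H.eval y0 ≠ 0 := by simpa [hY] using hy0.1
    refine ⟨hx0, ?_⟩
    have h1 : η (H.eval x) = η (H.eval y0) := by rw [hJ2 _ hx0, hJ2 _ hy00, hx.2, hy0.2]
    have h2 := hker (H.eval x * (H.eval y0)⁻¹) (by
      rw [map_mul, h1, ← map_mul, mul_inv_cancel₀ hy00, map_one])
    rw [mul_pow, inv_pow] at h2
    field_simp at h2
    exact h2
  have hYcard : s * s ≤ ∑ j ∈ Finset.range d, N j + δ := by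
    have h1 : Y.card = ∑ j ∈ Finset.range d, N j := Finset.card_eq_sum_card_fiberwise hmaps
    rw [← h1, ← hR, ← Finset.card_univ, ← Finset.card_filter_add_card_filter_not (fun y : E => H.eval y ≠ 0)]
    refine Nat.add_le_add_left ?_ _
    refine le_trans ?_ hδ
    exact card_le_degree_of_subset_roots (p := H) (fun x hx => by
      rw [mem_roots hH0]; simpa using hx)
  have hgeom : ∑ j ∈ Finset.range d, ζ ^ j = 0 := hprim.geom_sum_eq_zero (by omega)
  have h1 : ∑ y : E, η (H.eval y) = - ∑ j ∈ Finset.range d, ((M - N j : ℝ) : ℂ) * ζ ^ j := by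
    rw [hsum]
    have : ∑ j ∈ Finset.range d, ((M - N j : ℝ) : ℂ) * ζ ^ j
        = M * ∑ j ∈ Finset.range d, ζ ^ j - ∑ j ∈ Finset.range d, (N j : ℂ) * ζ ^ j := by
      rw [Finset.mul_sum, ← Finset.sum_sub_distrib]
      refine Finset.sum_congr rfl (fun j _ => ?_)
      push_cast; ring
    rw [this, hgeom]; ring
  rw [h1, norm_neg]
  have hζn : ‖ζ‖ = 1 := hprim.norm'_eq_one (by omega)
  refine (norm_sum_le _ _).trans ?_
  have h2 : ∀ j ∈ Finset.range d, ‖((M - N j : ℝ) : ℂ) * ζ ^ j‖ = (M : ℝ) - N j := by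
    intro j hj
    rw [norm_mul, norm_pow, hζn, one_pow, mul_one, Complex.norm_real, Real.norm_of_nonneg]
    have : (N j : ℝ) ≤ M := by exact_mod_cast hNM j hj
    linarith
  rw [Finset.sum_congr rfl h2, Finset.sum_sub_distrib]
  simp only [Finset.sum_const, Finset.card_range, nsmul_eq_mul]
  have h3 : (s : ℝ) * s ≤ ∑ j ∈ Finset.range d, (N j : ℝ) + δ := by exact_mod_cast hYcard
  have h4 : (s : ℝ) = 1 + d * e := by exact_mod_cast hs
  have h5 : (1 : ℝ) ≤ s := by exact_mod_cast hs0
  have h6 : (M : ℝ) = e * s + (5 * δ + 9) * s := by rw [hM]; push_cast; ring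
  have h7 : (d : ℝ) * M = (s - 1) * s + d * (5 * δ + 9) * s := by rw [h6, h4]; ring
  have h8 : (δ : ℝ) ≤ δ * s := by nlinarith [(Nat.cast_nonneg δ : (0:ℝ) ≤ δ)]
  nlinarith

theorem mulChar_norm_le_one {E : Type} [Field E] [Fintype E] (χ : MulChar E ℂ) (x : E) : ‖χ x‖ ≤ 1 := by
  classical
  by_cases hx : x = 0
  · rw [hx, MulChar.map_zero]; simp
  · have h1 : χ x ^ (Fintype.card E - 1) = 1 := by
      rw [← map_pow, FiniteField.pow_card_sub_one_eq_one x hx, map_one]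
    have h2 : Fintype.card E - 1 ≠ 0 := by
      have := Fintype.one_lt_card (α := E)
      omega
    exact (Complex.norm_eq_one_of_pow_eq_one h1 h2).le

theorem crude_bound (d' δ : ℕ) : ∃ C0 : ℝ, 0 ≤ C0 ∧ ∀ (E : Type) [Field E] [Fintype E] (p v s : ℕ) [Fact p.Prime]
    [CharP E p], s = p ^ v → Fintype.card E = s * s → d' ∣ s - 1 → ∀ (χ : MulChar E ℂ),
    orderOf χ = d' → ∀ U : E[X], U.natDegree ≤ δ → (∀ (c : E) (V : E[X]), U ≠ C c * V ^ d') →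
    ‖∑ y : E, χ (U.eval y)‖ ≤ C0 * s := by
  classical
  refine ⟨d' * (5 * δ + 9) + δ + d' * (2 * δ + 1) + 1, by positivity, ?_⟩
  intro E _ _ p v s _ _ hsv hR hds χ hχ U hU hUn
  have hs0 : 0 < s := by rw [hsv]; exact pow_pos (Fact.out : p.Prime).pos _
  have hd' : 0 < d' := by rw [← hχ]; exact orderOf_pos χ
  by_cases hbig : s ≤ d' * (2 * δ + 1)
  · refine (norm_sum_le _ _).trans ((Finset.sum_le_sum (fun y _ => mulChar_norm_le_one χ _)).trans ?_)
    simp only [Finset.sum_const, Finset.card_univ, nsmul_eq_mul, mul_one]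
    rw [hR]
    push_cast
    refine mul_le_mul_of_nonneg_right ?_ (Nat.cast_nonneg _)
    have : (s : ℝ) ≤ d' * (2 * δ + 1) := by exact_mod_cast hbig
    have : (0:ℝ) ≤ d' * (5 * δ + 9) + δ := by positivity
    linarith
  push Not at hbig
  set T := d'.divisors.filter (fun e => ∃ (c : E) (V : E[X]), U = C c * V ^ e) with hT
  have hTne : T.Nonempty := ⟨1, by
    rw [hT, Finset.mem_filter]
    exact ⟨Nat.one_mem_divisors.2 hd'.ne', 1, U, by simp⟩⟩
  obtain ⟨e, heT, hemax⟩ := T.exists_max_image id hTne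
  rw [hT, Finset.mem_filter, Nat.mem_divisors] at heT
  obtain ⟨⟨⟨d, hde⟩, -⟩, c, H, hUH⟩ := heT
  have he0 : 0 < e := by
    rcases Nat.eq_zero_or_pos e with h | h
    · subst h; simp at hde; omega
    · exact h
  have hd0 : 0 < d := by
    rcases Nat.eq_zero_or_pos d with h | h
    · subst h; simp at hde; omega
    · exact h
  have hd2 : 2 ≤ d := by
    by_contra h
    have : d = 1 := by omega
    subst this
    exact hUn c H (by rw [hde, mul_one]; exact hUH)
  have hc0 : c ≠ 0 := by
    rintro rfl
    exact hUn 0 0 (by rw [hUH]; simp)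
  have hdd' : d ≤ d' := by rw [hde]; exact Nat.le_mul_of_pos_left _ he0
  have hdegH : H.natDegree ≤ δ := by
    refine le_trans ?_ hU
    rw [hUH, natDegree_C_mul hc0, natDegree_pow]
    exact Nat.le_mul_of_pos_left _ he0
  obtain ⟨f, hf⟩ : d ∣ s - 1 := (Dvd.intro_left e hde.symm).trans hds
  have hs : s = 1 + d * f := by omega
  have hbig' : 2 * δ ≤ f := by
    by_contra h
    push Not at h
    have h1 : d * f ≤ d' * (2 * δ) := Nat.mul_le_mul hdd' h.le
    nlinarith
  have hη : orderOf (χ ^ e) = d := by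
    rw [orderOf_pow' _ he0.ne', hχ, hde, Nat.gcd_mul_right_left, Nat.mul_div_cancel_left _ he0]
  have hmain := crude_prim (p := p) (v := v) hd2 hsv hs hR H (by
    intro b hb hbd c' V hHV
    have hbe : b * e ∈ T := by
      rw [hT, Finset.mem_filter, Nat.mem_divisors]
      refine ⟨⟨by rw [hde, mul_comm]; exact Nat.mul_dvd_mul_left e hbd, hd'.ne'⟩, c * c' ^ e, V, ?_⟩
      rw [hUH, hHV, mul_pow, ← pow_mul, C_mul, C_pow]
      ring
    have h1 := hemax _ hbe
    simp only [id] at h1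
    have := hb.two_le
    nlinarith) hdegH hbig' (χ ^ e) hη
  have h1 : ∑ y : E, χ (U.eval y) = χ c * ∑ y : E, (χ ^ e) (H.eval y) := by
    rw [Finset.mul_sum]
    refine Finset.sum_congr rfl (fun y _ => ?_)
    rw [hUH, MulChar.pow_apply' _ he0.ne', eval_mul, eval_C, eval_pow, map_mul, map_pow]
  rw [h1, norm_mul]
  have h2 : ‖χ c‖ ≤ 1 := mulChar_norm_le_one χ c
  refine (mul_le_mul h2 hmain (norm_nonneg _) zero_le_one).trans ?_
  rw [one_mul]
  refine mul_le_mul_of_nonneg_right ?_ (Nat.cast_nonneg _)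
  have h3 : (d : ℝ) ≤ d' := by exact_mod_cast hdd'
  have h4 : (d : ℝ) * (5 * δ + 9) ≤ d' * (5 * δ + 9) := mul_le_mul_of_nonneg_right h3 (by positivity)
  have : (0:ℝ) ≤ d' * (2 * δ + 1) := by positivity
  linarith
end PartA4

section PartB1
open Polynomial

theorem rootMult_of_eq {R : Type*} [CommRing R] [IsDomain R] {A B : R[X]} {y : R} {μ : ℕ}
    (h : A = (X - C y) ^ μ * B) (hB : B.eval y ≠ 0) : rootMultiplicity y A = μ := by
  have hB0 : B ≠ 0 := by rintro rfl; simp at hB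
  rw [h, rootMultiplicity_mul (mul_ne_zero (pow_ne_zero _ (X_sub_C_ne_zero y)) hB0),
    rootMultiplicity_X_sub_C_pow, rootMultiplicity_eq_zero hB, add_zero]

theorem rootMult_pow' {R : Type*} [CommRing R] [IsDomain R] {A : R[X]} (hA : A ≠ 0) (y : R) (k : ℕ) :
    rootMultiplicity y (A ^ k) = k * rootMultiplicity y A := by
  induction k with
  | zero => simp [rootMultiplicity_eq_zero]
  | succ k ih => rw [pow_succ, rootMultiplicity_mul (mul_ne_zero (pow_ne_zero _ hA) hA), ih]; ring

theorem not_power_comp {L E : Type} [Field L] [Fintype L] [Field E] [Algebra L E]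
    {P F F' : L[X]} {μ d : ℕ} (hP : Irreducible P) (hF : F = P ^ μ * F') (hPF : ¬ P ∣ F')
    (hd : ¬ d ∣ μ) (x : E) (c : E) (V : E[X]) :
    (F.map (algebraMap L E)).comp (X ^ Fintype.card L - X + C x) ≠ C c * V ^ d := by
  intro h
  let W := AlgebraicClosure E
  set ι : L →+* W := (algebraMap E W).comp (algebraMap L E) with hι
  set Q := Fintype.card L with hQ
  have hQ1 : 1 < Q := Fintype.one_lt_card
  obtain ⟨β, hβ⟩ := IsAlgClosed.exists_root (P.map ι) (by
    rw [degree_map]; exact hP.degree_pos.ne')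
  set xx := algebraMap E W x with hxx
  have hdq : (X ^ Q - X + C (xx - β) : W[X]).degree = Q := by
    rw [sub_add]
    rw [degree_sub_eq_left_of_degree_lt]
    · simp
    · rw [degree_X_pow]
      have h0 : (X - C (xx - β) : W[X]).degree = 1 := degree_X_sub_C _
      rw [h0]
      exact_mod_cast hQ1
  obtain ⟨y, hy⟩ := IsAlgClosed.exists_root (X ^ Q - X + C (xx - β) : W[X]) (by
    rw [hdq]; exact_mod_cast (by omega : Q ≠ 0))
  set q : W[X] := X ^ Q - X + C xx with hq
  have hqy : q.eval y = β := by
    have : y ^ Q - y + (xx - β) = 0 := by simpa using hy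
    simp only [hq, eval_add, eval_sub, eval_pow, eval_X, eval_C]
    linear_combination this
  obtain ⟨R, hR⟩ : (X - C y) ∣ q - C β := by
    rw [dvd_iff_isRoot]; simp [hqy]
  have hQ0 : (Q : W) = 0 := by
    have h1 : (Q : L) = 0 := FiniteField.cast_card_eq_zero L
    have := congrArg ι h1
    simpa using this
  have hRy : R.eval y ≠ 0 := by
    have h1 := congrArg (fun t => (derivative t).eval y) hR
    simp [hq] at h1
    rw [← h1, derivative_X_pow, hQ0]
    simp
  obtain ⟨P1, hP1⟩ : (X - C β) ∣ P.map ι := dvd_iff_isRoot.2 hβ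
  have hP1β : P1.eval β ≠ 0 := by
    have hsep : P.Separable := PerfectField.separable_of_irreducible hP
    have h0 : eval₂ ι β P = 0 := by rw [← eval_map]; exact hβ
    have h1 := hsep.eval₂_derivative_ne_zero ι h0
    rw [← eval_map, ← derivative_map, hP1] at h1
    simpa using h1
  have hF'β : (F'.map ι).eval β ≠ 0 := by
    intro h0
    apply hPF
    have hcop : ¬ IsCoprime P F' := by
      rintro ⟨a, b, hab⟩
      have := congrArg (fun t => (t.map ι).eval β) hab
      simp only [Polynomial.map_add, Polynomial.map_mul, eval_add, eval_mul, h0, hβ.eq_zero, Polynomial.map_one, eval_one] at this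
      simp at this
    by_contra hc
    exact hcop ((hP.coprime_iff_not_dvd).2 hc)
  have hU : ((F.map (algebraMap L E)).comp (X ^ Q - X + C x)).map (algebraMap E W)
      = (X - C y) ^ μ * (R ^ μ * ((P1 ^ μ * F'.map ι).comp q)) := by
    rw [map_comp, map_map, ← hι, hF, Polynomial.map_mul, Polynomial.map_pow, hP1]
    have : map (algebraMap E W) (X ^ Q - X + C x) = q := by simp [hq, hxx]
    rw [this]
    have h2 : q - C β = (X - C y) * R := hR
    simp only [mul_comp, pow_comp, sub_comp, X_comp, C_comp, h2, mul_pow]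
    ring
  have hm := rootMult_of_eq hU (by
    simp only [eval_mul, eval_pow, eval_comp, hqy]
    exact mul_ne_zero (pow_ne_zero _ hRy) (mul_ne_zero (pow_ne_zero _ hP1β) hF'β))
  have hne : ((F.map (algebraMap L E)).comp (X ^ Q - X + C x)).map (algebraMap E W) ≠ 0 := by
    rw [hU]
    refine mul_ne_zero (pow_ne_zero _ (X_sub_C_ne_zero y)) ?_
    intro h0
    have := congrArg (eval y) h0
    simp only [eval_mul, eval_pow, eval_comp, hqy, eval_zero] at this
    exact mul_ne_zero (pow_ne_zero _ hRy) (mul_ne_zero (pow_ne_zero _ hP1β) hF'β) this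
  rw [h] at hm hne
  simp only [Polynomial.map_mul, map_C, Polynomial.map_pow] at hm hne
  have hV : V.map (algebraMap E W) ≠ 0 := by
    intro h0
    rw [h0] at hne
    have hd0 : d ≠ 0 := by
      rintro rfl
      apply hd
      rw [← hm]
      simp [rootMultiplicity_C]
    simp [hd0] at hne
  rw [rootMultiplicity_mul hne, rootMultiplicity_C, zero_add, rootMult_pow' hV] at hm
  exact hd ⟨_, hm.symm⟩

/-- Lift a multiplicative character via the norm. -/
noncomputable def normChar {L : Type} (E : Type) [Field L] [Field E] [Finite E] [Algebra L E]
    (χ : MulChar L ℂ) : MulChar E ℂ :=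
  { toMonoidHom := (χ.toMonoidHom).comp (Algebra.norm L)
    map_nonunit' := by
      intro a ha
      have ha0 : a = 0 := by
        by_contra h
        exact ha (IsUnit.mk0 a h)
      have : Module.Finite L E := Module.Finite.of_finite
      subst ha0
      change χ (Algebra.norm L (0 : E)) = 0
      rw [Algebra.norm_zero, MulChar.map_zero] }

theorem normChar_apply {L E : Type} [Field L] [Field E] [Finite E] [Algebra L E]
    (χ : MulChar L ℂ) (x : E) : normChar E χ x = χ (Algebra.norm L x) := rfl

theorem normChar_order {L E : Type} [Field L] [Field E] [Finite E] [Algebra L E]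
    (χ : MulChar L ℂ) : orderOf (normChar E χ) = orderOf χ := by
  have : Module.Finite L E := Module.Finite.of_finite
  apply orderOf_eq_orderOf_iff.2
  intro k
  constructor
  · intro h
    ext u
    obtain ⟨x, hx⟩ := FiniteField.norm_surjective L E (u : L)
    have hx0 : x ≠ 0 := by
      rintro rfl
      rw [Algebra.norm_zero] at hx
      exact u.ne_zero hx.symm
    have h1 := congrArg (fun η : MulChar E ℂ => η ((Units.mk0 x hx0 : Eˣ) : E)) h
    beta_reduce at h1
    rw [MulChar.pow_apply_coe, MulChar.one_apply_coe, Units.val_mk0, normChar_apply, hx] at h1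
    rw [MulChar.pow_apply_coe, h1, MulChar.one_apply_coe]
  · intro h
    ext u
    have h0 : Algebra.norm L (u : E) ≠ 0 := Algebra.norm_ne_zero_iff.2 u.ne_zero
    have h1 := congrArg (fun η : MulChar L ℂ => η ((Units.mk0 _ h0 : Lˣ) : L)) h
    beta_reduce at h1
    rw [MulChar.pow_apply_coe, MulChar.one_apply_coe, Units.val_mk0] at h1
    rw [MulChar.pow_apply_coe, normChar_apply, h1, MulChar.one_apply_coe]

theorem trace_pow_card {L E : Type} [Field L] [Fintype L] [Field E] [Finite E] [Algebra L E] (y : E) :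
    Algebra.trace L E (y ^ Fintype.card L) = Algebra.trace L E y := by
  obtain ⟨p, hp⟩ := CharP.exists E
  haveI : Fact p.Prime := ⟨CharP.char_is_prime E p⟩
  have := Algebra.trace_eq_of_algEquiv (FiniteField.frobeniusAlgEquiv L E p) y
  simpa using this

theorem artin_sum {L E : Type} [Field L] [Fintype L] [Field E] [Fintype E] [Algebra L E]
    (xt : L → E) (hxt : ∀ t, Algebra.trace L E (xt t) = t) (h : E → ℂ) :
    ∑ t : L, ∑ y : E, h (y ^ Fintype.card L - y + xt t) = Fintype.card L * ∑ x : E, h x := by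
  classical
  set Q := Fintype.card L with hQ
  have hQ1 : 1 < Q := Fintype.one_lt_card
  let Φ : L × E → E := fun z => z.2 ^ Q - z.2 + xt z.1
  have htr : ∀ z, Algebra.trace L E (Φ z) = z.1 := by
    intro z
    simp only [Φ, map_add, map_sub, hxt, hQ, trace_pow_card, sub_self, zero_add]
  let fib : E → Finset (L × E) := fun x => Finset.univ.filter (fun z => Φ z = x)
  have hfib : ∀ x ∈ (Finset.univ : Finset E), (fib x).card ≤ Q := by
    intro x _
    set pl : E[X] := X ^ Q - (X - C (xt (Algebra.trace L E x) - x)) with hpl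
    have hdeg : pl.natDegree = Q := by
      rw [hpl, natDegree_sub_eq_left_of_natDegree_lt]
      · simp
      · rw [natDegree_X_sub_C, natDegree_X_pow]; exact hQ1
    have hpl0 : pl ≠ 0 := by
      intro h0
      rw [h0, natDegree_zero] at hdeg
      omega
    have hinj : Set.InjOn (fun z : L × E => z.2) (fib x) := by
      intro z hz w hw hzw
      simp only [fib, Finset.coe_filter, Finset.mem_univ, true_and, Set.mem_setOf_eq] at hz hw
      refine Prod.ext ?_ hzw
      rw [← htr z, ← htr w, hz, hw]
    rw [← Finset.card_image_of_injOn hinj, ← hdeg]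
    refine card_le_degree_of_subset_roots ?_
    intro y hy
    simp only [Finset.mem_val, Finset.mem_image, fib, Finset.mem_filter, Finset.mem_univ, true_and] at hy
    obtain ⟨z, hz, rfl⟩ := hy
    rw [mem_roots hpl0, IsRoot, hpl]
    have h1 : z.1 = Algebra.trace L E x := by rw [← hz, htr]
    simp only [eval_sub, eval_pow, eval_X, eval_C, ← h1]
    simp only [Φ] at hz
    linear_combination hz
  have htot : ∑ x : E, (fib x).card = ∑ _x : E, Q := by
    rw [← Finset.card_eq_sum_card_fiberwise (f := Φ) (s := Finset.univ) (fun _ _ => Finset.mem_univ _)]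
    simp [hQ, mul_comm]
  have heq := (Finset.sum_eq_sum_iff_of_le hfib).1 htot
  rw [← Fintype.sum_prod_type' (f := fun t y => h (y ^ Q - y + xt t))]
  rw [← Finset.sum_fiberwise_of_maps_to (s := Finset.univ) (t := Finset.univ) (g := Φ) (fun _ _ => Finset.mem_univ _),
    Finset.mul_sum]
  refine Finset.sum_congr rfl (fun x _ => ?_)
  rw [Finset.sum_congr rfl (g := fun _ => h x)]
  · rw [Finset.sum_const, nsmul_eq_mul]
    congr 1
    exact_mod_cast heq x (Finset.mem_univ x)
  · intro z hz
    rw [Finset.mem_filter] at hz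
    exact congrArg h hz.2

theorem addChar_norm_le {L : Type} [Field L] [Finite L] (ψ : AddChar L ℂ) (x : L) : ‖ψ x‖ ≤ 1 :=
  (AddChar.norm_apply ψ x).le

theorem crude_twisted {L : Type} [Field L] [Fintype L] (χ : MulChar L ℂ) (ψ : AddChar L ℂ)
    {P F F' : L[X]} {μ : ℕ} (hP : Irreducible P) (hF : F = P ^ μ * F') (hPF : ¬ P ∣ F')
    (hd : ¬ orderOf χ ∣ μ) : ∃ C0 : ℝ, 0 ≤ C0 ∧ ∀ (E : Type) [Field E] [Fintype E] [Algebra L E] (m : ℕ),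
      Fintype.card E = (Fintype.card L ^ m) * (Fintype.card L ^ m) →
      ‖∑ x : E, χ (Algebra.norm L (aeval x F)) * ψ (Algebra.trace L E x)‖ ≤ C0 * (Fintype.card L : ℝ) ^ m := by
  classical
  set Q := Fintype.card L with hQ
  have hQ1 : 1 < Q := Fintype.one_lt_card
  obtain ⟨C0, hC0, hC⟩ := crude_bound (orderOf χ) (F.natDegree * Q)
  refine ⟨C0, hC0, ?_⟩
  intro E _ _ _ m hcard
  haveI : Module.Finite L E := Module.Finite.of_finite
  obtain ⟨p, hp⟩ := CharP.exists L
  haveI : Fact p.Prime := ⟨CharP.char_is_prime L p⟩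
  haveI : CharP E p := charP_of_injective_algebraMap (algebraMap L E).injective p
  obtain ⟨k, -, hk⟩ := FiniteField.card L p
  choose xt hxt using Algebra.trace_surjective L E
  have h1 := artin_sum xt hxt (fun x => χ (Algebra.norm L (aeval x F)) * ψ (Algebra.trace L E x))
  have h2 : ∀ t : L, ‖∑ y : E, χ (Algebra.norm L (aeval (y ^ Q - y + xt t) F)) * ψ (Algebra.trace L E (y ^ Q - y + xt t))‖
      ≤ C0 * (Q : ℝ) ^ m := by
    intro t
    have h3 := hC E p (k * m) (Q ^ m) (by rw [hQ, hk, pow_mul]) hcard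
      ((MulChar.orderOf_dvd_card_sub_one L χ).trans (by
        simpa using Nat.sub_dvd_pow_sub_pow Q 1 m))
      (normChar E χ) (normChar_order χ) ((F.map (algebraMap L E)).comp (X ^ Q - X + C (xt t)))
      (by
        rw [natDegree_comp]
        refine Nat.mul_le_mul natDegree_map_le ?_
        rw [sub_add]
        refine (natDegree_sub_le _ _).trans ?_
        rw [natDegree_X_pow, natDegree_X_sub_C]
        exact max_le le_rfl hQ1.le)
      (fun c V => not_power_comp hP hF hPF hd (xt t) c V)
    have h4 : ∑ y : E, χ (Algebra.norm L (aeval (y ^ Q - y + xt t) F)) * ψ (Algebra.trace L E (y ^ Q - y + xt t))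
        = (∑ y : E, normChar E χ (((F.map (algebraMap L E)).comp (X ^ Q - X + C (xt t))).eval y)) * ψ t := by
      rw [Finset.sum_mul]
      refine Finset.sum_congr rfl (fun y _ => ?_)
      rw [normChar_apply]
      congr 2
      · simp [eval_map, aeval_def]
      · simp only [map_add, map_sub, hxt, hQ, trace_pow_card, sub_self, zero_add]
    rw [h4, norm_mul]
    push_cast at h3
    have h5 := addChar_norm_le ψ t
    calc _ ≤ (C0 * (Q:ℝ) ^ m) * 1 := mul_le_mul h3 h5 (norm_nonneg _) (by positivity)
      _ = _ := mul_one _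
  have h5 : ‖(Q : ℂ) * ∑ x : E, χ (Algebra.norm L (aeval x F)) * ψ (Algebra.trace L E x)‖ ≤ Q * (C0 * (Q : ℝ) ^ m) := by
    rw [← h1]
    refine (norm_sum_le _ _).trans ((Finset.sum_le_sum (fun t _ => h2 t)).trans ?_)
    simp [hQ]
  rw [norm_mul, Complex.norm_natCast] at h5
  exact le_of_mul_le_mul_left h5 (by exact_mod_cast (by omega : 0 < Q))
end PartB1

section PartB2
open Polynomial

theorem finite_monic_deg (L : Type) [Field L] [Finite L] (k : ℕ) :
    {h : L[X] | h.Monic ∧ h.natDegree = k}.Finite := by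
  have : Finite (degreeLT L (k + 1)) := Finite.of_equiv _ (degreeLTEquiv L (k + 1)).symm.toEquiv
  refine Set.Finite.subset (Set.toFinite (degreeLT L (k + 1) : Set L[X])) ?_
  rintro h ⟨h1, h2⟩
  rw [SetLike.mem_coe, mem_degreeLT, degree_eq_natDegree h1.ne_zero, h2]
  exact_mod_cast Nat.lt_succ_self k

noncomputable def MP (L : Type) [Field L] [Finite L] (k : ℕ) : Finset L[X] :=
  (finite_monic_deg L k).toFinset

theorem mem_MP {L : Type} [Field L] [Finite L] {k : ℕ} {h : L[X]} :
    h ∈ MP L k ↔ h.Monic ∧ h.natDegree = k := by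
  simp [MP]

open Classical in
noncomputable def IP (L : Type) [Field L] [Finite L] (k : ℕ) : Finset L[X] :=
  ((Finset.range (k + 1)).biUnion (MP L)).filter Irreducible

theorem mem_IP {L : Type} [Field L] [Finite L] {k : ℕ} {h : L[X]} :
    h ∈ IP L k ↔ h.Monic ∧ Irreducible h ∧ h.natDegree ≤ k := by
  simp only [IP, Finset.mem_filter, Finset.mem_biUnion, Finset.mem_range, mem_MP]
  constructor
  · rintro ⟨⟨a, ha, h1, rfl⟩, h2⟩
    exact ⟨h1, h2, by omega⟩
  · rintro ⟨h1, h2, h3⟩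
    exact ⟨⟨_, by omega, h1, rfl⟩, h2⟩

open Classical in
theorem deg_eq_sum {L : Type} [Field L] [Finite L] {k : ℕ} {h : L[X]} (hm : h.Monic) (hk : h.natDegree = k) :
    k = ∑ P ∈ IP L k, P.natDegree * ((Finset.Icc 1 k).filter (fun j => P ^ j ∣ h)).card := by
  classical
  set nf := UniqueFactorizationMonoid.normalizedFactors h with hnf
  have hmem : ∀ P ∈ nf, P.Monic ∧ Irreducible P ∧ P ∣ h := by
    intro P hP
    have h1 := UniqueFactorizationMonoid.irreducible_of_normalized_factor P hP
    have h2 := UniqueFactorizationMonoid.normalize_normalized_factor P hP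
    refine ⟨?_, h1, UniqueFactorizationMonoid.dvd_of_mem_normalizedFactors hP⟩
    rw [← h2]
    exact monic_normalize h1.ne_zero
  have hprod : nf.prod = h := by
    have h1 := UniqueFactorizationMonoid.prod_normalizedFactors hm.ne_zero
    have h2 : nf.prod.Monic := by
      have := monic_multiset_prod_of_monic nf id (fun P hP => (hmem P hP).1)
      simpa using this
    exact eq_of_monic_of_associated h2 hm h1
  have hcount : ∀ P ∈ IP L k, nf.count P = ((Finset.Icc 1 k).filter (fun j => P ^ j ∣ h)).card := by
    intro P hP
    rw [mem_IP] at hP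
    have hle : ∀ j, P ^ j ∣ h ↔ j ≤ nf.count P := by
      intro j
      rw [pow_dvd_iff_le_emultiplicity,
        UniqueFactorizationMonoid.emultiplicity_eq_count_normalizedFactors hP.2.1 hm.ne_zero,
        hP.1.normalize_eq_self]
      exact_mod_cast Iff.rfl
    have hck : nf.count P ≤ k := by
      have h1 := natDegree_le_of_dvd ((hle _).2 le_rfl) hm.ne_zero
      rw [natDegree_pow, hk] at h1
      have h2 := hP.2.1.natDegree_pos
      nlinarith
    have : (Finset.Icc 1 k).filter (fun j => P ^ j ∣ h) = Finset.Icc 1 (nf.count P) := by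
      ext j
      simp only [Finset.mem_filter, Finset.mem_Icc, hle]
      omega
    rw [this]; simp
  have h1 : k = (nf.map natDegree).sum := by
    rw [← hk, ← hprod, natDegree_multiset_prod_of_monic _ (fun P hP => (hmem P hP).1)]
  rw [Finset.sum_multiset_map_count] at h1
  conv_lhs => rw [h1]
  have hsub : nf.toFinset ⊆ IP L k := by
    intro P hP
    have := hmem P (Multiset.mem_toFinset.1 hP)
    rw [mem_IP]
    refine ⟨this.1, this.2.1, ?_⟩
    rw [← hk]
    exact natDegree_le_of_dvd this.2.2 hm.ne_zero
  rw [Finset.sum_subset hsub]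
  · refine Finset.sum_congr rfl (fun P hP => ?_)
    rw [hcount P hP, smul_eq_mul, mul_comm]
  · intro P _ hP
    rw [Multiset.mem_toFinset] at hP
    simp [Multiset.count_eq_zero_of_notMem hP]

noncomputable def sig (L : Type) [Field L] [Finite L] (lam : L[X] → ℂ) (k : ℕ) : ℂ := ∑ h ∈ MP L k, lam h

open Classical in
noncomputable def SS (L : Type) [Field L] [Finite L] (lam : L[X] → ℂ) (m : ℕ) : ℂ :=
  ∑ P ∈ (IP L m).filter (fun P => P.natDegree ∣ m), (P.natDegree : ℂ) * lam P ^ (m / P.natDegree)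

open Classical in
theorem newton_id {L : Type} [Field L] [Finite L] (lam : L[X] → ℂ) (h1 : lam 1 = 1)
    (hmul : ∀ g h : L[X], g.Monic → h.Monic → lam (g * h) = lam g * lam h) (k : ℕ) :
    (k : ℂ) * sig L lam k = ∑ m ∈ Finset.Icc 1 k, SS L lam m * sig L lam (k - m) := by
  classical
  have hpow : ∀ (P : L[X]) (j : ℕ), P.Monic → lam (P ^ j) = lam P ^ j := by
    intro P j hP
    induction j with
    | zero => simp [h1]
    | succ j ih => rw [pow_succ, hmul _ _ (hP.pow j) hP, ih, pow_succ]
  have hfil : ∀ (P : L[X]) (j : ℕ), P.Monic → ∑ h ∈ (MP L k).filter (fun h => P ^ j ∣ h), lam h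
      = if j * P.natDegree ≤ k then lam P ^ j * sig L lam (k - j * P.natDegree) else 0 := by
    intro P j hP
    have hPj : (P ^ j).Monic := hP.pow j
    have hdj : (P ^ j).natDegree = j * P.natDegree := by rw [natDegree_pow]
    split_ifs with hle
    · rw [sig, Finset.mul_sum]
      symm
      refine Finset.sum_bij (fun g _ => P ^ j * g) ?_ ?_ ?_ ?_
      · intro g hg
        rw [mem_MP] at hg
        rw [Finset.mem_filter, mem_MP]
        refine ⟨⟨hPj.mul hg.1, ?_⟩, dvd_mul_right _ _⟩
        rw [hPj.natDegree_mul hg.1, hg.2, hdj]; omega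
      · intro a _ b _ hab
        exact mul_left_cancel₀ hPj.ne_zero hab
      · intro h hh
        rw [Finset.mem_filter, mem_MP] at hh
        obtain ⟨⟨hh1, hh2⟩, g, rfl⟩ := hh
        have hg : g.Monic := hPj.of_mul_monic_left hh1
        refine ⟨g, ?_, rfl⟩
        rw [mem_MP]
        refine ⟨hg, ?_⟩
        rw [hPj.natDegree_mul hg, hdj] at hh2
        omega
      · intro g hg
        rw [mem_MP] at hg
        rw [hmul _ _ hPj hg.1, hpow P j hP]
    · rw [Finset.filter_false_of_mem, Finset.sum_empty]
      intro h hh hd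
      rw [mem_MP] at hh
      have := natDegree_le_of_dvd hd hh.1.ne_zero
      rw [hdj, hh.2] at this
      exact hle this
  have hL : (k : ℂ) * sig L lam k = ∑ P ∈ IP L k, ∑ j ∈ Finset.Icc 1 k,
      (P.natDegree : ℂ) * (if j * P.natDegree ≤ k then lam P ^ j * sig L lam (k - j * P.natDegree) else 0) := by
    have e1 : (k : ℂ) * sig L lam k = ∑ h ∈ MP L k, ∑ P ∈ IP L k, ∑ j ∈ Finset.Icc 1 k,
        (P.natDegree : ℂ) * (if P ^ j ∣ h then lam h else 0) := by
      rw [sig, Finset.mul_sum]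
      refine Finset.sum_congr rfl (fun h hh => ?_)
      rw [mem_MP] at hh
      have e2 : (k : ℂ) = ∑ P ∈ IP L k, (P.natDegree : ℂ) * ((Finset.Icc 1 k).filter (fun j => P ^ j ∣ h)).card := by
        exact_mod_cast deg_eq_sum hh.1 hh.2
      rw [e2, Finset.sum_mul]
      refine Finset.sum_congr rfl (fun P _ => ?_)
      rw [← Finset.mul_sum, ← Finset.sum_filter, Finset.sum_const, nsmul_eq_mul, mul_assoc]
    rw [e1, Finset.sum_comm]
    refine Finset.sum_congr rfl (fun P hP => ?_)
    rw [Finset.sum_comm]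
    refine Finset.sum_congr rfl (fun j _ => ?_)
    rw [← Finset.mul_sum, ← Finset.sum_filter, hfil P j (mem_IP.1 hP).1]
  rw [hL]
  have hR : ∑ m ∈ Finset.Icc 1 k, SS L lam m * sig L lam (k - m)
      = ∑ P ∈ IP L k, ∑ m ∈ Finset.Icc 1 k, if P.natDegree ∣ m then
        (P.natDegree : ℂ) * lam P ^ (m / P.natDegree) * sig L lam (k - m) else 0 := by
    rw [Finset.sum_comm]
    refine Finset.sum_congr rfl (fun m hm => ?_)
    rw [Finset.mem_Icc] at hm
    have e3 : (IP L m).filter (fun P => P.natDegree ∣ m) = (IP L k).filter (fun P => P.natDegree ∣ m) := by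
      ext P
      simp only [Finset.mem_filter, mem_IP]
      constructor
      · rintro ⟨⟨a, b, c⟩, d⟩
        exact ⟨⟨a, b, by omega⟩, d⟩
      · rintro ⟨⟨a, b, c⟩, d⟩
        exact ⟨⟨a, b, Nat.le_of_dvd (by omega) d⟩, d⟩
    rw [SS, e3, Finset.sum_mul, Finset.sum_filter]
  rw [hR]
  refine Finset.sum_congr rfl (fun P hP => ?_)
  have hdp : 0 < P.natDegree := (mem_IP.1 hP).2.1.natDegree_pos
  simp only [mul_ite, mul_zero]
  rw [← Finset.sum_filter, ← Finset.sum_filter]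
  refine Finset.sum_bij (fun j _ => j * P.natDegree) ?_ ?_ ?_ ?_
  · intro j hj
    rw [Finset.mem_filter, Finset.mem_Icc] at *
    refine ⟨⟨Nat.mul_pos hj.1.1 hdp, hj.2⟩, dvd_mul_left _ _⟩
  · intro a _ b _ hab
    exact Nat.eq_of_mul_eq_mul_right hdp hab
  · intro m hm
    rw [Finset.mem_filter, Finset.mem_Icc] at hm
    obtain ⟨⟨h3, h4⟩, j, rfl⟩ := hm
    refine ⟨j, ?_, mul_comm _ _⟩
    rw [Finset.mem_filter, Finset.mem_Icc]
    have : 0 < j := Nat.pos_of_mul_pos_left (by omega : 0 < P.natDegree * j)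
    refine ⟨⟨this, ?_⟩, by rw [mul_comm]; exact h4⟩
    nlinarith
  · intro j _
    rw [Nat.mul_div_cancel _ hdp, mul_assoc]
end PartB2

section PartB3
open Polynomial IntermediateField

theorem res_aroots {L W : Type} [Field L] [Field W] [Algebra L W] [IsAlgClosed W] (P F : L[X]) (hP : P.Monic) :
    algebraMap L W (resultant P F) = ((P.aroots W).map (fun β => aeval β F)).prod := by
  rw [← resultant_map_map, ← natDegree_map (algebraMap L W) (p := P),
    resultant_eq_prod_eval _ _ _ natDegree_map_le (IsAlgClosed.splits _), (hP.map _).leadingCoeff, one_pow, one_mul]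
  rw [aroots_def]
  congr 1
  refine Multiset.map_congr rfl (fun β _ => ?_)
  rw [eval_map, aeval_def]

theorem norm_aeval_adjoin {L E : Type} [Field L] [Finite L] [Field E] [Finite E] [Algebra L E] (F : L[X]) (x : E) :
    Algebra.norm L (aeval x F) = resultant (minpoly L x) F ^ (Module.finrank L⟮x⟯ E) := by
  classical
  have hyint : IsIntegral L x := Algebra.IsIntegral.isIntegral x
  have h0 : aeval x F = algebraMap L⟮x⟯ E (aeval (AdjoinSimple.gen L x) F) := by
    rw [← aeval_algebraMap_apply, AdjoinSimple.algebraMap_gen]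
  rw [h0, ← Algebra.norm_norm (R := L) (S := L⟮x⟯), Algebra.norm_algebraMap, map_pow]
  congr 1
  let pb := adjoin.powerBasis hyint
  have hgen : pb.gen = AdjoinSimple.gen L x := adjoin.powerBasis_gen hyint
  have hmin : minpoly L pb.gen = minpoly L x := by rw [hgen, minpoly_gen]
  let W := AlgebraicClosure L
  apply (algebraMap L W).injective
  rw [res_aroots _ _ (minpoly.monic hyint), Algebra.norm_eq_prod_embeddings L W]
  rw [Fintype.prod_equiv pb.liftEquiv' (fun σ => σ (aeval (AdjoinSimple.gen L x) F)) (fun y => aeval (y : W) F)]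
  · rw [Finset.prod_mem_multiset _ _ (fun y => aeval y F) (fun _ => rfl), Finset.prod_eq_multiset_prod,
      Multiset.toFinset_val, Multiset.dedup_eq_self.mpr, hmin]
    apply nodup_roots
    rw [hmin]
    exact (PerfectField.separable_of_irreducible (minpoly.irreducible hyint)).map
  · intro σ
    rw [PowerBasis.liftEquiv'_apply_coe, hgen, aeval_algHom_apply]

noncomputable def lamb {L : Type} [Field L] (χ : MulChar L ℂ) (ψ : AddChar L ℂ) (F : L[X]) (h : L[X]) : ℂ :=
  χ (resultant h F) * ψ (- h.nextCoeff)

theorem lamb_one {L : Type} [Field L] (χ : MulChar L ℂ) (ψ : AddChar L ℂ) (F : L[X]) : lamb χ ψ F 1 = 1 := by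
  simp [lamb, nextCoeff]

theorem lamb_mul {L : Type} [Field L] (χ : MulChar L ℂ) (ψ : AddChar L ℂ) (F : L[X]) (g h : L[X])
    (hg : g.Monic) (hh : h.Monic) : lamb χ ψ F (g * h) = lamb χ ψ F g * lamb χ ψ F h := by
  rw [lamb, hg.nextCoeff_mul hh, hg.natDegree_mul hh, resultant_mul_left _ _ _ _ le_rfl, map_mul, neg_add,
    AddChar.map_add_eq_mul, lamb, lamb]
  ring

open Classical in
theorem SS_eq_sum {L E : Type} [Field L] [Fintype L] [Field E] [Fintype E] [Algebra L E] {m : ℕ}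
    (hm : Module.finrank L E = m) (χ : MulChar L ℂ) (ψ : AddChar L ℂ) (F : L[X]) :
    SS L (lamb χ ψ F) m = ∑ x : E, χ (Algebra.norm L (aeval x F)) * ψ (Algebra.trace L E x) := by
  classical
  have hmpos : 0 < m := by rw [← hm]; exact Module.finrank_pos
  have hcardE : Fintype.card E = Fintype.card L ^ m := by rw [← hm]; exact Module.card_eq_pow_finrank
  have hterm : ∀ x : E, χ (Algebra.norm L (aeval x F)) * ψ (Algebra.trace L E x)
      = lamb χ ψ F (minpoly L x) ^ (m / (minpoly L x).natDegree) := by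
    intro x
    have hyint : IsIntegral L x := Algebra.IsIntegral.isIntegral x
    have h1 : Module.finrank L⟮x⟯ E = m / (minpoly L x).natDegree := by
      rw [← hm, ← Module.finrank_mul_finrank L L⟮x⟯ E, adjoin.finrank hyint, Nat.mul_div_cancel_left]
      exact minpoly.natDegree_pos hyint
    rw [norm_aeval_adjoin, trace_eq_finrank_mul_minpoly_nextCoeff, h1, lamb, mul_pow, map_pow,
      ← nsmul_eq_mul, AddChar.map_nsmul_eq_pow]
  have hmaps : ∀ x ∈ (Finset.univ : Finset E), minpoly L x ∈ (IP L m).filter (fun P => P.natDegree ∣ m) := by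
    intro x _
    have hyint : IsIntegral L x := Algebra.IsIntegral.isIntegral x
    have hd : (minpoly L x).natDegree ∣ m := by
      rw [← hm, ← Module.finrank_mul_finrank L L⟮x⟯ E, adjoin.finrank hyint]
      exact dvd_mul_right _ _
    rw [Finset.mem_filter, mem_IP]
    exact ⟨⟨minpoly.monic hyint, minpoly.irreducible hyint, Nat.le_of_dvd hmpos hd⟩, hd⟩
  rw [SS, ← Finset.sum_fiberwise_of_maps_to hmaps]
  refine Finset.sum_congr rfl (fun P hP => ?_)
  rw [Finset.mem_filter, mem_IP] at hP
  obtain ⟨⟨hPm, hPi, hPle⟩, hPd⟩ := hP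
  rw [Finset.sum_congr rfl (g := fun _ => lamb χ ψ F P ^ (m / P.natDegree))]
  · rw [Finset.sum_const, nsmul_eq_mul]
    congr 2
    have hsplit : (P.map (algebraMap L E)).Splits := by
      have hdv : P ∣ X ^ (Nat.card L) ^ m - X := hPi.natDegree_dvd_iff_dvd_X_pow_card_pow_sub_X.1 hPd
      rw [Nat.card_eq_fintype_card, ← hcardE] at hdv
      have h2 := Polynomial.map_dvd (algebraMap L E) hdv
      rw [Polynomial.map_sub, Polynomial.map_pow, map_X] at h2
      refine Splits.of_dvd (g := X ^ Fintype.card E - X) ?_ ?_ h2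
      · rw [← Nat.card_eq_fintype_card]; exact Polynomial.splits_X_pow_nat_card_sub_X
      · exact FiniteField.X_pow_card_sub_X_ne_zero E Fintype.one_lt_card
    have h3 := card_rootSet_eq_natDegree (K := E) (PerfectField.separable_of_irreducible hPi) hsplit
    rw [← h3, ← Set.toFinset_card]
    congr 1
    ext x
    simp only [Set.mem_toFinset, Finset.mem_filter, Finset.mem_univ, true_and, mem_rootSet]
    constructor
    · rintro ⟨_, h⟩
      exact (minpoly.eq_of_irreducible_of_monic hPi h hPm).symm
    · rintro rfl
      exact ⟨hPi.ne_zero, minpoly.aeval L x⟩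
  · intro x hx
    rw [Finset.mem_filter] at hx
    rw [hterm, hx.2]
end PartB3

section PartB4
open Polynomial IntermediateField

theorem exists_res_eq {L : Type} [Field L] [Finite L] {P : L[X]} (hPm : P.Monic) (hP : Irreducible P) (c : L) :
    ∃ u : L[X], resultant P u = c := by
  haveI : Fact (Irreducible P) := ⟨hP⟩
  haveI : Module.Finite L (AdjoinRoot P) := (AdjoinRoot.powerBasis hP.ne_zero).finite
  haveI : Finite (AdjoinRoot P) := Module.finite_of_finite L
  obtain ⟨y, hy⟩ := FiniteField.norm_surjective L (AdjoinRoot P) c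
  obtain ⟨u, rfl⟩ := AdjoinRoot.mk_surjective y
  refine ⟨u, ?_⟩
  rw [← AdjoinRoot.aeval_eq, norm_aeval_adjoin, AdjoinRoot.minpoly_root hP.ne_zero] at hy
  have hyint : IsIntegral L (AdjoinRoot.root P) := Algebra.IsIntegral.isIntegral _
  have h1 : Module.finrank L⟮AdjoinRoot.root P⟯ (AdjoinRoot P) = 1 := by
    have h2 := Module.finrank_mul_finrank L L⟮AdjoinRoot.root P⟯ (AdjoinRoot P)
    rw [adjoin.finrank hyint, AdjoinRoot.minpoly_root hP.ne_zero, natDegree_mul_C (by simpa using hP.ne_zero),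
      (AdjoinRoot.powerBasis hP.ne_zero).finrank, AdjoinRoot.powerBasis_dim] at h2
    exact Nat.eq_of_mul_eq_mul_left hP.natDegree_pos (by rw [h2, mul_one])
  rw [h1, pow_one, hPm.leadingCoeff, inv_one, C_1, mul_one] at hy
  exact hy

theorem res_change {L W : Type} [Field L] [Field W] [Algebra L W] [IsAlgClosed W] {F : L[X]} (hF : F ≠ 0)
    {h h' u : L[X]} (hd : h'.natDegree = h.natDegree)
    (hu : ∀ β : W, aeval β F = 0 → aeval β h' = aeval β u * aeval β h) :
    algebraMap L W (resultant h' F) = ((F.aroots W).map (fun β => aeval β u)).prod * algebraMap L W (resultant h F) := by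
  have key : ∀ g : L[X], algebraMap L W (resultant g F) = (-1)^(g.natDegree * F.natDegree) *
      ((algebraMap L W F.leadingCoeff)^ g.natDegree * ((F.aroots W).map (fun β => aeval β g)).prod) := by
    intro g
    rw [resultant_comm, map_mul, ← resultant_map_map (φ := algebraMap L W) (f := F) (g := g)]
    have h1 := resultant_eq_prod_eval (F.map (algebraMap L W)) (g.map (algebraMap L W)) g.natDegree natDegree_map_le (IsAlgClosed.splits _)
    rw [natDegree_map] at h1
    rw [h1, leadingCoeff_map, aroots_def]
    simp [eval_map, aeval_def]
  rw [key, key, hd]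
  have : ((F.aroots W).map (fun β => aeval β h')) = (F.aroots W).map (fun β => aeval β u * aeval β h) := by
    refine Multiset.map_congr rfl (fun β hβ => hu β ((mem_aroots.1 hβ).2))
  rw [this, Multiset.prod_map_mul]
  ring

theorem sig_vanish {L : Type} [Field L] [Fintype L] (χ : MulChar L ℂ) (ψ : AddChar L ℂ) {P F F' G : L[X]} {μ N : ℕ}
    (hPm : P.Monic) (hP : Irreducible P) (hF : F = P ^ μ * F') (hPF : ¬ P ∣ F') (hd : ¬ orderOf χ ∣ μ)
    (hG : G.Monic) (hFG : F ∣ G ^ N) {k : ℕ} (hk : G.natDegree + 1 ≤ k) : sig L (lamb χ ψ F) k = 0 := by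
  classical
  have hF0 : F ≠ 0 := by
    rintro rfl
    rw [zero_dvd_iff] at hFG
    exact hG.ne_zero (eq_zero_of_pow_eq_zero hFG)
  have hF'0 : F' ≠ 0 := by rintro rfl; simp at hPF
  obtain ⟨c, hc⟩ : ∃ c : Lˣ, χ ((c:L) ^ μ) ≠ 1 := by
    by_contra hcon
    push Not at hcon
    apply hd
    rw [orderOf_dvd_iff_pow_eq_one]
    ext a
    rw [MulChar.pow_apply_coe, ← map_pow, hcon, MulChar.one_apply_coe]
  obtain ⟨u0, hu0⟩ := exists_res_eq hPm hP (c : L)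
  obtain ⟨G', hGG', hPG'⟩ := (FiniteMultiplicity.of_not_isUnit hP.not_isUnit hG.ne_zero).exists_eq_pow_mul_and_not_dvd
  generalize multiplicity P G = j at hGG'
  obtain ⟨a, b, hab⟩ : IsCoprime P G' := (hP.coprime_iff_not_dvd).2 hPG'
  set u : L[X] := u0 * (b * G') + a * P with hu
  have hu1 : ∃ w, u = u0 + P * w := ⟨a - u0 * a, by rw [hu]; linear_combination u0 * hab⟩
  have hu2 : ∃ w, u = 1 + G' * w := ⟨u0 * b - b, by rw [hu]; linear_combination hab⟩
  obtain ⟨w1, hw1⟩ := hu1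
  obtain ⟨w2, hw2⟩ := hu2
  have hcop0 : IsCoprime P u0 := by
    by_contra hcon
    have h0 : resultant P u0 ≠ 0 := by rw [hu0]; exact c.ne_zero
    exact h0 (resultant_eq_zero_iff.2 ⟨Or.inl hP.ne_zero, hcon⟩)
  have hcopP : IsCoprime P u := by
    rw [hw1]; exact IsCoprime.add_mul_left_right hcop0 w1
  have hcopG' : IsCoprime G' u := by
    rw [hw2]; exact IsCoprime.add_mul_left_right isCoprime_one_right w2
  have hcop : IsCoprime G u := by
    rw [hGG']; exact IsCoprime.mul_left (hcopP.pow_left) hcopG'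
  let W := AlgebraicClosure L
  have hGroot : ∀ β : W, aeval β F = 0 → aeval β G = 0 := by
    intro β hβ
    obtain ⟨z, hz⟩ := hFG
    have : aeval β G ^ N = 0 := by rw [← map_pow, hz, map_mul, hβ, zero_mul]
    exact eq_zero_of_pow_eq_zero this
  have hprod : ((F.aroots W).map (fun β => aeval β u)).prod = algebraMap L W ((c:L)^μ) := by
    rw [hF, aroots_mul (hF ▸ hF0), aroots_pow, Multiset.map_add, Multiset.prod_add, Multiset.map_nsmul, Multiset.prod_nsmul,
      map_pow, ← hu0, res_aroots _ _ hPm]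
    have e1 : (P.aroots W).map (fun β => aeval β u) = (P.aroots W).map (fun β => aeval β u0) := by
      refine Multiset.map_congr rfl (fun β hβ => ?_)
      rw [hw1, map_add, map_mul, (mem_aroots.1 hβ).2, zero_mul, add_zero]
    have e2 : (F'.aroots W).map (fun β => aeval β u) = (F'.aroots W).map (fun β => 1) := by
      refine Multiset.map_congr rfl (fun β hβ => ?_)
      have hβ' := (mem_aroots.1 hβ).2
      obtain ⟨x, y, hxy⟩ : IsCoprime P F' := (hP.coprime_iff_not_dvd).2 hPF
      have hPβ : aeval β P ≠ 0 := by
        intro h0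
        have := congrArg (aeval β) hxy
        simp [h0, hβ'] at this
      have hGβ := hGroot β (by rw [hF, map_mul, hβ', mul_zero])
      rw [hGG', map_mul, map_pow] at hGβ
      have hG'β : aeval β G' = 0 := (mul_eq_zero.1 hGβ).resolve_left (pow_ne_zero _ hPβ)
      rw [hw2, map_add, map_mul, hG'β, zero_mul, add_zero, map_one]
    rw [e1, e2]
    simp
  let T : L[X] → L[X] := fun h => h - ((h - u * h) %ₘ G)
  have hlt : ∀ p : L[X], (p %ₘ G).degree < (k - 1 : ℕ) := by
    intro p
    refine (degree_modByMonic_lt p hG).trans_le ?_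
    rw [degree_eq_natDegree hG.ne_zero]
    exact_mod_cast (by omega : G.natDegree ≤ k - 1)
  have hTmon : ∀ h ∈ MP L k, T h ∈ MP L k := by
    intro h hh
    rw [mem_MP] at hh ⊢
    have hdeg : ((h - u * h) %ₘ G).degree < h.degree := by
      rw [degree_eq_natDegree hh.1.ne_zero, hh.2]
      exact (hlt _).trans_le (by exact_mod_cast (by omega : k - 1 ≤ k))
    exact ⟨hh.1.sub_of_left hdeg, by
      rw [natDegree_eq_of_degree_eq (degree_sub_eq_left_of_degree_lt hdeg), hh.2]⟩
  have hTnext : ∀ h ∈ MP L k, (T h).nextCoeff = h.nextCoeff := by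
    intro h hh
    have h2 := hTmon h hh
    rw [mem_MP] at hh h2
    rw [nextCoeff_of_natDegree_pos (by omega), nextCoeff_of_natDegree_pos (by omega), h2.2, hh.2]
    change (h - _).coeff _ = _
    rw [coeff_sub, coeff_eq_zero_of_degree_lt (hlt _), sub_zero]
  have hTdvd : ∀ h, G ∣ T h - u * h := by
    intro h
    refine ⟨(h - u * h) /ₘ G, ?_⟩
    have := modByMonic_add_div (h - u * h) G
    change h - _ - _ = _
    linear_combination -this
  have hinj : Set.InjOn T (MP L k) := by
    intro h1 _ h2 _ he
    have hd1 : G ∣ u * (h1 - h2) := by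
      have := dvd_sub (hTdvd h2) (hTdvd h1)
      rw [he] at this
      have e : T h2 - u * h2 - (T h2 - u * h1) = u * (h1 - h2) := by ring
      rwa [e] at this
    have hd2 : G ∣ h1 - h2 := hcop.dvd_of_dvd_mul_left hd1
    have he2 : h1 - h2 = (h1 - u * h1) %ₘ G - (h2 - u * h2) %ₘ G := by
      change h1 - _ = h2 - _ at he
      linear_combination he
    have hlt2 : (h1 - h2).degree < G.degree := by
      rw [he2]
      exact (degree_sub_le _ _).trans_lt (max_lt (degree_modByMonic_lt _ hG) (degree_modByMonic_lt _ hG))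
    by_contra hne
    exact absurd (degree_le_of_dvd hd2 (sub_ne_zero.2 hne)) (not_le.2 hlt2)
  have hres : ∀ h ∈ MP L k, resultant (T h) F = (c:L)^μ * resultant h F := by
    intro h hh
    apply (algebraMap L W).injective
    have h2 := hTmon h hh
    rw [mem_MP] at hh h2
    rw [res_change (W := W) hF0 (h := h) (h' := T h) (u := u) (by rw [h2.2, hh.2]), hprod, map_mul]
    intro β hβ
    obtain ⟨z, hz⟩ := hTdvd h
    have := congrArg (aeval β) hz
    rw [map_mul, hGroot β hβ, zero_mul, map_sub, map_mul, sub_eq_zero] at this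
    exact this
  have hsum : sig L (lamb χ ψ F) k = χ ((c:L)^μ) * sig L (lamb χ ψ F) k := by
    conv_lhs => rw [sig]
    rw [sig, Finset.mul_sum]
    symm
    refine Finset.sum_bij (fun h _ => T h) hTmon (fun a ha b hb h => hinj ha hb h) ?_ ?_
    · intro b hb
      obtain ⟨a, ha, hab⟩ := Finset.surjOn_of_injOn_of_card_le T hTmon hinj le_rfl hb
      exact ⟨a, ha, hab⟩
    · intro h hh
      rw [lamb, lamb, hTnext h hh, hres h hh, map_mul, mul_assoc]
  have : (1 - χ ((c:L)^μ)) * sig L (lamb χ ψ F) k = 0 := by linear_combination hsum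
  rcases mul_eq_zero.1 this with h | h
  · exact absurd (by linear_combination -h) hc
  · exact h
end PartB4

section PartB5
open Polynomial

theorem bounded_powersum (s : Multiset ℂ) (C : ℝ) (hC : ∀ m : ℕ, 1 ≤ m → ‖(s.map (fun z => z ^ m)).sum‖ ≤ C) :
    ∀ z ∈ s, ‖z‖ ≤ 1 := by
  classical
  intro z hz
  let R : ℂ[X] := ∏ w ∈ s.toFinset.erase z, (X - Polynomial.C w)
  have hRz : R.eval z ≠ 0 := by
    rw [eval_prod, Finset.prod_ne_zero_iff]
    intro w hw
    rw [eval_sub, eval_X, eval_C, sub_ne_zero]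
    exact (Finset.ne_of_mem_erase hw).symm
  have hRw : ∀ w ∈ s.toFinset, w ≠ z → R.eval w = 0 := by
    intro w hw hne
    rw [eval_prod]
    exact Finset.prod_eq_zero (Finset.mem_erase.2 ⟨hne, hw⟩) (by simp)
  have hp : ∀ m : ℕ, (s.map (fun z => z ^ m)).sum = ∑ w ∈ s.toFinset, (s.count w : ℂ) * w ^ m := by
    intro m
    rw [Finset.sum_multiset_map_count]
    simp [nsmul_eq_mul]
  have key : ∀ m : ℕ, ∑ i ∈ R.support, R.coeff i * (s.map (fun z => z ^ (m + i))).sum = (s.count z : ℂ) * R.eval z * z ^ m := by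
    intro m
    simp_rw [hp, Finset.mul_sum]
    rw [Finset.sum_comm]
    have : ∀ w ∈ s.toFinset, ∑ i ∈ R.support, R.coeff i * ((s.count w : ℂ) * w ^ (m + i)) = (s.count w : ℂ) * w ^ m * R.eval w := by
      intro w _
      rw [eval_eq_sum, Polynomial.sum, Finset.mul_sum]
      refine Finset.sum_congr rfl (fun i _ => ?_)
      ring
    rw [Finset.sum_congr rfl this, Finset.sum_eq_single_of_mem z (Multiset.mem_toFinset.2 hz)]
    · ring
    · intro w hw hne
      rw [hRw w hw hne, mul_zero]
  by_contra hgt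
  push Not at hgt
  have hK : 0 < ‖(s.count z : ℂ) * R.eval z‖ := by
    rw [norm_pos_iff]
    exact mul_ne_zero (by exact_mod_cast (Multiset.count_pos.2 hz).ne') hRz
  set B := ∑ i ∈ R.support, ‖R.coeff i‖ * C
  have hb : ∀ m : ℕ, 1 ≤ m → ‖(s.count z : ℂ) * R.eval z‖ * ‖z‖ ^ m ≤ B := by
    intro m hm
    rw [← norm_pow, ← norm_mul, ← key]
    refine (norm_sum_le _ _).trans (Finset.sum_le_sum (fun i _ => ?_))
    rw [norm_mul]
    exact mul_le_mul_of_nonneg_left (hC _ (by omega)) (norm_nonneg _)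
  obtain ⟨m, hm⟩ := pow_unbounded_of_one_lt (B / ‖(s.count z : ℂ) * R.eval z‖) hgt
  have h1 := hb (m+1) (by omega)
  rw [div_lt_iff₀ hK] at hm
  have h2 : ‖z‖ ^ m ≤ ‖z‖ ^ (m+1) := pow_le_pow_right₀ hgt.le (by omega)
  nlinarith

noncomputable def geo (w : ℂ) : PowerSeries ℂ := PowerSeries.mk (fun m => if m = 0 then 0 else w ^ m)

theorem geo_mul (w : ℂ) : (1 - PowerSeries.C w * PowerSeries.X) * geo w = PowerSeries.C w * PowerSeries.X := by
  ext k
  rcases k with _ | k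
  · simp [geo]
  · rw [sub_mul, one_mul, map_sub, mul_assoc, PowerSeries.coeff_C_mul, PowerSeries.coeff_C_mul, PowerSeries.coeff_succ_X_mul]
    rcases k with _ | k
    · simp [geo]
    · simp [geo, PowerSeries.coeff_X, pow_succ]; ring

theorem deriv_prod (s : Multiset ℂ) : 
    PowerSeries.X * PowerSeries.derivative ℂ ((s.map (fun w => (1 - PowerSeries.C w * PowerSeries.X : PowerSeries ℂ))).prod) =
      - (s.map (fun w => (1 - PowerSeries.C w * PowerSeries.X : PowerSeries ℂ))).prod * (s.map geo).sum := by
  induction s using Multiset.induction_on with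
  | empty => 
    simp only [Multiset.map_zero, Multiset.prod_zero, Multiset.sum_zero, mul_zero]
    simp
  | cons w s ih =>
    rw [Multiset.map_cons, Multiset.prod_cons, Multiset.map_cons, Multiset.sum_cons, Derivation.leibniz]
    simp only [smul_eq_mul]
    have hd : PowerSeries.derivative ℂ (1 - PowerSeries.C w * PowerSeries.X : PowerSeries ℂ) = - PowerSeries.C w := by
      ext k
      rw [PowerSeries.coeff_derivative]
      rcases k with _ | k
      · simp [PowerSeries.coeff_one]
      · simp [PowerSeries.coeff_one, PowerSeries.coeff_X, PowerSeries.coeff_C]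
    rw [hd]
    have h2 := geo_mul w
    linear_combination (1 - PowerSeries.C w * PowerSeries.X) * ih + (Multiset.map (fun w => (1 - PowerSeries.C w * PowerSeries.X : PowerSeries ℂ)) s).prod * h2

theorem exists_factor (A : ℂ[X]) (h0 : A.coeff 0 = 1) : ∃ s : Multiset ℂ, s.card ≤ A.natDegree ∧ 
    (A : PowerSeries ℂ) = (s.map (fun w => (1 - PowerSeries.C w * PowerSeries.X : PowerSeries ℂ))).prod := by
  have hA0 : A ≠ 0 := by rintro rfl; simp at h0
  refine ⟨A.roots.map (fun r => r⁻¹), ?_, ?_⟩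
  · rw [Multiset.card_map]; exact card_roots' A
  · have hs : A = (A.roots.map (fun r => (1 - Polynomial.C r⁻¹ * X : ℂ[X]))).prod := by
      have h1 := (IsAlgClosed.splits A).eq_prod_roots
      have hr : ∀ r ∈ A.roots, r ≠ 0 := by
        rintro r hr rfl
        have := (mem_roots'.1 hr).2
        rw [IsRoot, ← coeff_zero_eq_eval_zero, h0] at this
        exact one_ne_zero this
      have h2 : (A.roots.map (fun r => (X - Polynomial.C r : ℂ[X]))) = 
          A.roots.map (fun r => Polynomial.C (-r) * (1 - Polynomial.C r⁻¹ * X : ℂ[X])) := by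
        refine Multiset.map_congr rfl (fun r h => ?_)
        have : Polynomial.C r * Polynomial.C r⁻¹ = 1 := by rw [← C_mul, mul_inv_cancel₀ (hr r h), C_1]
        rw [C_neg]
        linear_combination (-X) * this
      rw [h2, Multiset.prod_map_mul, ← mul_assoc] at h1
      have h3 : Polynomial.C A.leadingCoeff * (A.roots.map (fun r => Polynomial.C (-r))).prod = 1 := by
        have e : (A.roots.map (fun r => Polynomial.C (-r))).prod = Polynomial.C ((A.roots.map (fun r => -r)).prod) := by
          rw [map_multiset_prod, Multiset.map_map]; rfl
        have e2 := congrArg (eval 0) h1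
        rw [← coeff_zero_eq_eval_zero, h0, e, ← C_mul, eval_mul, eval_C, eval_multiset_prod, Multiset.map_map] at e2
        simp at e2
        rw [e, ← C_mul]
        have e3 : A.leadingCoeff * (A.roots.map (fun r => -r)).prod = 1 := by simpa using e2.symm
        rw [e3, C_1]
      rw [h3, one_mul] at h1
      exact h1
    conv_lhs => rw [hs]
    rw [← Polynomial.coeToPowerSeries.ringHom_apply, map_multiset_prod, Multiset.map_map, Multiset.map_map]
    congr 1
    refine Multiset.map_congr rfl (fun r _ => ?_)
    simp

theorem newton_bound (σ S : ℕ → ℂ) (D : ℕ) (Q C : ℝ) (hQ : 0 < Q) (h0 : σ 0 = 1) (hv : ∀ k, D + 1 ≤ k → σ k = 0)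
    (hN : ∀ k : ℕ, (k:ℂ) * σ k = ∑ m ∈ Finset.Icc 1 k, S m * σ (k - m))
    (hb : ∀ m : ℕ, 1 ≤ m → ‖S (2 * m)‖ ≤ C * Q ^ m) : ‖S 1‖ ≤ D * √Q := by
  classical
  let A : ℂ[X] := ∑ k ∈ Finset.range (D+1), monomial k (σ k)
  have hAc : ∀ k, A.coeff k = σ k := by
    intro k
    simp only [A, finsetSum_coeff, coeff_monomial]
    rw [Finset.sum_ite_eq']
    split_ifs with h
    · rfl
    · rw [hv k (by simpa using h)]
  have hdeg : A.natDegree ≤ D := by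
    rw [natDegree_le_iff_coeff_eq_zero]
    intro k hk
    rw [hAc, hv k hk]
  obtain ⟨s, hs, hAs⟩ := exists_factor A (by rw [hAc, h0])
  let SP : PowerSeries ℂ := PowerSeries.mk (fun m => if m = 0 then 0 else S m)
  have h1 : PowerSeries.X * PowerSeries.derivative ℂ (A : PowerSeries ℂ) = SP * (A : PowerSeries ℂ) := by
    symm
    ext k
    rw [PowerSeries.coeff_mul, Finset.Nat.sum_antidiagonal_eq_sum_range_succ_mk, Finset.sum_range_succ']
    simp only [SP, PowerSeries.coeff_mk, if_true, zero_mul, add_zero, Polynomial.coeff_coe, hAc]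
    have h2 := hN k
    have h3 : ∑ m ∈ Finset.Icc 1 k, S m * σ (k - m) = ∑ m ∈ Finset.range k, (if m + 1 = 0 then 0 else S (m+1)) * σ (k - (m+1)) := by
      rw [Finset.range_eq_Ico, Finset.sum_Ico_add' (fun m => (if m = 0 then 0 else S m) * σ (k - m)) 0 k 1]
      refine Finset.sum_congr rfl (fun m hm => ?_)
      rw [if_neg]
      have := (Finset.mem_Icc.1 hm).1
      omega
    rw [← h3, ← h2]
    rcases k with _ | k
    · simp
    · rw [PowerSeries.coeff_succ_X_mul, PowerSeries.coeff_derivative, Polynomial.coeff_coe, hAc]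
      push_cast; ring
  have hA0 : (A : PowerSeries ℂ) ≠ 0 := by
    intro h
    have := congrArg (PowerSeries.coeff 0) h
    rw [Polynomial.coeff_coe, hAc, h0] at this
    simp at this
  have h2 : SP = - (s.map geo).sum := by
    have h3 := deriv_prod s
    rw [← hAs, h1] at h3
    apply mul_right_cancel₀ hA0
    rw [h3]; ring
  have hS : ∀ m, 1 ≤ m → S m = - (s.map (fun w => w ^ m)).sum := by
    intro m hm
    have h3 := congrArg (PowerSeries.coeff m) h2
    have e : PowerSeries.coeff m (s.map geo).sum = (s.map (fun w => w ^ m)).sum := by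
      rw [map_multiset_sum, Multiset.map_map]
      congr 1
      refine Multiset.map_congr rfl (fun w _ => ?_)
      simp [geo]; omega
    rw [map_neg, e] at h3
    rw [← h3]
    simp [SP]; omega
  have hw : ∀ w ∈ s, ‖w‖ ≤ √Q := by
    intro w hw
    have hz := bounded_powersum (s.map (fun w => w ^ 2 / (Q:ℂ))) C (by
      intro m hm
      rw [Multiset.map_map]
      have e : (s.map ((fun z => z ^ m) ∘ fun w => w ^ 2 / (Q:ℂ))).sum = - S (2 * m) / (Q:ℂ) ^ m := by
        rw [hS _ (by omega), neg_neg, ← Multiset.sum_map_div]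
        congr 1
        refine Multiset.map_congr rfl (fun w _ => ?_)
        simp [div_pow, pow_mul]
      rw [e, norm_div, norm_neg, norm_pow, Complex.norm_real, Real.norm_of_nonneg hQ.le, div_le_iff₀ (by positivity)]
      exact hb m hm) (w ^ 2 / (Q:ℂ)) (Multiset.mem_map_of_mem _ hw)
    rw [norm_div, norm_pow, Complex.norm_real, Real.norm_of_nonneg hQ.le, div_le_iff₀ hQ, one_mul] at hz
    exact Real.le_sqrt_of_sq_le hz
  rw [hS 1 le_rfl, norm_neg]
  simp only [pow_one, Multiset.map_id']
  calc ‖s.sum‖ ≤ (s.map norm).sum := norm_multiset_sum_le s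
    _ ≤ (s.map norm).card • √Q := Multiset.sum_le_card_nsmul _ _ (by
        intro x hx
        obtain ⟨w, hw', rfl⟩ := Multiset.mem_map.1 hx
        exact hw w hw')
    _ ≤ D * √Q := by
      rw [Multiset.card_map, nsmul_eq_mul]
      exact mul_le_mul_of_nonneg_right (by exact_mod_cast hs.trans hdeg) (Real.sqrt_nonneg _)
end PartB5

section PartB6
open Polynomial IntermediateField

theorem weil_bound {L : Type} [Field L] [Fintype L] (χ : MulChar L ℂ) (ψ : AddChar L ℂ) {P F F' G : L[X]} {μ N : ℕ}
    (hPm : P.Monic) (hP : Irreducible P) (hF : F = P ^ μ * F') (hPF : ¬ P ∣ F') (hd : ¬ orderOf χ ∣ μ)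
    (hG : G.Monic) (hFG : F ∣ G ^ N) :
    ‖∑ x : L, χ (F.eval x) * ψ x‖ ≤ G.natDegree * √(Fintype.card L : ℝ) := by
  classical
  obtain ⟨C0, hC0, hC⟩ := crude_twisted χ ψ hP hF hPF hd
  have hQ0 : (0:ℝ) < Fintype.card L := by exact_mod_cast Fintype.card_pos
  have h1 : ∑ x : L, χ (F.eval x) * ψ x = SS L (lamb χ ψ F) 1 := by
    rw [SS_eq_sum (E := L) (Module.finrank_self L)]
    refine Finset.sum_congr rfl (fun x _ => ?_)
    rw [Algebra.norm_self, Algebra.trace_self]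
    simp
  rw [h1]
  refine newton_bound (sig L (lamb χ ψ F)) (SS L (lamb χ ψ F)) G.natDegree _ C0 hQ0 ?_ ?_ ?_ ?_
  · have : MP L 0 = {1} := by
      ext h
      rw [mem_MP, Finset.mem_singleton]
      constructor
      · rintro ⟨h1, h2⟩
        exact h1.natDegree_eq_zero.1 h2
      · rintro rfl
        exact ⟨monic_one, natDegree_one⟩
    rw [sig, this, Finset.sum_singleton, lamb_one]
  · intro k hk
    exact sig_vanish χ ψ hPm hP hF hPF hd hG hFG hk
  · exact newton_id _ (lamb_one χ ψ F) (lamb_mul χ ψ F)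
  · intro m hm
    obtain ⟨p, hp⟩ := CharP.exists L
    haveI : Fact p.Prime := ⟨CharP.char_is_prime L p⟩
    haveI : NeZero (2 * m) := ⟨by omega⟩
    let E := FiniteField.Extension L p (2 * m)
    haveI : Fintype E := Fintype.ofFinite E
    rw [SS_eq_sum (E := E) (FiniteField.finrank_extension L p (2 * m))]
    apply hC E m
    have := FiniteField.natCard_extension L p (2 * m)
    rw [Nat.card_eq_fintype_card, Nat.card_eq_fintype_card] at this
    rw [this, ← pow_add]; congr 1; omega
end PartB6

section PartC1
open Polynomial

def SRep {Γ X : Type} [CommGroup Γ] [Fintype Γ] (ev : Γ → X → ℂ) (H : Subgroup Γ) (w : X → ℝ) (θ M : ℝ) : Prop :=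
  ∃ A : Γ → ℂ, (∀ γ, γ ∉ H → A γ = 0) ∧ A 1 = θ ∧ ∑ γ, ‖A γ‖ ≤ M ∧ ∀ x, (w x : ℂ) = ∑ γ, A γ * ev γ x

section
variable {Γ X : Type} [CommGroup Γ] [Fintype Γ] {ev : Γ → X → ℂ}

theorem SRep.mono {H H' : Subgroup Γ} {w : X → ℝ} {θ M M' : ℝ} (h : SRep ev H w θ M) (hH : H ≤ H') (hM : M ≤ M') :
    SRep ev H' w θ M' := by
  obtain ⟨A, h1, h2, h3, h4⟩ := h
  exact ⟨A, fun γ hγ => h1 γ (fun h => hγ (hH h)), h2, h3.trans hM, h4⟩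

theorem SRep.one (dom : X → ℝ) (hdom : ∀ x, ev 1 x = dom x) : SRep ev ⊥ dom 1 1 := by
  classical
  refine ⟨fun γ => if γ = 1 then 1 else 0, ?_, by simp, ?_, ?_⟩
  · intro γ hγ
    beta_reduce
    rw [if_neg]
    rintro rfl
    exact hγ (Subgroup.one_mem _)
  · simp [apply_ite]
  · intro x
    simp [hdom]

theorem SRep.sub {H : Subgroup Γ} {w w' : X → ℝ} {θ θ' M M' : ℝ} (h : SRep ev H w θ M) (h' : SRep ev H w' θ' M') :
    SRep ev H (fun x => w x - w' x) (θ - θ') (M + M') := by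
  obtain ⟨A, h1, h2, h3, h4⟩ := h
  obtain ⟨A', h1', h2', h3', h4'⟩ := h'
  refine ⟨fun γ => A γ - A' γ, ?_, ?_, ?_, ?_⟩
  · intro γ hγ; simp [h1 γ hγ, h1' γ hγ]
  · simp [h2, h2']
  · calc ∑ γ, ‖A γ - A' γ‖ ≤ ∑ γ, (‖A γ‖ + ‖A' γ‖) := Finset.sum_le_sum (fun γ _ => norm_sub_le _ _)
      _ ≤ M + M' := by rw [Finset.sum_add_distrib]; linarith
  · intro x
    push_cast
    rw [h4, h4', ← Finset.sum_sub_distrib]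
    simp [sub_mul]

theorem SRep.mul {H H' : Subgroup Γ} {w w' : X → ℝ} {θ θ' M M' : ℝ} (hev : ∀ γ δ x, ev (γ * δ) x = ev γ x * ev δ x)
    (h : SRep ev H w θ M) (h' : SRep ev H' w' θ' M') (hM : 0 ≤ M) (hd : Disjoint H H') :
    SRep ev (H ⊔ H') (fun x => w x * w' x) (θ * θ') (M * M') := by
  obtain ⟨A, h1, h2, h3, h4⟩ := h
  obtain ⟨A', h1', h2', h3', h4'⟩ := h'
  refine ⟨fun γ => ∑ δ, A δ * A' (δ⁻¹ * γ), ?_, ?_, ?_, ?_⟩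
  · intro γ hγ
    refine Finset.sum_eq_zero (fun δ _ => ?_)
    by_cases hδ : δ ∈ H
    · rw [h1' (δ⁻¹ * γ), mul_zero]
      intro hc
      apply hγ
      have := Subgroup.mul_mem_sup hδ hc
      rwa [mul_inv_cancel_left] at this
    · rw [h1 δ hδ, zero_mul]
  · beta_reduce
    rw [Finset.sum_eq_single 1]
    · simp [h2, h2']
    · intro δ _ hδ
      by_cases hδH : δ ∈ H
      · rw [h1' (δ⁻¹ * 1), mul_zero]
        intro hc
        rw [mul_one, Subgroup.inv_mem_iff] at hc
        exact hδ ((Subgroup.disjoint_def.1 hd) hδH hc)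
      · rw [h1 δ hδH, zero_mul]
    · simp
  · calc ∑ γ, ‖∑ δ, A δ * A' (δ⁻¹ * γ)‖ ≤ ∑ γ, ∑ δ, ‖A δ‖ * ‖A' (δ⁻¹ * γ)‖ :=
          Finset.sum_le_sum (fun γ _ => (norm_sum_le _ _).trans_eq (by simp))
      _ = ∑ δ, ‖A δ‖ * ∑ γ, ‖A' γ‖ := by
          rw [Finset.sum_comm]
          refine Finset.sum_congr rfl (fun δ _ => ?_)
          rw [Finset.mul_sum]
          exact (Fintype.sum_equiv (Equiv.mulLeft δ⁻¹) _ (fun γ => ‖A δ‖ * ‖A' γ‖) (fun γ => rfl))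
      _ ≤ M * M' := by
          rw [← Finset.sum_mul]
          exact mul_le_mul h3 h3' (Finset.sum_nonneg (fun _ _ => norm_nonneg _)) hM
  · intro x
    push_cast
    rw [h4, h4', Finset.sum_mul_sum]
    simp_rw [Finset.sum_mul]
    rw [Finset.sum_comm (f := fun γ δ => A δ * A' (δ⁻¹ * γ) * ev γ x)]
    refine Finset.sum_congr rfl (fun δ _ => ?_)
    refine Fintype.sum_equiv (Equiv.mulLeft δ) _ _ (fun γ => ?_)
    simp only [Equiv.coe_mulLeft, inv_mul_cancel_left, hev]
    ring

theorem SRep.sum_bound [Fintype X] {H : Subgroup Γ} {w : X → ℝ} {θ M B : ℝ} (h : SRep ev H w θ M) (hB0 : 0 ≤ B)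
    (dom : X → ℝ) (hdom : ∀ x, ev 1 x = dom x)
    (hB : ∀ γ, γ ≠ 1 → ‖∑ x, ev γ x‖ ≤ B) : θ * ∑ x, dom x - M * B ≤ ∑ x, w x := by
  classical
  obtain ⟨A, h1, h2, h3, h4⟩ := h
  have e1 : ((∑ x, w x : ℝ) : ℂ) = ∑ γ, A γ * ∑ x, ev γ x := by
    push_cast
    simp_rw [h4, Finset.mul_sum]
    rw [Finset.sum_comm]
  rw [← Finset.add_sum_erase _ _ (Finset.mem_univ (1:Γ))] at e1
  simp_rw [hdom, h2] at e1
  have e2 : ‖((∑ x, w x - θ * ∑ x, dom x : ℝ) : ℂ)‖ ≤ M * B := by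
    have : ((∑ x, w x - θ * ∑ x, dom x : ℝ) : ℂ) = ∑ γ ∈ Finset.univ.erase 1, A γ * ∑ x, ev γ x := by
      rw [Complex.ofReal_sub, e1]; push_cast; ring
    rw [this]
    calc _ ≤ ∑ γ ∈ Finset.univ.erase 1, ‖A γ‖ * B := by
            refine (norm_sum_le _ _).trans (Finset.sum_le_sum (fun γ hγ => ?_))
            rw [norm_mul]
            exact mul_le_mul_of_nonneg_left (hB γ (Finset.ne_of_mem_erase hγ)) (norm_nonneg _)
      _ ≤ ∑ γ, ‖A γ‖ * B := Finset.sum_le_sum_of_subset_of_nonneg (Finset.erase_subset _ _)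
            (fun _ _ _ => mul_nonneg (norm_nonneg _) hB0)
      _ ≤ M * B := by rw [← Finset.sum_mul]; exact mul_le_mul_of_nonneg_right h3 hB0
  rw [Complex.norm_real] at e2
  have := (abs_le.1 e2).1
  linarith

open Classical in
noncomputable def uu (ev : Γ → X → ℂ) (H : Subgroup Γ) (dom : X → ℝ) (x : X) : ℝ :=
  if ∀ γ ∈ H, ev γ x = 1 then dom x else 0

open Classical in
theorem rep_coeff_sum (H : Subgroup Γ) (dom : X → ℝ) (hdom : ∀ x, ev 1 x = dom x) (hdom01 : ∀ x, dom x = 0 ∨ dom x = 1)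
    (hev : ∀ γ δ x, ev (γ * δ) x = ev γ x * ev δ x) (x : X) :
    (Nat.card H : ℂ) * (uu ev H dom x : ℂ) = ∑ γ : H, ev γ x := by
  classical
  unfold uu
  split_ifs with h
  · rw [Fintype.sum_congr (fun γ : H => ev γ x) (fun _ => (1:ℂ)) (fun γ => h γ γ.2)]
    rw [← hdom, h 1 (Subgroup.one_mem _)]
    simp [Nat.card_eq_fintype_card]
  · push Not at h
    obtain ⟨γ0, hγ0, hne⟩ := h
    have : ev γ0 x * ∑ γ : H, ev γ x = ∑ γ : H, ev γ x := by
      rw [Finset.mul_sum]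
      refine Fintype.sum_equiv (Equiv.mulLeft (⟨γ0, hγ0⟩ : H)) _ _ (fun γ => ?_)
      simp [hev]
    have h2 : (ev γ0 x - 1) * ∑ γ : H, ev γ x = 0 := by linear_combination this
    rw [(mul_eq_zero.1 h2).resolve_left (sub_ne_zero.2 hne)]
    simp

theorem SRep.ind (H : Subgroup Γ) (dom : X → ℝ) (hdom : ∀ x, ev 1 x = dom x) (hdom01 : ∀ x, dom x = 0 ∨ dom x = 1)
    (hev : ∀ γ δ x, ev (γ * δ) x = ev γ x * ev δ x) :
    SRep ev H (uu ev H dom) (1 / Nat.card H) 1 ∧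
    SRep ev H (fun x => dom x - uu ev H dom x) (1 - 1 / Nat.card H) (2 * (1 - 1 / Nat.card H)) := by
  classical
  have hN : (Nat.card H : ℂ) ≠ 0 := by exact_mod_cast Nat.card_pos.ne'
  have hNr : (0:ℝ) < Nat.card H := by exact_mod_cast Nat.card_pos
  have hN1 : (1:ℝ) ≤ Nat.card H := by exact_mod_cast Nat.card_pos
  have hsum : ∀ (f : Γ → ℂ), ∑ γ : Γ, (if γ ∈ H then f γ else 0) = ∑ γ : H, f γ := by
    intro f
    rw [← Finset.sum_filter]
    exact Finset.sum_subtype _ (by simp) f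
  have hsumr : ∀ (f : Γ → ℝ), ∑ γ : Γ, (if γ ∈ H then f γ else 0) = ∑ γ : H, f γ := by
    intro f
    rw [← Finset.sum_filter]
    exact Finset.sum_subtype _ (by simp) f
  have hval : ∀ x, (uu ev H dom x : ℂ) = ∑ γ, (if γ ∈ H then (1 / Nat.card H : ℂ) else 0) * ev γ x := by
    intro x
    have := rep_coeff_sum H dom hdom hdom01 hev x
    simp_rw [ite_mul, zero_mul]
    rw [hsum, ← Finset.mul_sum, ← this]
    field_simp
  constructor
  · refine ⟨fun γ => if γ ∈ H then (1 / Nat.card H : ℂ) else 0, ?_, ?_, ?_, hval⟩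
    · intro γ hγ; simp [hγ]
    · simp
    · simp only [apply_ite norm, norm_zero]
      rw [hsumr]
      simp [Nat.card_eq_fintype_card] 
  · refine ⟨fun γ => (if γ = 1 then 1 else 0) - if γ ∈ H then (1 / Nat.card H : ℂ) else 0, ?_, ?_, ?_, ?_⟩
    · intro γ hγ
      have : γ ≠ 1 := by rintro rfl; exact hγ (Subgroup.one_mem _)
      simp [hγ, this]
    · simp
    · have e : ∀ γ : Γ, ‖((if γ = 1 then 1 else 0) - if γ ∈ H then (1 / Nat.card H : ℂ) else 0)‖ =
          (if γ = 1 then (1 - 2 / Nat.card H : ℝ) else 0) + if γ ∈ H then (1 / Nat.card H : ℝ) else 0 := by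
        intro γ
        by_cases h1 : γ = 1
        · subst h1
          simp only [if_true, Subgroup.one_mem]
          have : (1 - 1 / (Nat.card H : ℂ)) = ((1 - 1 / (Nat.card H : ℝ) : ℝ) : ℂ) := by push_cast; rfl
          rw [this, Complex.norm_real, Real.norm_of_nonneg]
          · ring
          · rw [sub_nonneg, div_le_one hNr]; exact hN1
        · by_cases h2 : γ ∈ H <;> simp [h1, h2]
      simp_rw [e]
      rw [Finset.sum_add_distrib, hsumr]
      simp [← Nat.card_eq_fintype_card]
      have : (Nat.card H : ℝ) * (Nat.card H : ℝ)⁻¹ = 1 := mul_inv_cancel₀ hNr.ne'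
      rw [div_eq_mul_inv]
      linarith
    · intro x
      push_cast
      rw [hval]
      simp_rw [sub_mul]
      rw [Finset.sum_sub_distrib]
      simp [hdom]

theorem abstract_sieve [Fintype X] {ι : Type} (H : ι → Subgroup Γ) (hH : iSupIndep H)
    (dom : X → ℝ) (hdom : ∀ x, ev 1 x = dom x) (hdom01 : ∀ x, dom x = 0 ∨ dom x = 1)
    (hev : ∀ γ δ x, ev (γ * δ) x = ev γ x * ev δ x) {B : ℝ} (hB0 : 0 ≤ B)
    (hB : ∀ γ, γ ≠ 1 → ‖∑ x, ev γ x‖ ≤ B) (C S : Finset ι) (hCS : Disjoint C S)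
    (hC : ∀ i ∈ C, 2 ≤ Nat.card (H i))
    (hpos : 0 ≤ 1 - ∑ i ∈ S, (1 / Nat.card (H i) : ℝ))
    (hmain : B * 2 ^ C.card * (1 + S.card) < (1 - ∑ i ∈ S, (1 / Nat.card (H i) : ℝ)) * ∑ x, dom x) :
    ∃ x, dom x = 1 ∧ ∀ i, i ∈ C ∨ i ∈ S → ¬ ∀ γ ∈ H i, ev γ x = 1 := by
  classical
  have hcore : ∀ T : Finset ι, T ⊆ C → ∃ θ : ℝ, 0 < θ ∧
      SRep ev (⨆ i ∈ T, H i) (fun x => dom x * ∏ i ∈ T, (dom x - uu ev (H i) dom x)) θ (2 ^ T.card * θ) := by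
    intro T
    induction T using Finset.induction_on with
    | empty => 
      intro _
      exact ⟨1, one_pos, by simpa using SRep.one dom hdom⟩
    | insert j T hj ih =>
      intro hT
      obtain ⟨θ, hθ, hrep⟩ := ih ((Finset.subset_insert _ _).trans hT)
      have h2 := hC j (hT (Finset.mem_insert_self _ _))
      have h2' : (2:ℝ) ≤ Nat.card (H j) := by exact_mod_cast h2
      have hθj : 0 < 1 - 1 / (Nat.card (H j) : ℝ) := by
        rw [sub_pos, div_lt_one (by linarith)]; linarith
      refine ⟨(1 - 1 / (Nat.card (H j) : ℝ)) * θ, by positivity, ?_⟩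
      have hdis : Disjoint (H j) (⨆ i ∈ T, H i) := by
        refine (hH j).mono_right ?_
        refine iSup₂_le (fun i hi => ?_)
        refine le_iSup₂_of_le i ?_ le_rfl
        rintro rfl; exact hj hi
      have := SRep.mul hev (SRep.ind (H j) dom hdom hdom01 hev).2 hrep (by positivity) hdis
      rw [Finset.iSup_insert, Finset.card_insert_of_notMem hj]
      convert this using 1
      · funext x
        rw [Finset.prod_insert hj]; ring
      · ring
  have hsv : ∀ T : Finset ι, T ⊆ S → 
      SRep ev (⨆ i ∈ T, H i) (fun x => dom x - ∑ i ∈ T, uu ev (H i) dom x) (1 - ∑ i ∈ T, (1 / Nat.card (H i) : ℝ)) (1 + T.card) := by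
    intro T
    induction T using Finset.induction_on with
    | empty => 
      intro _
      simpa using SRep.one dom hdom
    | insert j T hj ih =>
      intro hT
      have hrep := ih ((Finset.subset_insert _ _).trans hT)
      have hle : (⨆ i ∈ T, H i) ≤ ⨆ i ∈ insert j T, H i := by
        rw [Finset.iSup_insert]; exact le_sup_right
      have hle2 : H j ≤ ⨆ i ∈ insert j T, H i := by
        rw [Finset.iSup_insert]; exact le_sup_left
      have := SRep.sub (hrep.mono hle le_rfl) ((SRep.ind (H j) dom hdom hdom01 hev).1.mono hle2 le_rfl)
      convert this using 1
      · funext x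
        rw [Finset.sum_insert hj]; ring
      · rw [Finset.sum_insert hj]; ring
      · rw [Finset.card_insert_of_notMem hj]; push_cast; ring
  obtain ⟨θ, hθ, hr1⟩ := hcore C subset_rfl
  have hr2 := hsv S subset_rfl
  haveI : IsCompactlyGenerated (Subgroup Γ) := CompleteLattice.isCompactlyGenerated_of_wellFoundedGT
  have hdis : Disjoint (⨆ i ∈ C, H i) (⨆ i ∈ S, H i) := hH.disjoint_biSup_biSup (by exact_mod_cast hCS)
  have hr := SRep.mul hev hr1 hr2 (by positivity) hdis
  have hb := hr.sum_bound hB0 dom hdom hB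
  set δ := 1 - ∑ i ∈ S, (1 / Nat.card (H i) : ℝ) with hδ
  have hgt : 0 < ∑ x, (dom x * ∏ i ∈ C, (dom x - uu ev (H i) dom x)) * (dom x - ∑ i ∈ S, uu ev (H i) dom x) := by
    refine lt_of_lt_of_le ?_ hb
    have := mul_lt_mul_of_pos_left hmain hθ
    nlinarith
  obtain ⟨x, -, hx⟩ := Finset.exists_lt_of_sum_lt (s := Finset.univ) (f := fun _ : X => (0:ℝ)) (by simpa using hgt)
  have huu : ∀ i, uu ev (H i) dom x = dom x ∨ uu ev (H i) dom x = 0 := by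
    intro i; unfold uu; split_ifs <;> simp
  have hd1 : dom x = 1 := by
    rcases hdom01 x with h | h
    · simp [h] at hx
    · exact h
  have huu0 : ∀ i, 0 ≤ uu ev (H i) dom x := by
    intro i; rcases huu i with h | h <;> simp [h, hd1]
  refine ⟨x, hd1, ?_⟩
  have hne : ∀ i, i ∈ C ∨ i ∈ S → uu ev (H i) dom x ≠ dom x := by
    rintro i (hi | hi) he
    · rw [Finset.prod_eq_zero hi (by rw [he, sub_self])] at hx
      simp at hx
    · have h1 : 0 ≤ dom x * ∏ i ∈ C, (dom x - uu ev (H i) dom x) := by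
        refine mul_nonneg (by rw [hd1]; norm_num) (Finset.prod_nonneg (fun i _ => ?_))
        rcases huu i with h | h <;> simp [h, hd1]
      have h2 : dom x ≤ ∑ i ∈ S, uu ev (H i) dom x := by
        rw [← he]
        exact Finset.single_le_sum (f := fun i => uu ev (H i) dom x) (fun j _ => huu0 j) hi
      nlinarith
  intro i hi hall
  apply hne i hi
  unfold uu
  rw [if_pos hall]
end
end PartC1

section PartC2
open Polynomial

theorem exists_gen_char (L : Type) [Field L] [Fintype L] :
    ∃ χ : MulChar L ℂ, orderOf χ = Fintype.card L - 1 ∧ ∀ η : MulChar L ℂ, ∃ a : ℕ, 0 < a ∧ χ ^ a = η := by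
  classical
  have hζ := Complex.isPrimitiveRoot_exp (Fintype.card Lˣ) Fintype.card_ne_zero
  obtain ⟨χ, hχ⟩ := MulChar.exists_mulChar_orderOf_eq_card_units L hζ
  refine ⟨χ, by rw [hχ, Fintype.card_units], fun η => ?_⟩
  have htop : Subgroup.zpowers χ = ⊤ := by
    apply Subgroup.eq_top_of_card_eq
    haveI : HasEnoughRootsOfUnity ℂ (Monoid.exponent Lˣ) := inferInstance
    rw [Nat.card_zpowers, hχ, MulChar.card_eq_card_units_of_hasEnoughRootsOfUnity, Nat.card_eq_fintype_card]
  have hmem : η ∈ Subgroup.zpowers χ := by rw [htop]; exact Subgroup.mem_top _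
  rw [← mem_powers_iff_mem_zpowers] at hmem
  obtain ⟨a, ha⟩ := hmem
  refine ⟨a + orderOf χ, ?_, ?_⟩
  · rw [hχ]; have : 0 < Fintype.card Lˣ := Fintype.card_pos
    omega
  · rw [pow_add, pow_orderOf_eq_one, mul_one]; exact ha

theorem mixed_main {L : Type} [Field L] [Fintype L] (hQ : 2 < Fintype.card L) {f1 f2 g : L[X]} {k : ℕ}
    (h1 : f1.natDegree ≤ 3) (h2 : f2.natDegree ≤ 2) (hcop : IsCoprime f1 f2) (hf1 : f1 ≠ 0) (hf2 : f2 ≠ 0)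
    (hk0 : 0 < k) (hgm : g.Monic) (hgi : Irreducible g) (hgX : g ≠ X) (hk : Nat.gcd k (Fintype.card L - 1) = 1)
    (hd : g ^ k ∣ f1 * f2) (hnd : ¬ g ^ (k + 1) ∣ f1 * f2) (χ₁ χ₂ : MulChar L ℂ) (ψ : AddChar L ℂ) (hχ₂ : χ₂ ≠ 1) :
    ‖∑ x : L, χ₁ x * χ₂ (f1.eval x / f2.eval x) * ψ x‖ ≤ 6 * √(Fintype.card L : ℝ) := by
  classical
  set Q := Fintype.card L with hQdef
  obtain ⟨χ, hord, hgen⟩ := exists_gen_char L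
  obtain ⟨a, ha, rfl⟩ := hgen χ₁
  obtain ⟨b, hb, rfl⟩ := hgen χ₂
  have hndb : ¬ (Q - 1) ∣ b := by
    intro h
    apply hχ₂
    rw [← hord] at h
    exact orderOf_dvd_iff_pow_eq_one.1 h
  set F : L[X] := X ^ a * f1 ^ b * f2 ^ ((Q - 2) * b) with hF
  have hval : ∀ x : L, (χ ^ a) x * (χ ^ b) (f1.eval x / f2.eval x) * ψ x = χ (F.eval x) * ψ x := by
    intro x
    congr 1
    rw [MulChar.pow_apply' _ ha.ne', MulChar.pow_apply' _ hb.ne', ← map_pow, ← map_pow, ← map_mul]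
    congr 1
    have hinv : ∀ y : L, y⁻¹ = y ^ (Q - 2) := by
      intro y
      by_cases hy : y = 0
      · rw [hy, inv_zero, zero_pow (by omega)]
      · have := FiniteField.pow_card_sub_one_eq_one y hy
        rw [show Fintype.card L - 1 = (Q - 2) + 1 by omega, pow_succ] at this
        exact inv_eq_of_mul_eq_one_left this
    rw [hF]
    simp only [eval_mul, eval_pow, eval_X]
    rw [div_eq_mul_inv, hinv, mul_pow, pow_mul]
    ring
  simp_rw [hval]
  have hne : X * f1 * f2 ≠ 0 := mul_ne_zero (mul_ne_zero X_ne_zero hf1) hf2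
  set G : L[X] := (X * f1 * f2) * C (X * f1 * f2).leadingCoeff⁻¹ with hG
  have hGm : G.Monic := monic_mul_leadingCoeff_inv hne
  have hGd : G.natDegree ≤ 6 := by
    rw [hG, natDegree_mul_leadingCoeff_inv _ hne]
    refine natDegree_mul_le.trans ?_
    have : (X * f1 : L[X]).natDegree ≤ 1 + f1.natDegree := natDegree_mul_le.trans (by rw [natDegree_X])
    omega
  have hFG : F ∣ G ^ (a + b + (Q - 2) * b) := by
    have e1 : F ∣ (X * f1 * f2) ^ (a + b + (Q - 2) * b) := by
      rw [pow_add, pow_add, hF]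
      refine mul_dvd_mul (mul_dvd_mul ?_ ?_) ?_
      · exact pow_dvd_pow_of_dvd ⟨f1 * f2, by ring⟩ _
      · exact pow_dvd_pow_of_dvd ⟨X * f2, by ring⟩ _
      · exact pow_dvd_pow_of_dvd ⟨X * f1, by ring⟩ _
    exact e1.trans (pow_dvd_pow_of_dvd ⟨_, hG⟩ _)
  have hgX' : ¬ g ∣ X := by
    intro h
    apply hgX
    have h3 : Associated g X := (irreducible_X (R := L)).dvd_iff.1 h |>.resolve_left hgi.not_isUnit |>.symm
    exact eq_of_monic_of_associated hgm monic_X h3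
  have hgp : Prime g := hgi.prime
  have hfin : ∀ (μ : ℕ) (F' : L[X]), F = g ^ μ * F' → ¬ g ∣ F' → ¬ orderOf χ ∣ μ →
      ‖∑ x : L, χ (F.eval x) * ψ x‖ ≤ 6 * √(Q : ℝ) := by
    intro μ F' e1 e2 e3
    refine (weil_bound χ ψ hgm hgi e1 e2 e3 hGm hFG).trans ?_
    exact mul_le_mul_of_nonneg_right (by exact_mod_cast hGd) (Real.sqrt_nonneg _)
  rw [hord] at hfin
  have hgdvd : g ∣ f1 * f2 := (dvd_pow_self g hk0.ne').trans hd
  rcases hgp.dvd_or_dvd hgdvd with hg1 | hg2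
  · have hg2 : ¬ g ∣ f2 := fun h => hgi.not_isUnit (hcop.isUnit_of_dvd' hg1 h)
    have hcg : IsCoprime (g ^ k) f2 := ((hgi.coprime_iff_not_dvd).2 hg2).pow_left
    obtain ⟨f1', hf1'⟩ := hcg.dvd_of_dvd_mul_right hd
    have hnf : ¬ g ∣ f1' := by
      rintro ⟨z, hz⟩
      apply hnd
      rw [hf1', hz]
      exact ⟨z * f2, by ring⟩
    refine hfin (k * b) (X ^ a * f1' ^ b * f2 ^ ((Q - 2) * b)) ?_ ?_ ?_
    · rw [hF, hf1', mul_pow, ← pow_mul]; ring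
    · intro h
      rcases hgp.dvd_or_dvd h with h | h
      · rcases hgp.dvd_or_dvd h with h | h
        · exact hgX' (hgp.dvd_of_dvd_pow h)
        · exact hnf (hgp.dvd_of_dvd_pow h)
      · exact hg2 (hgp.dvd_of_dvd_pow h)
    · intro h
      exact hndb ((Nat.Coprime.symm hk).dvd_of_dvd_mul_left h)
  · have hg1 : ¬ g ∣ f1 := fun h => hgi.not_isUnit (hcop.isUnit_of_dvd' h hg2)
    have hcg : IsCoprime (g ^ k) f1 := ((hgi.coprime_iff_not_dvd).2 hg1).pow_left
    obtain ⟨f2', hf2'⟩ := hcg.dvd_of_dvd_mul_left hd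
    have hnf : ¬ g ∣ f2' := by
      rintro ⟨z, hz⟩
      apply hnd
      rw [hf2', hz]
      exact ⟨z * f1, by ring⟩
    refine hfin (k * ((Q - 2) * b)) (X ^ a * f1 ^ b * f2' ^ ((Q - 2) * b)) ?_ ?_ ?_
    · rw [hF, hf2', mul_pow, ← pow_mul]; ring
    · intro h
      rcases hgp.dvd_or_dvd h with h | h
      · rcases hgp.dvd_or_dvd h with h | h
        · exact hgX' (hgp.dvd_of_dvd_pow h)
        · exact hg1 (hgp.dvd_of_dvd_pow h)
      · exact hnf (hgp.dvd_of_dvd_pow h)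
    · intro h
      have h3 := (Nat.Coprime.symm hk).dvd_of_dvd_mul_left h
      have h4 : Nat.Coprime (Q - 1) (Q - 2) := by
        rw [show Q - 1 = (Q - 2) + 1 by omega]
        exact (Nat.coprime_self_add_right (m := Q - 2) (n := 1)).2 (by simp) |>.symm
      exact hndb (h4.dvd_of_dvd_mul_left h3)

theorem mixed_bound {L : Type} [Field L] [Fintype L] (hQ : 2 < Fintype.card L) {f1 f2 g : L[X]} {k : ℕ}
    (h1 : f1.natDegree ≤ 3) (h2 : f2.natDegree ≤ 2) (hcop : IsCoprime f1 f2) (hf1 : f1 ≠ 0) (hf2 : f2 ≠ 0)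
    (hk0 : 0 < k) (hgm : g.Monic) (hgi : Irreducible g) (hgX : g ≠ X) (hk : Nat.gcd k (Fintype.card L - 1) = 1)
    (hd : g ^ k ∣ f1 * f2) (hnd : ¬ g ^ (k + 1) ∣ f1 * f2) (χ₁ χ₂ : MulChar L ℂ) (ψ : AddChar L ℂ)
    (hne : ¬ (χ₁ = 1 ∧ χ₂ = 1 ∧ ψ = 1)) :
    ‖∑ x : L, χ₁ x * χ₂ (f1.eval x / f2.eval x) * ψ x‖ ≤ 6 * √(Fintype.card L : ℝ) := by
  classical
  by_cases hχ₂ : χ₂ = 1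
  swap
  · exact mixed_main hQ h1 h2 hcop hf1 hf2 hk0 hgm hgi hgX hk hd hnd χ₁ χ₂ ψ hχ₂
  subst hχ₂
  set Q := Fintype.card L with hQdef
  have hQ1 : (1:ℝ) ≤ √(Q:ℝ) := by
    rw [Real.one_le_sqrt]; exact_mod_cast (by omega : 1 ≤ Q)
  have hψ1 : ∀ x, ‖ψ x‖ ≤ 1 := fun x => (AddChar.norm_apply ψ x).le
  set Z := (f1 * f2).roots.toFinset with hZ
  have hZc : (Z.card : ℝ) ≤ 5 := by
    have : Z.card ≤ 5 := by
      refine (Multiset.toFinset_card_le _).trans ((card_roots' _).trans (natDegree_mul_le.trans ?_))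
      omega
    exact_mod_cast this
  have hZm : ∀ x, x ∈ Z ↔ f1.eval x / f2.eval x = 0 := by
    intro x
    rw [hZ, Multiset.mem_toFinset, mem_roots (mul_ne_zero hf1 hf2), IsRoot, eval_mul, div_eq_zero_iff, mul_eq_zero]
  have hsplit : ∀ (v : L → ℂ), (∑ x : L, v x * (1 : MulChar L ℂ) (f1.eval x / f2.eval x) * ψ x) =
      ∑ x : L, v x * ψ x - ∑ x ∈ Z, v x * ψ x := by
    intro v
    rw [eq_sub_iff_add_eq, ← Finset.sum_filter_add_sum_filter_not Finset.univ (· ∈ Z) (fun x => v x * ψ x)]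
    rw [Finset.filter_univ_mem, add_comm]
    congr 1
    rw [Finset.sum_filter]
    refine Finset.sum_congr rfl (fun x _ => ?_)
    by_cases hx : x ∈ Z
    · rw [if_neg (by simpa using hx), (hZm x).1 hx, MulChar.map_zero]; simp
    · rw [if_pos hx]
      have : f1.eval x / f2.eval x ≠ 0 := fun h => hx ((hZm x).2 h)
      rw [MulChar.one_apply this.isUnit, mul_one]
  rw [hsplit]
  have hZb : ‖∑ x ∈ Z, χ₁ x * ψ x‖ ≤ 5 := by
    refine (norm_sum_le _ _).trans ?_
    refine (Finset.sum_le_card_nsmul Z _ 1 ?_).trans (by simpa using hZc)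
    intro x _
    rw [norm_mul]
    exact mul_le_one₀ (mulChar_norm_le_one χ₁ x) (norm_nonneg _) (hψ1 x)
  refine (norm_sub_le _ _).trans ?_
  by_cases hχ₁ : χ₁ = 1
  · subst hχ₁
    have hψ : ψ ≠ 1 := fun h => hne ⟨rfl, rfl, h⟩
    have e : ∑ x : L, (1 : MulChar L ℂ) x * ψ x = -1 := by
      have h0 := AddChar.sum_eq_zero_of_ne_one hψ
      rw [← Finset.add_sum_erase _ _ (Finset.mem_univ (0:L)), AddChar.map_zero_eq_one] at h0
      rw [← Finset.add_sum_erase _ _ (Finset.mem_univ (0:L)), MulChar.map_zero, zero_mul, zero_add]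
      rw [Finset.sum_congr rfl (g := fun x => ψ x)]
      · linear_combination h0
      · intro x hx
        rw [MulChar.one_apply (Finset.ne_of_mem_erase hx).isUnit, one_mul]
    rw [e]
    simp only [norm_neg, norm_one]
    linarith
  · have hw := weil_bound χ₁ ψ (P := X) (F := X) (F' := 1) (G := X) (μ := 1) (N := 1) monic_X irreducible_X
      (by simp) (by rw [← isUnit_iff_dvd_one]; exact not_isUnit_X) (by rw [Nat.dvd_one, orderOf_eq_one_iff]; exact hχ₁) monic_X (by simp)
    simp only [eval_X, natDegree_X, Nat.cast_one, one_mul] at hw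
    linarith
end PartC2

section PartC3
open Polynomial

noncomputable def Fr (K L : Type) [Field K] [Fintype K] [Field L] [Algebra K L] : Module.End K L :=
  (FiniteField.frobeniusAlgHom K L).toLinearMap

section
variable {K L : Type} [Field K] [Fintype K] [Field L] [Fintype L] [Algebra K L]

theorem Fr_pow (i : ℕ) (x : L) : (Fr K L ^ i) x = x ^ Fintype.card K ^ i := by
  induction i generalizing x with
  | zero => simp
  | succ i ih =>
    rw [pow_succ, Module.End.mul_apply, ih]
    change (FiniteField.frobeniusAlgHom K L x) ^ _ = _
    rw [FiniteField.frobeniusAlgHom_apply, ← pow_mul, ← pow_succ']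

theorem aeval_Fr (P : K[X]) (x : L) : aeval (Fr K L) P x = P.sum fun i a => algebraMap K L a * x ^ Fintype.card K ^ i := by
  rw [aeval_eq_sum_range, P.sum_over_range (by simp)]
  simp only [LinearMap.coe_sum, Finset.sum_apply, LinearMap.smul_apply, Fr_pow]
  exact Finset.sum_congr rfl fun i _ => Algebra.smul_def _ _

theorem aeval_Fr_zero {n : ℕ} (hn : Fintype.card L = Fintype.card K ^ n) : aeval (Fr K L) (X ^ n - 1 : K[X]) = 0 := by
  ext x
  rw [map_sub, map_pow, aeval_X, map_one, LinearMap.sub_apply, Fr_pow, ← hn, FiniteField.pow_card]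
  simp

theorem card_ker_le {h : K[X]} (hh : h ≠ 0) :
    Nat.card (LinearMap.ker (aeval (Fr K L) h)) ≤ Fintype.card K ^ h.natDegree := by
  classical
  have hq : 1 < Fintype.card K := Fintype.one_lt_card
  let R : L[X] := ∑ i ∈ Finset.range (h.natDegree + 1), C (algebraMap K L (h.coeff i)) * X ^ (Fintype.card K ^ i)
  have hR0 : R ≠ 0 := by
    intro h0
    have := congrArg (fun p => p.coeff (Fintype.card K ^ h.natDegree)) h0
    simp only [R, finsetSum_coeff, coeff_C_mul, coeff_X_pow, coeff_zero] at this
    rw [Finset.sum_eq_single h.natDegree] at this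
    · simp at this; exact hh this
    · intro i _ hi
      rw [if_neg, mul_zero]
      intro he
      exact hi (Nat.pow_right_injective hq he).symm
    · simp
  have hRd : R.natDegree ≤ Fintype.card K ^ h.natDegree := by
    refine natDegree_sum_le_of_forall_le _ _ (fun i hi => ?_)
    refine (natDegree_C_mul_X_pow_le _ _).trans ?_
    exact Nat.pow_le_pow_right hq.le (by simpa [Nat.lt_succ_iff] using hi)
  have hRe : ∀ x, R.eval x = aeval (Fr K L) h x := by
    intro x
    rw [aeval_Fr, h.sum_over_range (by simp)]
    simp [R, eval_finsetSum]
  have hsub : (LinearMap.ker (aeval (Fr K L) h) : Set L) ⊆ (R.roots.toFinset : Set L) := by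
    intro x hx
    rw [Finset.mem_coe, Multiset.mem_toFinset, mem_roots hR0, IsRoot, hRe]
    exact hx
  calc Nat.card (LinearMap.ker (aeval (Fr K L) h)) = (LinearMap.ker (aeval (Fr K L) h) : Set L).ncard := rfl
    _ ≤ (R.roots.toFinset : Set L).ncard := Set.ncard_le_ncard hsub (Finset.finite_toSet _)
    _ ≤ R.roots.card := by rw [Set.ncard_coe_finset]; exact Multiset.toFinset_card_le _
    _ ≤ _ := (card_roots' _).trans hRd

theorem normal_of_forall {n : ℕ} (hn0 : 0 < n) (hn : Fintype.card L = Fintype.card K ^ n) (x : L)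
    (hx : ∀ g h : K[X], g.Monic → Irreducible g → X ^ n - 1 = g * h → aeval (Fr K L) h x ≠ 0) :
    LinearIndependent K (fun i : Fin n => x ^ Fintype.card K ^ (i : ℕ)) ∧
    Submodule.span K (Set.range fun i : Fin n => x ^ Fintype.card K ^ (i : ℕ)) = ⊤ := by
  classical
  have hmon : (X ^ n - 1 : K[X]).Monic := monic_X_pow_sub_C 1 hn0.ne'
  have hdeg : (X ^ n - 1 : K[X]).natDegree = n := natDegree_X_pow_sub_C (r := (1:K))
  have hli : LinearIndependent K (fun i : Fin n => x ^ Fintype.card K ^ (i : ℕ)) := by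
    rw [Fintype.linearIndependent_iff]
    intro c hc
    by_contra hcon
    push Not at hcon
    obtain ⟨i0, hi0⟩ := hcon
    let P : K[X] := ∑ i : Fin n, monomial (i : ℕ) (c i)
    have hPc : ∀ i : Fin n, P.coeff i = c i := by
      intro i
      simp only [P, finsetSum_coeff, coeff_monomial]
      rw [Finset.sum_eq_single i]
      · simp
      · intro j _ hj
        rw [if_neg]
        exact fun h => hj (Fin.ext h)
      · simp
    have hP0 : P ≠ 0 := by
      intro h
      apply hi0
      rw [← hPc, h, coeff_zero]
    have hPd : P.degree < n := by
      refine (degree_sum_le _ _).trans_lt ?_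
      refine (Finset.sup_lt_iff (WithBot.bot_lt_coe n)).2 ?_
      intro i _
      exact (degree_monomial_le _ _).trans_lt (WithBot.coe_lt_coe.2 i.2)
    have hPx : aeval (Fr K L) P x = 0 := by
      simp only [P, map_sum, LinearMap.coe_sum, Finset.sum_apply, aeval_monomial, Module.End.mul_apply,
        Fr_pow, Module.algebraMap_end_apply]
      exact hc
    set d := EuclideanDomain.gcd P (X ^ n - 1) with hd
    have hdx : aeval (Fr K L) d x = 0 := by
      rw [hd, EuclideanDomain.gcd_eq_gcd_ab, mul_comm P, map_add, map_mul, map_mul, aeval_Fr_zero hn, zero_mul, add_zero,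
        Module.End.mul_apply, hPx, map_zero]
    obtain ⟨e, he⟩ : d ∣ X ^ n - 1 := EuclideanDomain.gcd_dvd_right _ _
    have hdd : d.degree < n := (degree_le_of_dvd (EuclideanDomain.gcd_dvd_left _ _) hP0).trans_lt hPd
    have hene : ¬ IsUnit e := by
      intro hu
      have h1 := congrArg degree he
      rw [degree_mul, degree_eq_zero_of_isUnit hu, add_zero, degree_eq_natDegree hmon.ne_zero, hdeg] at h1
      exact absurd h1 hdd.ne'
    obtain ⟨g, hgm, hgi, hge⟩ := Polynomial.exists_monic_irreducible_factor e hene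
    obtain ⟨e', he'⟩ := hge
    refine hx g (d * e') hgm hgi (by rw [he, he']; ring) ?_
    rw [mul_comm, map_mul, Module.End.mul_apply, hdx, map_zero]
  refine ⟨hli, hli.span_eq_top_of_card_eq_finrank' ?_⟩
  rw [Fintype.card_fin]
  have := Module.card_eq_pow_finrank (K := K) (V := L)
  rw [hn] at this
  exact Nat.pow_right_injective (Fintype.one_lt_card (α := K)) this

end

theorem primitive_of_forall {L : Type} [Field L] [Fintype L] (x : L) (hx0 : x ≠ 0)
    (hx : ∀ p ∈ (Fintype.card L - 1).primeFactors, ¬ ∃ y : L, y ^ p = x) : orderOf x = Fintype.card L - 1 := by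
  classical
  have hQ : 0 < Fintype.card L - 1 := by have := Fintype.one_lt_card (α := L); omega
  refine orderOf_eq_of_pow_and_pow_div_prime hQ (FiniteField.pow_card_sub_one_eq_one x hx0) ?_
  intro p hp hpd h1
  apply hx p (Nat.mem_primeFactors.2 ⟨hp, hpd, hQ.ne'⟩)
  obtain ⟨γ, hγ⟩ := IsCyclic.exists_generator (α := Lˣ)
  obtain ⟨j, hj⟩ := (mem_powers_iff_mem_zpowers).2 (hγ (Units.mk0 x hx0))
  beta_reduce at hj
  have hord : orderOf γ = Fintype.card L - 1 := by
    rw [orderOf_eq_card_of_forall_mem_zpowers hγ, Nat.card_eq_fintype_card, Fintype.card_units]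
  have h2 : γ ^ (j * ((Fintype.card L - 1) / p)) = 1 := by
    rw [pow_mul, hj]
    ext
    simpa using h1
  have h3 := orderOf_dvd_of_pow_eq_one h2
  rw [hord] at h3
  obtain ⟨r, hr⟩ := hpd
  have hrp : (Fintype.card L - 1) / p = r := by rw [hr, Nat.mul_div_cancel_left _ hp.pos]
  rw [hrp, hr] at h3
  have hr0 : 0 < r := by
    rcases Nat.eq_zero_or_pos r with h | h
    · rw [h] at hr; omega
    · exact h
  obtain ⟨t, ht⟩ := Nat.dvd_of_mul_dvd_mul_right hr0 h3
  refine ⟨(γ ^ t : Lˣ), ?_⟩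
  have := congrArg (fun u : Lˣ => (u : L)) hj
  simp only [Units.val_mk0] at this
  rw [← this, ht]
  push_cast
  rw [← pow_mul, mul_comm]
end PartC3

section PartC4
open Polynomial

abbrev Gam (L : Type) [Field L] : Type := MulChar L ℂ × MulChar L ℂ × AddChar L ℂ
abbrev PSt (L : Type) [Fintype L] : Type := {p : ℕ // p ∈ (Fintype.card L - 1).primeFactors}
abbrev FSt (K : Type) [Field K] (n : ℕ) : Type :=
  {g : K[X] // g.Monic ∧ Irreducible g ∧ g ∣ X ^ n - 1}

/-- Additive characters trivial on a set. -/
noncomputable def annSet {L : Type} [Field L] (V : Set L) : Subgroup (AddChar L ℂ) where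
  carrier := {ψ | ∀ y ∈ V, ψ y = 1}
  mul_mem' := by
    intro a b ha hb y hy
    rw [AddChar.mul_apply, ha y hy, hb y hy, one_mul]
  one_mem' := by intro y _; rfl
  inv_mem' := by
    intro a ha y hy
    have h : (a * a⁻¹) y = 1 := by rw [mul_inv_cancel]; rfl
    rw [AddChar.mul_apply, ha y hy, one_mul] at h
    exact h

theorem mem_annSet {L : Type} [Field L] {V : Set L} {ψ : AddChar L ℂ} :
    ψ ∈ annSet V ↔ ∀ y ∈ V, ψ y = 1 := Iff.rfl

section
variable (K L : Type) [Field K] [Fintype K] [Field L] [Fintype L] [Algebra K L] (n : ℕ)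

/-- the union of kernels of cofactors. -/
def kerCof (g : K[X]) : Set L := {y | ∃ h : K[X], X ^ n - 1 = g * h ∧ aeval (Fr K L) h y = 0}

noncomputable def HH : PSt L ⊕ PSt L ⊕ FSt K n → Subgroup (Gam L)
  | Sum.inl p => (powMonoidHom p.1 : MulChar L ℂ →* MulChar L ℂ).ker.prod ⊥
  | Sum.inr (Sum.inl p) =>
      (⊥ : Subgroup (MulChar L ℂ)).prod ((powMonoidHom p.1 : MulChar L ℂ →* MulChar L ℂ).ker.prod ⊥)
  | Sum.inr (Sum.inr g) =>
      (⊥ : Subgroup (MulChar L ℂ)).prod ((⊥ : Subgroup (MulChar L ℂ)).prod (annSet (kerCof K L n g.1)))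

variable {K L n}

theorem mulChar_coprime {χ : MulChar L ℂ} {a b : ℕ} (hab : Nat.Coprime a b) (h1 : χ ^ a = 1) (h2 : χ ^ b = 1) :
    χ = 1 := by
  have := Nat.dvd_gcd (orderOf_dvd_of_pow_eq_one h1) (orderOf_dvd_of_pow_eq_one h2)
  rw [hab] at this
  exact orderOf_eq_one_iff.1 (Nat.dvd_one.1 this)

theorem exists_cofactor (p : PSt L) : ∃ m : ℕ, Nat.Coprime p.1 m ∧ ∀ p' : PSt L, p' ≠ p → p'.1 ∣ m := by
  obtain ⟨hp, hpd, h0⟩ := Nat.mem_primeFactors.1 p.2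
  obtain ⟨e, m, hm, he⟩ := Nat.exists_eq_pow_mul_and_not_dvd h0 p.1 hp.ne_one
  refine ⟨m, (hp.coprime_iff_not_dvd).2 hm, fun p' hp' => ?_⟩
  obtain ⟨hq, hqd, _⟩ := Nat.mem_primeFactors.1 p'.2
  have hqd := hqd.trans (dvd_of_eq he)
  refine Nat.Coprime.dvd_of_dvd_mul_left ?_ hqd
  exact Nat.Coprime.pow_right _ ((Nat.coprime_primes hq hp).2 fun h => hp' (Subtype.ext h))

theorem exists_cofactor_poly (hn0 : 0 < n) (g : FSt K n) :
    ∃ m : K[X], IsCoprime g.1 m ∧ ∀ g' : FSt K n, g' ≠ g → g'.1 ∣ m := by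
  have h0 : (X ^ n - 1 : K[X]) ≠ 0 := (monic_X_pow_sub_C 1 hn0.ne').ne_zero
  obtain ⟨hm1, hi, hd⟩ := g.2
  obtain ⟨e, m, hm, he⟩ := WfDvdMonoid.max_power_factor h0 hi
  refine ⟨m, (hi.coprime_iff_not_dvd).2 hm, fun g' hg' => ?_⟩
  obtain ⟨hm1', hi', hd'⟩ := g'.2
  have hd' := hd'.trans (dvd_of_eq he)
  refine IsCoprime.dvd_of_dvd_mul_left ?_ hd'
  refine IsCoprime.pow_right ((hi'.coprime_iff_not_dvd).2 fun h => hg' (Subtype.ext ?_))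
  exact eq_of_monic_of_associated hm1' hm1 (hi'.associated_of_dvd hi h)

theorem HH_indep (hn0 : 0 < n) (hn : Fintype.card L = Fintype.card K ^ n) : iSupIndep (HH K L n) := by
  intro i
  rw [Subgroup.disjoint_def]
  rintro ⟨χ₁, χ₂, ψ⟩ hx hy
  rcases i with p | p | g
  · obtain ⟨m, hm, hm'⟩ := exists_cofactor p
    have hle : (⨆ j, ⨆ (_ : j ≠ Sum.inl p), HH K L n j) ≤
        (powMonoidHom m : MulChar L ℂ →* MulChar L ℂ).ker.prod ⊤ := by
      refine iSup₂_le fun j hj => ?_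
      rintro ⟨a, b, c⟩ h
      rcases j with p' | p' | g <;> simp only [HH, Subgroup.mem_prod, MonoidHom.mem_ker, powMonoidHom_apply, Subgroup.mem_bot, Subgroup.mem_top, and_true] at h ⊢
      · obtain ⟨t, rfl⟩ := hm' p' (fun h => hj (by rw [h]))
        rw [pow_mul, h.1, one_pow]
      · rw [h.1, one_pow]
      · rw [h.1, one_pow]
    have h2 := hle hy
    simp only [HH, Subgroup.mem_prod, MonoidHom.mem_ker, powMonoidHom_apply, Subgroup.mem_bot, Subgroup.mem_top, and_true] at hx h2
    obtain ⟨hx1, hx2⟩ := hx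
    rw [mulChar_coprime hm hx1 h2, hx2]
    rfl
  · obtain ⟨m, hm, hm'⟩ := exists_cofactor p
    have hle : (⨆ j, ⨆ (_ : j ≠ Sum.inr (Sum.inl p)), HH K L n j) ≤
        (⊤ : Subgroup (MulChar L ℂ)).prod ((powMonoidHom m : MulChar L ℂ →* MulChar L ℂ).ker.prod ⊤) := by
      refine iSup₂_le fun j hj => ?_
      rintro ⟨a, b, c⟩ h
      rcases j with p' | p' | g <;> simp only [HH, Subgroup.mem_prod, MonoidHom.mem_ker, powMonoidHom_apply, Subgroup.mem_bot, Subgroup.mem_top, and_true, true_and, Prod.mk_eq_one] at h ⊢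
      · rw [h.2.1, one_pow]
      · obtain ⟨t, rfl⟩ := hm' p' (fun h => hj (by rw [h]))
        rw [pow_mul, h.2.1, one_pow]
      · rw [h.2.1, one_pow]
    have h2 := hle hy
    simp only [HH, Subgroup.mem_prod, MonoidHom.mem_ker, powMonoidHom_apply, Subgroup.mem_bot, Subgroup.mem_top, and_true, true_and] at hx h2
    obtain ⟨hx1, hx2, hx3⟩ := hx
    rw [mulChar_coprime hm hx2 h2, hx1, hx3]
    rfl
  · obtain ⟨m, hm, hm'⟩ := exists_cofactor_poly hn0 g
    have himg : ∀ (g : FSt K n) (ψ : AddChar L ℂ), ψ ∈ annSet (kerCof K L n g.1) → ∀ y, ψ (aeval (Fr K L) g.1 y) = 1 := by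
      intro g ψ hψ y
      obtain ⟨h, hh⟩ := g.2.2.2
      refine hψ _ ⟨h, hh, ?_⟩
      rw [← Module.End.mul_apply, ← map_mul, mul_comm, ← hh, aeval_Fr_zero hn]
      rfl
    have hle : (⨆ j, ⨆ (_ : j ≠ Sum.inr (Sum.inr g)), HH K L n j) ≤
        (⊤ : Subgroup (MulChar L ℂ)).prod ((⊤ : Subgroup (MulChar L ℂ)).prod (annSet (Set.range (aeval (Fr K L) m)))) := by
      refine iSup₂_le fun j hj => ?_
      rintro ⟨a, b, c⟩ h
      rcases j with p' | p' | g' <;> simp only [HH, Subgroup.mem_prod, MonoidHom.mem_ker, powMonoidHom_apply, Subgroup.mem_bot, Subgroup.mem_top, and_true, true_and, Prod.mk_eq_one] at h ⊢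
      · rw [h.2.2]; exact one_mem _
      · rw [h.2.2]; exact one_mem _
      · obtain ⟨t, rfl⟩ := hm' g' (fun h => hj (by rw [h]))
        rintro _ ⟨y, rfl⟩
        rw [map_mul, Module.End.mul_apply]
        exact himg g' c h.2.2 _
    have h2 := hle hy
    simp only [HH, Subgroup.mem_prod, Subgroup.mem_bot, Subgroup.mem_top, true_and] at hx h2
    obtain ⟨hx1, hx2, hx3⟩ := hx
    have hψ : ψ = 1 := by
      obtain ⟨a, b, hab⟩ := hm
      ext y
      have hy : y = aeval (Fr K L) g.1 (aeval (Fr K L) a y) + aeval (Fr K L) m (aeval (Fr K L) b y) := by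
        rw [← Module.End.mul_apply, ← Module.End.mul_apply, ← map_mul, ← map_mul, ← LinearMap.add_apply, ← map_add,
          mul_comm g.1, mul_comm m, hab, map_one]
        rfl
      rw [hy, AddChar.map_add_eq_mul, himg g ψ hx3, h2 _ ⟨_, rfl⟩, one_mul]
      rfl
    rw [hψ, hx1, hx2]
    rfl

theorem pow_ker_card (p : PSt L) : p.1 ≤ Nat.card (powMonoidHom p.1 : MulChar L ℂ →* MulChar L ℂ).ker := by
  obtain ⟨hp, hpd, h0⟩ := Nat.mem_primeFactors.1 p.2
  obtain ⟨χ, hχ, _⟩ := exists_gen_char L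
  obtain ⟨r, hr⟩ := hpd
  have hr0 : r ≠ 0 := by rintro rfl; exact h0 (by rw [hr, mul_zero])
  have ho : orderOf (χ ^ r) = p.1 := by
    have hr' := hχ.trans hr
    rw [orderOf_pow' _ hr0, hr', Nat.gcd_eq_right (Dvd.intro_left _ rfl), Nat.mul_div_cancel _ (Nat.pos_of_ne_zero hr0)]
  calc p.1 = Nat.card (Subgroup.zpowers (χ ^ r)) := by rw [Nat.card_zpowers, ho]
    _ ≤ _ := by
      refine Subgroup.card_le_of_le ?_
      rw [Subgroup.zpowers_le, MonoidHom.mem_ker, powMonoidHom_apply]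
      rw [← ho, pow_orderOf_eq_one]

theorem ann_card (hn0 : 0 < n) (hn : Fintype.card L = Fintype.card K ^ n) (g : FSt K n) :
    Fintype.card K ^ g.1.natDegree ≤ Nat.card (annSet (kerCof K L n g.1)) := by
  classical
  obtain ⟨hgm, hgi, h, hh⟩ := g.2
  have hmon : (X ^ n - 1 : K[X]).Monic := monic_X_pow_sub_C 1 hn0.ne'
  have hdeg : (X ^ n - 1 : K[X]).natDegree = n := natDegree_X_pow_sub_C (r := (1:K))
  have hh0 : h ≠ 0 := by rintro rfl; exact hmon.ne_zero (by rw [hh, mul_zero])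
  let V : AddSubgroup L := (LinearMap.ker (aeval (Fr K L) h)).toAddSubgroup
  have hV : Nat.card V ≤ Fintype.card K ^ h.natDegree := card_ker_le hh0
  have h1 := AddSubgroup.card_eq_card_quotient_mul_card_addSubgroup V
  rw [Nat.card_eq_fintype_card, hn] at h1
  have hd : n = g.1.natDegree + h.natDegree := by
    rw [← natDegree_mul hgi.ne_zero hh0, ← hh, hdeg]
  have h2 : Fintype.card K ^ g.1.natDegree ≤ Nat.card (L ⧸ V) := by
    have h3 : Fintype.card K ^ g.1.natDegree * Fintype.card K ^ h.natDegree ≤ Nat.card (L ⧸ V) * Fintype.card K ^ h.natDegree := by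
      rw [← pow_add, ← hd, h1]
      exact Nat.mul_le_mul_left _ hV
    exact Nat.le_of_mul_le_mul_right h3 (pow_pos Fintype.card_pos _)
  refine h2.trans ?_
  haveI : Fintype (L ⧸ V) := Fintype.ofFinite _
  rw [Nat.card_eq_fintype_card, ← AddChar.card_eq, ← Nat.card_eq_fintype_card]
  let φ : AddChar (L ⧸ V) ℂ → annSet (kerCof K L n g.1) := fun ψ =>
    ⟨ψ.compAddMonoidHom (QuotientAddGroup.mk' V), by
      rintro y ⟨h', hh', hy⟩
      have : h' = h := mul_left_cancel₀ hgi.ne_zero (hh'.symm.trans hh)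
      subst this
      rw [AddChar.compAddMonoidHom_apply]
      have : QuotientAddGroup.mk' V y = 0 := (QuotientAddGroup.eq_zero_iff y).2 hy
      rw [this, AddChar.map_zero_eq_one]⟩
  refine Nat.card_le_card_of_injective φ ?_
  intro ψ ψ' he
  ext z
  obtain ⟨y, rfl⟩ := QuotientAddGroup.mk_surjective z
  exact DFunLike.congr_fun (congrArg Subtype.val he) y

theorem HH_card_inl (p : PSt L) : p.1 ≤ Nat.card (HH K L n (Sum.inl p)) := by
  refine (pow_ker_card p).trans ?_
  refine Nat.card_le_card_of_injective (fun χ => ⟨(χ.1, 1), ⟨χ.2, rfl⟩⟩) ?_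
  intro a b h
  have h1 := congrArg (fun z => z.1.1) h
  exact Subtype.ext h1

theorem HH_card_inr_inl (p : PSt L) : p.1 ≤ Nat.card (HH K L n (Sum.inr (Sum.inl p))) := by
  refine (pow_ker_card p).trans ?_
  refine Nat.card_le_card_of_injective (fun χ => ⟨(1, χ.1, 1), ⟨rfl, χ.2, rfl⟩⟩) ?_
  intro a b h
  have h1 := congrArg (fun z => z.1.2.1) h
  exact Subtype.ext h1

theorem HH_card_inr_inr (hn0 : 0 < n) (hn : Fintype.card L = Fintype.card K ^ n) (g : FSt K n) :
    Fintype.card K ^ g.1.natDegree ≤ Nat.card (HH K L n (Sum.inr (Sum.inr g))) := by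
  refine (ann_card hn0 hn g).trans ?_
  refine Nat.card_le_card_of_injective (fun χ => ⟨(1, 1, χ.1), ⟨rfl, rfl, χ.2⟩⟩) ?_
  intro a b h
  have h1 := congrArg (fun z => z.1.2.2) h
  exact Subtype.ext h1
end
end PartC4

section PartC5
open Polynomial

theorem ratEval_eq {L : Type} [Field L] {f1 f2 : L[X]} (x : L) (hx : f2.eval x ≠ 0) :
    ratEval (algebraMap L[X] (RatFunc L) f1 / algebraMap L[X] (RatFunc L) f2) x = f1.eval x / f2.eval x := by
  have hf2 : f2 ≠ 0 := by rintro rfl; simp at hx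
  have hf2' : algebraMap L[X] (RatFunc L) f2 ≠ 0 := by
    simpa using hf2
  unfold ratEval
  have h1 : (algebraMap L[X] (RatFunc L) f1 / algebraMap L[X] (RatFunc L) f2) * algebraMap L[X] (RatFunc L) f2
      = algebraMap L[X] (RatFunc L) f1 := div_mul_cancel₀ _ hf2'
  have h2 := RatFunc.eval_mul (RingHom.id L) x (x := algebraMap L[X] (RatFunc L) f1 / algebraMap L[X] (RatFunc L) f2)
    (y := algebraMap L[X] (RatFunc L) f2) ?_ ?_
  · rw [h1, RatFunc.eval_algebraMap, RatFunc.eval_algebraMap] at h2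
    simp only [Algebra.algebraMap_self, RingHom.id_apply, eval₂_id] at h2
    rw [eq_div_iff hx, ← h2]
  · obtain ⟨t, ht⟩ := RatFunc.denom_div_dvd f1 f2
    rw [eval₂_id]
    intro h0
    apply hx
    rw [ht, eval_mul, h0, zero_mul]
  · rw [RatFunc.denom_algebraMap]
    simp

theorem sieve_concrete {K L : Type} [Field K] [Field L] [Fintype K] [Fintype L] [Algebra K L] {n : ℕ}
    (hn0 : 0 < n) (hn : Fintype.card L = Fintype.card K ^ n) (hQ : 2 < Fintype.card L)
    {f : RatFunc L} (hf : f ∈ Upsilon L 3 2) (C S : Finset ℕ) (hCS : Disjoint C S)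
    (hCS' : C ∪ S = (Fintype.card L - 1).primeFactors) (A B : Finset K[X]) (hAB : Disjoint A B)
    (hAB' : ∀ g, (g ∈ A ∨ g ∈ B) ↔ (g.Monic ∧ Irreducible g ∧ g ∣ X ^ n - 1))
    (hpos : 0 ≤ 1 - (2 * ∑ p ∈ S, (1 / p : ℝ) + ∑ g ∈ B, (1 / (Fintype.card K : ℝ) ^ g.natDegree)))
    (hmain : 6 * √(Fintype.card L) * (4 ^ C.card * 2 ^ A.card) * (1 + 2 * S.card + B.card) <
      (1 - (2 * ∑ p ∈ S, (1 / p : ℝ) + ∑ g ∈ B, (1 / (Fintype.card K : ℝ) ^ g.natDegree))) * (Fintype.card L - 6)) :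
    ∃ α : L, IsPrimitiveElem α ∧ IsNormalElem K n α ∧ IsPrimitiveElem (ratEval f α) := by
  classical
  obtain ⟨f1, f2, hf2, rfl, hd1, hd2, hcop, k, g, hk0, hgm, hgi, hgX, hk, hgd, hgnd⟩ := hf
  have hf1 : f1 ≠ 0 := by rintro rfl; simp at hgnd
  haveI : Fintype (Gam L) := Fintype.ofFinite _
  let ev : Gam L → L → ℂ := fun γ x => γ.1 x * γ.2.1 (f1.eval x / f2.eval x) * γ.2.2 x
  let dom : L → ℝ := fun x => if x ≠ 0 ∧ f1.eval x / f2.eval x ≠ 0 then 1 else 0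
  have hdomsum : (Fintype.card L : ℝ) - 6 ≤ ∑ x, dom x := by
    have h1 : ∀ x, 1 - (if x ∈ ((X * f1 * f2 : L[X]).roots.toFinset) then 1 else 0 : ℝ) ≤ dom x := by
      intro x
      have h0 : (X * f1 * f2 : L[X]) ≠ 0 := mul_ne_zero (mul_ne_zero X_ne_zero hf1) hf2
      simp only [dom]
      by_cases hx : x ∈ (X * f1 * f2 : L[X]).roots.toFinset
      · rw [if_pos hx]; split_ifs <;> norm_num
      · rw [if_neg hx]
        rw [Multiset.mem_toFinset, mem_roots h0, IsRoot, eval_mul, eval_mul, eval_X] at hx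
        rw [if_pos]
        · norm_num
        · have h3 := right_ne_zero_of_mul hx
          have h4 := left_ne_zero_of_mul hx
          exact ⟨left_ne_zero_of_mul h4, div_ne_zero (right_ne_zero_of_mul h4) h3⟩
    refine le_trans ?_ (Finset.sum_le_sum fun x _ => h1 x)
    rw [Finset.sum_sub_distrib, Finset.sum_boole]
    simp only [Finset.sum_const, Finset.card_univ, nsmul_eq_mul, mul_one]
    have h2 : ((X * f1 * f2 : L[X]).roots.toFinset).card ≤ 6 := by
      refine (Multiset.toFinset_card_le _).trans ((card_roots' _).trans ?_)
      refine natDegree_mul_le.trans ?_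
      have : (X * f1 : L[X]).natDegree ≤ 1 + f1.natDegree := natDegree_mul_le.trans (by rw [natDegree_X])
      omega
    have h3 : ((Finset.univ.filter fun x => x ∈ (X * f1 * f2 : L[X]).roots.toFinset).card : ℝ) ≤ 6 := by
      rw [Finset.filter_mem_eq_inter, Finset.univ_inter]
      exact_mod_cast h2
    linarith
  let pP : ℕ → Prop := fun p => p ∈ (Fintype.card L - 1).primeFactors
  let pF : K[X] → Prop := fun g => g.Monic ∧ Irreducible g ∧ g ∣ X ^ n - 1
  have hCP : ∀ x ∈ C, pP x := fun x hx => by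
    change x ∈ _; rw [← hCS']; exact Finset.mem_union_left _ hx
  have hSP : ∀ x ∈ S, pP x := fun x hx => by
    change x ∈ _; rw [← hCS']; exact Finset.mem_union_right _ hx
  have hAF : ∀ x ∈ A, pF x := fun x hx => (hAB' x).1 (Or.inl hx)
  have hBF : ∀ x ∈ B, pF x := fun x hx => (hAB' x).1 (Or.inr hx)
  let C' : Finset (PSt L ⊕ PSt L ⊕ FSt K n) := (C.subtype pP).disjSum ((C.subtype pP).disjSum (A.subtype pF))
  let S' : Finset (PSt L ⊕ PSt L ⊕ FSt K n) := (S.subtype pP).disjSum ((S.subtype pP).disjSum (B.subtype pF))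
  have hC'c : C'.card = 2 * C.card + A.card := by
    simp only [C', Finset.card_disjSum, Finset.card_subtype]
    rw [Finset.filter_true_of_mem hCP, Finset.filter_true_of_mem hAF]; ring
  have hS'c : S'.card = 2 * S.card + B.card := by
    simp only [S', Finset.card_disjSum, Finset.card_subtype]
    rw [Finset.filter_true_of_mem hSP, Finset.filter_true_of_mem hBF]; ring
  have hq0 : (0:ℝ) < Fintype.card K := by exact_mod_cast Fintype.card_pos
  have hsum : ∑ i ∈ S', (1 / Nat.card (HH K L n i) : ℝ) ≤
      2 * ∑ p ∈ S, (1 / p : ℝ) + ∑ g ∈ B, (1 / (Fintype.card K : ℝ) ^ g.natDegree) := by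
    refine (le_of_eq ((Finset.sum_disjSum _ _ _).trans (congrArg _ (Finset.sum_disjSum _ _ _)))).trans ?_
    rw [← Finset.sum_subtype_of_mem (fun p : ℕ => (1 / p : ℝ)) hSP,
      ← Finset.sum_subtype_of_mem (fun g : K[X] => (1 / (Fintype.card K : ℝ) ^ g.natDegree)) hBF, two_mul, add_assoc]
    apply add_le_add
    · apply Finset.sum_le_sum
      intro p _
      have hp0 : (0:ℝ) < p.1 := by exact_mod_cast (Nat.prime_of_mem_primeFactors p.2).pos
      exact one_div_le_one_div_of_le hp0 (by exact_mod_cast HH_card_inl p)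
    apply add_le_add
    · apply Finset.sum_le_sum
      intro p _
      have hp0 : (0:ℝ) < p.1 := by exact_mod_cast (Nat.prime_of_mem_primeFactors p.2).pos
      exact one_div_le_one_div_of_le hp0 (by exact_mod_cast HH_card_inr_inl p)
    · apply Finset.sum_le_sum
      intro g _
      exact one_div_le_one_div_of_le (pow_pos hq0 _) (by exact_mod_cast HH_card_inr_inr hn0 hn g)
  obtain ⟨x, hx1, hx2⟩ := abstract_sieve (ev := ev) (HH K L n) (HH_indep hn0 hn) dom (by
      intro x
      change (1 : MulChar L ℂ) x * (1 : MulChar L ℂ) (f1.eval x / f2.eval x) * 1 = _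
      simp only [dom]
      split_ifs with h
      · rw [MulChar.one_apply (Ne.isUnit h.1), MulChar.one_apply (Ne.isUnit h.2)]; simp
      · by_cases h0 : x = 0
        · rw [h0, MulChar.map_zero]; simp
        · have : f1.eval x / f2.eval x = 0 := by
            by_contra h1; exact h ⟨h0, h1⟩
          rw [this, MulChar.map_zero]; simp) (by
      intro x; simp only [dom]; split_ifs <;> simp) (by
      intro γ δ x
      simp only [ev, Prod.fst_mul, Prod.snd_mul, MulChar.mul_apply, AddChar.mul_apply]
      ring) (B := 6 * √(Fintype.card L)) (by positivity) (by
      intro γ hγ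
      exact mixed_bound hQ hd1 hd2 hcop hf1 hf2 hk0 hgm hgi hgX hk hgd hgnd γ.1 γ.2.1 γ.2.2 (fun h =>
        hγ (Prod.ext h.1 (Prod.ext h.2.1 h.2.2)))) C' S' (by
      rw [Finset.disjoint_left]
      rintro (p | p | g) h1 h2 <;> simp only [C', S', Finset.inl_mem_disjSum, Finset.inr_mem_disjSum, Finset.mem_subtype] at h1 h2
      · exact Finset.disjoint_left.1 hCS h1 h2
      · exact Finset.disjoint_left.1 hCS h1 h2
      · exact Finset.disjoint_left.1 hAB h1 h2) (by
      rintro (p | p | g) h1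
      · exact (Nat.prime_of_mem_primeFactors p.2).two_le.trans (HH_card_inl p)
      · exact (Nat.prime_of_mem_primeFactors p.2).two_le.trans (HH_card_inr_inl p)
      · refine le_trans ?_ (HH_card_inr_inr hn0 hn g)
        have h2 : 2 ≤ Fintype.card K := Fintype.one_lt_card
        exact h2.trans (Nat.le_self_pow (g.2.2.1.natDegree_pos).ne' _)) (by linarith) (by
      have h6 : (0:ℝ) ≤ 1 - ∑ i ∈ S', (1 / Nat.card (HH K L n i) : ℝ) := by linarith
      rw [hC'c, hS'c]
      have e1 : (6 * √(Fintype.card L) * 2 ^ (2 * C.card + A.card) * (1 + ((2 * S.card + B.card : ℕ) : ℝ)) : ℝ)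
        = 6 * √(Fintype.card L) * (4 ^ C.card * 2 ^ A.card) * (1 + 2 * S.card + B.card) := by
        rw [pow_add, pow_mul]; push_cast; norm_num; ring
      rw [e1]
      have hLHS : (0:ℝ) ≤ 6 * √(Fintype.card L) * (4 ^ C.card * 2 ^ A.card) * (1 + 2 * S.card + B.card) := by positivity
      have hQ6 : (0:ℝ) ≤ (Fintype.card L : ℝ) - 6 := by
        by_contra hneg
        push Not at hneg
        have := mul_nonpos_of_nonneg_of_nonpos hpos hneg.le
        linarith
      calc _ < _ := hmain
        _ ≤ (1 - ∑ i ∈ S', (1 / Nat.card (HH K L n i) : ℝ)) * ((Fintype.card L : ℝ) - 6) :=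
          mul_le_mul_of_nonneg_right (by linarith) hQ6
        _ ≤ _ := mul_le_mul_of_nonneg_left hdomsum h6)
  have hx0 : x ≠ 0 ∧ f1.eval x / f2.eval x ≠ 0 := by
    by_contra h
    simp only [dom, if_neg h] at hx1
    norm_num at hx1
  obtain ⟨hxne, hfx⟩ := hx0
  have hf2x : f2.eval x ≠ 0 := by
    intro h; rw [h, div_zero] at hfx; exact hfx rfl
  have hpow : ∀ (χ : MulChar L ℂ) (p : ℕ) (y z : L), z ≠ 0 → y ^ p = z → p ≠ 0 → χ ^ p = 1 → χ z = 1 := by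
    intro χ p y z hz hy hp h1
    have hy0 : y ≠ 0 := by rintro rfl; rw [zero_pow hp] at hy; exact hz hy.symm
    rw [← hy, map_pow, ← MulChar.pow_apply' χ hp, h1, MulChar.one_apply (Ne.isUnit hy0)]
  have hmemP : ∀ p ∈ (Fintype.card L - 1).primeFactors, p ∈ C ∨ p ∈ S := by
    intro p hp; rw [← hCS'] at hp; exact Finset.mem_union.1 hp
  refine ⟨x, ?_, ?_, ?_⟩
  · refine primitive_of_forall x hxne ?_
    rintro p hp ⟨y, hy⟩
    refine hx2 (Sum.inl ⟨p, hp⟩) ?_ ?_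
    · simpa only [C', S', Finset.inl_mem_disjSum, Finset.mem_subtype] using hmemP p hp
    · rintro ⟨χ₁, χ₂, ψ⟩ ⟨h1, h2⟩
      have h2 : (χ₂, ψ) = 1 := h2
      obtain ⟨rfl, rfl⟩ := Prod.mk_eq_one.1 h2
      change χ₁ x * (1 : MulChar L ℂ) (f1.eval x / f2.eval x) * 1 = 1
      rw [hpow χ₁ p y x hxne hy (Nat.prime_of_mem_primeFactors hp).ne_zero h1, MulChar.one_apply (Ne.isUnit hfx)]
      simp
  · refine normal_of_forall hn0 hn x ?_
    intro g h hgm hgi hgh hgx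
    have hpF : pF g := ⟨hgm, hgi, ⟨h, hgh⟩⟩
    refine hx2 (Sum.inr (Sum.inr ⟨g, hpF⟩)) ?_ ?_
    · simpa only [C', S', Finset.inr_mem_disjSum, Finset.mem_subtype] using (hAB' g).2 hpF
    · rintro ⟨χ₁, χ₂, ψ⟩ ⟨h1, h2, h3⟩
      have h1 : χ₁ = 1 := h1
      have h2 : χ₂ = 1 := h2
      subst h1 h2
      change (1 : MulChar L ℂ) x * (1 : MulChar L ℂ) (f1.eval x / f2.eval x) * ψ x = 1
      rw [MulChar.one_apply (Ne.isUnit hxne), MulChar.one_apply (Ne.isUnit hfx), h3 x ⟨h, hgh, hgx⟩]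
      simp
  · rw [ratEval_eq x hf2x]
    refine primitive_of_forall _ hfx ?_
    rintro p hp ⟨y, hy⟩
    refine hx2 (Sum.inr (Sum.inl ⟨p, hp⟩)) ?_ ?_
    · simpa only [C', S', Finset.inr_mem_disjSum, Finset.inl_mem_disjSum, Finset.mem_subtype] using hmemP p hp
    · rintro ⟨χ₁, χ₂, ψ⟩ ⟨h1, h2, h3⟩
      have h1 : χ₁ = 1 := h1
      have h3 : ψ = 1 := h3
      subst h1 h3
      change (1 : MulChar L ℂ) x * χ₂ (f1.eval x / f2.eval x) * 1 = 1
      rw [hpow χ₂ p y _ hfx hy (Nat.prime_of_mem_primeFactors hp).ne_zero h2, MulChar.one_apply (Ne.isUnit hxne)]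
      simp
end PartC5

section PartD1
/-- The first hundred primes. -/
def PL : List ℕ := [2, 3, 5, 7, 11, 13, 17, 19, 23, 29, 31, 37, 41, 43, 47, 53, 59, 61, 67, 71, 73, 79, 83,
  89, 97, 101, 103, 107, 109, 113, 127, 131, 137, 139, 149, 151, 157, 163, 167, 173, 179,
  181, 191, 193, 197, 199, 211, 223, 227, 229, 233, 239, 241, 251, 257, 263, 269, 271, 277,
  281, 283, 293, 307, 311, 313, 317, 331, 337, 347, 349, 353, 359, 367, 373, 379, 383, 389,
  397, 401, 409, 419, 421, 431, 433, 439, 443, 449, 457, 461, 463, 467, 479, 487, 491, 499,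
  503, 509, 521, 523, 541]

def lpr (i : ℕ) : ℕ := PL.getD i 547

theorem PL_complete : ∀ m < 547, m ∈ PL ∨ m < 2 ∨ ∃ d ∈ [2, 3, 5, 7, 11, 13, 17, 19, 23], d ∣ m ∧ d ≠ m := by
  decide +kernel

theorem prime_mem_PL {m : ℕ} (hm : m.Prime) (h : m < 547) : m ∈ PL := by
  rcases PL_complete m h with h1 | h1 | ⟨d, hd, h2, h3⟩
  · exact h1
  · exact absurd hm.two_le (by omega)
  · rcases (Nat.dvd_prime hm).1 h2 with h4 | h4
    · subst h4; simp at hd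
    · exact absurd h4 h3

theorem PL_filter : ∀ i < 101, (PL.filter (fun m => m < lpr i)).length ≤ i := by
  decide +kernel

theorem lpr_ge : ∀ i < 100, 2 ≤ lpr i ∧ (6 ≤ i → 16 ≤ lpr i) ∧ lpr i ≤ 547 := by
  decide +kernel

theorem lpr_tail {i : ℕ} (h : 100 ≤ i) : lpr i = 547 := by
  unfold lpr
  rw [List.getD_eq_default]
  exact h

theorem lpr_two_le (i : ℕ) : 2 ≤ lpr i := by
  rcases Nat.lt_or_ge i 100 with h | h
  · exact (lpr_ge i h).1
  · rw [lpr_tail h]; norm_num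

theorem lpr_sixteen_le {i : ℕ} (hi : 6 ≤ i) : 16 ≤ lpr i := by
  rcases Nat.lt_or_ge i 100 with h | h
  · exact (lpr_ge i h).2.1 hi
  · rw [lpr_tail h]; norm_num

theorem lpr_max {T : Finset ℕ} (hT : ∀ p ∈ T, p.Prime) {w m : ℕ} (hw : T.card = w + 1) (hm : ∀ p ∈ T, p ≤ m) :
    lpr w ≤ m := by
  classical
  by_contra hlt
  push Not at hlt
  have hle : lpr w ≤ 547 := by
    rcases Nat.lt_or_ge w 100 with h | h
    · exact (lpr_ge w h).2.2
    · rw [lpr_tail h]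
  have key : ∀ j, j < 101 → lpr w ≤ lpr j → T.card ≤ j := by
    intro j hj hwj
    have hsub : T ⊆ (PL.filter (fun m => m < lpr j)).toFinset := by
      intro p hp
      have h1 : p < lpr w := (hm p hp).trans_lt hlt
      rw [List.mem_toFinset, List.mem_filter]
      exact ⟨prime_mem_PL (hT p hp) (h1.trans_le hle), by simpa using h1.trans_le hwj⟩
    exact (Finset.card_le_card hsub).trans ((List.toFinset_card_le _).trans (PL_filter j hj))
  rcases Nat.lt_or_ge w 101 with h | h
  · have := key w h le_rfl
    omega
  · have := key 100 (by norm_num) (by rw [lpr_tail (show 100 ≤ w by omega), lpr_tail le_rfl])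
    omega

def prim : ℕ → ℕ
  | 0 => 1
  | k + 1 => prim k * lpr k

def ubt (i : ℕ) : ℕ := 1000000 / lpr i + 1

def sumUb (c : ℕ) : ℕ → ℕ
  | 0 => 0
  | k + 1 => sumUb c k + ubt (c + k)

theorem inv_le_ubt (i m : ℕ) (h : lpr i ≤ m) : (1 / m : ℝ) ≤ ubt i / 1000000 := by
  have h2 := lpr_two_le i
  have h0 : (0:ℝ) < lpr i := by exact_mod_cast (by omega : 0 < lpr i)
  have h1 : (1 / m : ℝ) ≤ 1 / lpr i := one_div_le_one_div_of_le h0 (by exact_mod_cast h)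
  refine h1.trans ?_
  rw [div_le_div_iff₀ h0 (by norm_num)]
  have h3 : 1000000 ≤ ubt i * lpr i := by
    unfold ubt
    have := Nat.lt_div_mul_add (a := 1000000) (show 0 < lpr i by omega)
    rw [add_mul, one_mul]; omega
  have h4 : (1000000:ℝ) ≤ ubt i * lpr i := by exact_mod_cast h3
  linarith

theorem prim_le {T : Finset ℕ} (hT : ∀ p ∈ T, p.Prime) : prim T.card ≤ ∏ p ∈ T, p := by
  induction hw : T.card generalizing T with
  | zero => rw [Finset.card_eq_zero.1 hw]; simp [prim]
  | succ w ih =>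
    have hne : T.Nonempty := by rw [← Finset.card_pos]; omega
    set m := T.max' hne
    have hm : m ∈ T := Finset.max'_mem _ _
    rw [← Finset.prod_erase_mul _ _ hm]
    exact Nat.mul_le_mul (ih (fun p hp => hT p (Finset.mem_of_mem_erase hp)) (by rw [Finset.card_erase_of_mem hm, hw]; rfl))
      (lpr_max hT hw fun p hp => Finset.le_max' _ _ hp)

theorem prime_split {T : Finset ℕ} (hT : ∀ p ∈ T, p.Prime) (c k : ℕ) (hc : T.card = c + k) :
    ∃ C S : Finset ℕ, Disjoint C S ∧ C ∪ S = T ∧ C.card = c ∧ S.card = k ∧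
      ∑ p ∈ S, (1 / p : ℝ) ≤ sumUb c k / 1000000 := by
  classical
  induction k generalizing T with
  | zero => exact ⟨T, ∅, by simp, by simp, by simpa using hc, rfl, by simp [sumUb]⟩
  | succ k ih =>
    have hne : T.Nonempty := by rw [← Finset.card_pos]; omega
    set m := T.max' hne
    have hm : m ∈ T := Finset.max'_mem _ _
    obtain ⟨C, S, h1, h2, h3, h4, h5⟩ := ih (T := T.erase m) (fun p hp => hT p (Finset.mem_of_mem_erase hp))
      (by rw [Finset.card_erase_of_mem hm, hc]; rfl)
    have hmCS : m ∉ C ∪ S := by rw [h2]; simp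
    rw [Finset.mem_union, not_or] at hmCS
    refine ⟨C, insert m S, ?_, ?_, h3, ?_, ?_⟩
    · rw [Finset.disjoint_insert_right]; exact ⟨hmCS.1, h1⟩
    · rw [Finset.union_insert, h2, Finset.insert_erase hm]
    · rw [Finset.card_insert_of_notMem hmCS.2, h4]
    · rw [Finset.sum_insert hmCS.2]
      have := inv_le_ubt (c + k) m (lpr_max hT (by rw [hc]; rfl) fun p hp => Finset.le_max' _ _ hp)
      simp only [sumUb]
      push_cast
      rw [add_div]
      linarith
end PartD1

section PartD2
open Polynomial

theorem exists_factor_finset (K : Type) [Field K] {n : ℕ} (hn0 : 0 < n) : ∃ F : Finset K[X],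
    (∀ g, g ∈ F ↔ (g.Monic ∧ Irreducible g ∧ g ∣ X ^ n - 1)) ∧ ∑ g ∈ F, g.natDegree ≤ n := by
  classical
  have hmon : (X ^ n - 1 : K[X]).Monic := monic_X_pow_sub_C 1 hn0.ne'
  have hdeg : (X ^ n - 1 : K[X]).natDegree = n := natDegree_X_pow_sub_C (r := (1:K))
  let F : Finset K[X] := (UniqueFactorizationMonoid.normalizedFactors (X ^ n - 1 : K[X])).toFinset
  have hF : ∀ g, g ∈ F ↔ (g.Monic ∧ Irreducible g ∧ g ∣ X ^ n - 1) := by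
    intro g
    rw [Multiset.mem_toFinset, UniqueFactorizationMonoid.mem_normalizedFactors_iff' hmon.ne_zero]
    constructor
    · rintro ⟨h1, h2, h3⟩
      refine ⟨?_, h1, h3⟩
      have := Polynomial.monic_normalize h1.ne_zero
      rwa [h2] at this
    · rintro ⟨h1, h2, h3⟩
      exact ⟨h2, h1.normalize_eq_self, h3⟩
  refine ⟨F, hF, ?_⟩
  have hdvd : ∏ g ∈ F, g ∣ X ^ n - 1 := by
    refine Finset.prod_dvd_of_coprime ?_ fun g hg => ((hF g).1 hg).2.2
    intro g hg h hh hne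
    obtain ⟨hg1, hg2, _⟩ := (hF g).1 hg
    obtain ⟨hh1, hh2, _⟩ := (hF h).1 hh
    exact (hg2.coprime_iff_not_dvd).2 fun hd => hne (eq_of_monic_of_associated hg1 hh1 (hg2.associated_of_dvd hh2 hd))
  have := natDegree_le_of_dvd hdvd hmon.ne_zero
  rwa [hdeg, natDegree_prod _ _ fun g hg => ((hF g).1 hg).2.1.ne_zero] at this

section
variable {K L : Type} [Field K] [Field L] [Fintype K] [Fintype L] [Algebra K L] {n : ℕ}

theorem sieve_num
    (hn0 : 0 < n) (hn : Fintype.card L = Fintype.card K ^ n)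
    {f : RatFunc L} (hf : f ∈ Upsilon L 3 2) (C S : Finset ℕ) (hCS : Disjoint C S)
    (hCS' : C ∪ S = (Fintype.card L - 1).primeFactors) (A B : Finset K[X]) (hAB : Disjoint A B)
    (hAB' : ∀ g, (g ∈ A ∨ g ∈ B) ↔ (g.Monic ∧ Irreducible g ∧ g ∣ X ^ n - 1))
    (D : ℝ) (hD : 0 < D)
    (hpos : D ≤ 1 - (2 * ∑ p ∈ S, (1 / p : ℝ) + ∑ g ∈ B, (1 / (Fintype.card K : ℝ) ^ g.natDegree)))
    (hmain : 36 * 16 ^ C.card * 4 ^ A.card * (1 + 2 * S.card + B.card : ℝ) ^ 2 + 12 * D ^ 2 ≤ Fintype.card L * D ^ 2) :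
    ∃ α : L, IsPrimitiveElem α ∧ IsNormalElem K n α ∧ IsPrimitiveElem (ratEval f α) := by
  set Q : ℝ := (Fintype.card L : ℝ) with hQdef
  set Y : ℝ := 6 * (4 ^ C.card * 2 ^ A.card) * (1 + 2 * S.card + B.card) with hY
  have hY2 : Y ^ 2 = 36 * 16 ^ C.card * 4 ^ A.card * (1 + 2 * S.card + B.card : ℝ) ^ 2 := by
    have e1 : (16:ℝ) ^ C.card = (4 ^ C.card) ^ 2 := by rw [← pow_mul, mul_comm, pow_mul]; norm_num
    have e2 : (4:ℝ) ^ A.card = (2 ^ A.card) ^ 2 := by rw [← pow_mul, mul_comm, pow_mul]; norm_num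
    rw [hY, e1, e2]
    ring
  rw [← hY2] at hmain
  have hY0 : 0 < Y := by positivity
  have hQ12 : 12 < Q := by
    by_contra hcon
    push Not at hcon
    have h1 : Q * D ^ 2 ≤ 12 * D ^ 2 := mul_le_mul_of_nonneg_right hcon (by positivity)
    nlinarith [pow_pos hY0 2]
  refine sieve_concrete hn0 hn ?_ hf C S hCS hCS' A B hAB hAB' (by linarith) ?_
  · have : (12 : ℝ) < (Fintype.card L : ℝ) := hQ12
    have : 12 < Fintype.card L := by exact_mod_cast this
    omega
  · have h1 : Y * √Q < D * (Q - 6) := by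
      refine lt_of_pow_lt_pow_left₀ 2 (mul_nonneg hD.le (by linarith)) ?_
      rw [mul_pow, Real.sq_sqrt (by linarith), mul_pow]
      have h2 : Y ^ 2 * Q ≤ (Q * D ^ 2 - 12 * D ^ 2) * Q := mul_le_mul_of_nonneg_right (by linarith) (by linarith)
      nlinarith [pow_pos hD 2]
    calc _ = Y * √Q := by rw [hY]; ring
      _ < _ := h1
      _ ≤ _ := mul_le_mul_of_nonneg_right hpos (by linarith)

theorem primeFactors_props : (∀ p ∈ (Fintype.card L - 1).primeFactors, p.Prime) ∧
    prim (Fintype.card L - 1).primeFactors.card ≤ Fintype.card L := by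
  have h1 : ∀ p ∈ (Fintype.card L - 1).primeFactors, p.Prime := fun p hp => Nat.prime_of_mem_primeFactors hp
  refine ⟨h1, (prim_le h1).trans ?_⟩
  have hQ : 0 < Fintype.card L - 1 := by have := Fintype.one_lt_card (α := L); omega
  exact (Nat.le_of_dvd hQ (Nat.prod_primeFactors_dvd _)).trans (Nat.sub_le _ _)

/-- Mode N: all polynomial factors are sieved. -/
theorem modeN (hn0 : 0 < n) (hn : Fintype.card L = Fintype.card K ^ n)
    {f : RatFunc L} (hf : f ∈ Upsilon L 3 2) (b E c k : ℕ) (F : Finset K[X])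
    (hF : ∀ g, g ∈ F ↔ (g.Monic ∧ Irreducible g ∧ g ∣ X ^ n - 1)) (hb : F.card ≤ b)
    (hE : ∑ g ∈ F, (1 / (Fintype.card K : ℝ) ^ g.natDegree) ≤ E / 1000000)
    (C S : Finset ℕ) (hCS : Disjoint C S)
    (hCS' : C ∪ S = (Fintype.card L - 1).primeFactors) (hC : C.card ≤ c) (hS : S.card ≤ k) (Z D : ℕ)
    (hZ : ∑ p ∈ S, (1 / p : ℝ) ≤ Z / 1000000) (hD : 0 < D) (hDZ : D + E + 2 * Z ≤ 1000000)
    (hmain : 36 * 16 ^ c * (1 + 2 * k + b) ^ 2 * 1000000000000 + 12 * D ^ 2 ≤ Fintype.card L * D ^ 2) :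
    ∃ α : L, IsPrimitiveElem α ∧ IsNormalElem K n α ∧ IsPrimitiveElem (ratEval f α) := by
  have hDZ' : (D : ℝ) + E + 2 * Z ≤ 1000000 := by exact_mod_cast hDZ
  have hmain' : (36 * 16 ^ c * (1 + 2 * k + b) ^ 2 * 1000000000000 + 12 * D ^ 2 : ℝ) ≤ Fintype.card L * D ^ 2 := by
    exact_mod_cast hmain
  refine sieve_num hn0 hn hf C S hCS hCS' ∅ F (by simp) (by simpa using hF) (D / 1000000) (by positivity) ?_ ?_
  · linarith
  · have hb' : (F.card : ℝ) ≤ b := by exact_mod_cast hb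
    have hS' : (S.card : ℝ) ≤ k := by exact_mod_cast hS
    have h1 : (16 : ℝ) ^ C.card ≤ 16 ^ c := pow_le_pow_right₀ (by norm_num) hC
    have h2 : (1 + 2 * S.card + F.card : ℝ) ^ 2 ≤ (1 + 2 * k + b) ^ 2 :=
      pow_le_pow_left₀ (by positivity) (by linarith) 2
    have h3 : 36 * 16 ^ C.card * 4 ^ (∅ : Finset K[X]).card * (1 + 2 * S.card + F.card : ℝ) ^ 2 ≤
        36 * 16 ^ c * (1 + 2 * k + b) ^ 2 := by
      rw [Finset.card_empty, pow_zero, mul_one]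
      gcongr
    have h4 : (D / 1000000 : ℝ) ^ 2 = D ^ 2 / 1000000000000 := by rw [div_pow]; norm_num
    rw [h4]
    linarith

theorem modeM (hn0 : 0 < n) (hn : Fintype.card L = Fintype.card K ^ n) (hq : 23 ≤ Fintype.card K)
    {f : RatFunc L} (hf : f ∈ Upsilon L 3 2) (c k : ℕ)
    (C S : Finset ℕ) (hCS : Disjoint C S)
    (hCS' : C ∪ S = (Fintype.card L - 1).primeFactors) (hC : C.card ≤ c) (hS : S.card ≤ k) (Z D : ℕ)
    (hZ : ∑ p ∈ S, (1 / p : ℝ) ≤ Z / 1000000) (hD : 0 < D) (hDZ : D + 2 * Z ≤ 1000000)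
    (hmain : (36 * 16 ^ c * (1 + 2 * k) ^ 2 * 1000000000000 + 12 * D ^ 2) ^ 9 ≤ Fintype.card L ^ 5 * (D ^ 2) ^ 9) :
    ∃ α : L, IsPrimitiveElem α ∧ IsNormalElem K n α ∧ IsPrimitiveElem (ratEval f α) := by
  have hDZ' : (D : ℝ) + 2 * Z ≤ 1000000 := by exact_mod_cast hDZ
  obtain ⟨F, hF, hFd⟩ := exists_factor_finset K hn0
  have hFn : F.card ≤ n := by
    refine le_trans ?_ hFd
    rw [Finset.card_eq_sum_ones]
    exact Finset.sum_le_sum fun g hg => ((hF g).1 hg).2.1.natDegree_pos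
  have h4n : (4 ^ n) ^ 9 ≤ Fintype.card L ^ 4 := by
    rw [hn, ← pow_mul, ← pow_mul, mul_comm n, mul_comm n, pow_mul, pow_mul]
    refine Nat.pow_le_pow_left ?_ n
    exact le_trans (by norm_num) (Nat.pow_le_pow_left hq 4)
  have hm : (36 * 16 ^ c * (1 + 2 * k) ^ 2 * 1000000000000 + 12 * D ^ 2) * 4 ^ n ≤ Fintype.card L * D ^ 2 := by
    refine le_of_pow_le_pow_left₀ (n := 9) (by norm_num) (Nat.zero_le _) ?_
    rw [mul_pow, mul_pow]
    calc _ ≤ (Fintype.card L ^ 5 * (D ^ 2) ^ 9) * Fintype.card L ^ 4 := Nat.mul_le_mul hmain h4n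
      _ = _ := by ring
  have hm2 : 36 * 16 ^ c * (1 + 2 * k) ^ 2 * 1000000000000 * 4 ^ n + 12 * D ^ 2 ≤ Fintype.card L * D ^ 2 := by
    refine le_trans ?_ hm
    have : 1 ≤ 4 ^ n := Nat.one_le_pow _ _ (by norm_num)
    nlinarith [Nat.zero_le (D ^ 2)]
  have hmain' : (36 * 16 ^ c * (1 + 2 * k) ^ 2 * 1000000000000 * 4 ^ n + 12 * D ^ 2 : ℝ) ≤ Fintype.card L * D ^ 2 := by
    exact_mod_cast hm2
  refine sieve_num hn0 hn hf C S hCS hCS' F ∅ (by simp) (by simpa using hF) (D / 1000000) (by positivity) ?_ ?_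
  · rw [Finset.sum_empty]; linarith
  · have hS' : (S.card : ℝ) ≤ k := by exact_mod_cast hS
    have h1 : (16 : ℝ) ^ C.card ≤ 16 ^ c := pow_le_pow_right₀ (by norm_num) hC
    have h1' : (4 : ℝ) ^ F.card ≤ 4 ^ n := pow_le_pow_right₀ (by norm_num) hFn
    have h2 : (1 + 2 * S.card : ℝ) ^ 2 ≤ (1 + 2 * k) ^ 2 :=
      pow_le_pow_left₀ (by positivity) (by linarith) 2
    have h3 : 36 * 16 ^ C.card * 4 ^ F.card * (1 + 2 * S.card + (∅ : Finset K[X]).card : ℝ) ^ 2 ≤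
        36 * 16 ^ c * 4 ^ n * (1 + 2 * k) ^ 2 := by
      rw [Finset.card_empty, Nat.cast_zero, add_zero]
      gcongr
    have h4 : (D / 1000000 : ℝ) ^ 2 = D ^ 2 / 1000000000000 := by rw [div_pow]; norm_num
    rw [h4]
    linarith
end
end PartD2

section PartD3
open Polynomial

def chkN (Q0 b E w c D : ℕ) : Bool :=
  Nat.ble 1 D && Nat.ble (36 * 16 ^ c * (1 + 2 * (w - c) + b) ^ 2 * 1000000000000 + 12 * D ^ 2) (max (prim w) Q0 * D ^ 2)

def okN (Q0 b E : ℕ) : Bool :=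
  ((List.range 30).all fun w => (List.range (w + 1)).any fun c =>
    chkN Q0 b E w c (1000000 - (E + 2 * sumUb c (w - c)))) &&
  (Nat.ble 1 (1000000 - E) && Nat.ble (36 * 16 ^ 30 * (1 + b) ^ 2 * 1000000000000 + 12 * (1000000 - E) ^ 2) (prim 30 * (1000000 - E) ^ 2))

theorem prim_tail (j : ℕ) : prim 30 * 16 ^ j ≤ prim (30 + j) := by
  induction j with
  | zero => simp
  | succ j ih =>
    rw [← add_assoc, prim, pow_succ, ← mul_assoc]
    exact Nat.mul_le_mul ih (lpr_sixteen_le (by omega))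

section
variable {K L : Type} [Field K] [Field L] [Fintype K] [Fintype L] [Algebra K L] {n : ℕ}

theorem factor_finset_bounds (hn0 : 0 < n) : ∃ F : Finset K[X],
    (∀ g, g ∈ F ↔ (g.Monic ∧ Irreducible g ∧ g ∣ X ^ n - 1)) ∧ F.card ≤ n ∧
    ∑ g ∈ F, (1 / (Fintype.card K : ℝ) ^ g.natDegree) ≤ n / Fintype.card K := by
  obtain ⟨F, hF, hFd⟩ := exists_factor_finset K hn0
  have hFn : F.card ≤ n := by
    refine le_trans ?_ hFd
    rw [Finset.card_eq_sum_ones]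
    exact Finset.sum_le_sum fun g hg => ((hF g).1 hg).2.1.natDegree_pos
  have hq1 : (1:ℝ) ≤ Fintype.card K := by exact_mod_cast (Fintype.card_pos (α := K))
  refine ⟨F, hF, hFn, ?_⟩
  calc ∑ g ∈ F, (1 / (Fintype.card K : ℝ) ^ g.natDegree) ≤ ∑ g ∈ F, (1 / (Fintype.card K : ℝ)) := by
        apply Finset.sum_le_sum
        intro g hg
        refine one_div_le_one_div_of_le (by linarith) ?_
        exact le_self_pow₀ hq1 ((hF g).1 hg).2.1.natDegree_pos.ne'
    _ = F.card / Fintype.card K := by rw [Finset.sum_const, nsmul_eq_mul, mul_one_div]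
    _ ≤ _ := by gcongr

theorem loss_le {q0 E : ℕ} (hq0 : 0 < q0) (hq : q0 ≤ Fintype.card K) (hE : n * 1000000 ≤ E * q0) :
    (n / Fintype.card K : ℝ) ≤ E / 1000000 := by
  have h0 : (0:ℝ) < q0 := by exact_mod_cast hq0
  have h1 : (q0:ℝ) ≤ Fintype.card K := by exact_mod_cast hq
  have h2 : (n * 1000000 : ℝ) ≤ E * q0 := by exact_mod_cast hE
  rw [div_le_div_iff₀ (by linarith) (by norm_num)]
  exact h2.trans (mul_le_mul_of_nonneg_left h1 (by positivity))

theorem genN (hn0 : 0 < n) (hn : Fintype.card L = Fintype.card K ^ n)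
    {f : RatFunc L} (hf : f ∈ Upsilon L 3 2) (q0 E : ℕ) (hq0 : 0 < q0) (hq : q0 ≤ Fintype.card K)
    (hE : n * 1000000 ≤ E * q0) (hok : okN (q0 ^ n) n E = true) :
    ∃ α : L, IsPrimitiveElem α ∧ IsNormalElem K n α ∧ IsPrimitiveElem (ratEval f α) := by
  obtain ⟨F, hF, hFn, hFE⟩ := factor_finset_bounds (K := K) hn0
  have hFE := hFE.trans (loss_le hq0 hq hE)
  obtain ⟨hpr, hprim⟩ := primeFactors_props (L := L)
  have hQ0 : q0 ^ n ≤ Fintype.card L := by rw [hn]; exact Nat.pow_le_pow_left hq n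
  set T := (Fintype.card L - 1).primeFactors with hT
  set w := T.card with hw
  rw [okN, Bool.and_eq_true, Bool.and_eq_true] at hok
  obtain ⟨h1, h2, h3⟩ := hok
  rcases Nat.lt_or_ge w 30 with hw30 | hw30
  · rw [List.all_eq_true] at h1
    have h4 := h1 w (List.mem_range.2 hw30)
    rw [List.any_eq_true] at h4
    obtain ⟨c, hc, h5⟩ := h4
    have hcw : c ≤ w := by have := List.mem_range.1 hc; omega
    rw [chkN, Bool.and_eq_true] at h5
    obtain ⟨h6, h7⟩ := h5
    have h6 := Nat.le_of_ble_eq_true h6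
    have h7 := Nat.le_of_ble_eq_true h7
    obtain ⟨C, S, hd, hu, hCc, hSc, hs⟩ := prime_split hpr c (w - c) (by omega)
    refine modeN hn0 hn hf n E c (w - c) F hF hFn hFE C S hd hu hCc.le hSc.le _ _ hs h6 (by omega) ?_
    exact h7.trans (Nat.mul_le_mul_right _ (max_le hprim hQ0))
  · obtain ⟨j, hj⟩ := Nat.exists_eq_add_of_le hw30
    have h2 := Nat.le_of_ble_eq_true h2
    have h3 := Nat.le_of_ble_eq_true h3
    refine modeN hn0 hn hf n E w 0 F hF hFn hFE T ∅ (by simp) (by rw [Finset.union_empty]) le_rfl le_rfl 0 (1000000 - E)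
      (by simp) h2 (by omega) ?_
    have h4 := (prim_tail j).trans (hj ▸ hprim)
    rw [hj, pow_add]
    generalize (1000000 - E) ^ 2 = D2 at *
    generalize prim 30 = P30 at *
    generalize 16 ^ 30 = X30 at *
    have h5 := Nat.mul_le_mul_right (16 ^ j) h3
    have h6 := Nat.mul_le_mul_right D2 h4
    have h7 : 1 ≤ 16 ^ j := Nat.one_le_pow _ _ (by norm_num)
    have h8 : 12 * D2 ≤ 12 * D2 * 16 ^ j := Nat.le_mul_of_pos_right _ h7
    calc 36 * (X30 * 16 ^ j) * (1 + 2 * 0 + n) ^ 2 * 1000000000000 + 12 * D2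
        ≤ 36 * (X30 * 16 ^ j) * (1 + 2 * 0 + n) ^ 2 * 1000000000000 + 12 * D2 * 16 ^ j := Nat.add_le_add_left h8 _
      _ = (36 * X30 * (1 + n) ^ 2 * 1000000000000 + 12 * D2) * 16 ^ j := by ring
      _ ≤ P30 * D2 * 16 ^ j := h5
      _ = P30 * 16 ^ j * D2 := by ring
      _ ≤ _ := h6
end

def hintC (w : ℕ) : ℕ := if w < 20 then min w 7 else 8 + (w - 20) / 10

def chkM (w c D : ℕ) : Bool :=
  Nat.ble 1 D && Nat.ble ((36 * 16 ^ c * (1 + 2 * (w - c)) ^ 2 * 1000000000000 + 12 * D ^ 2) ^ 9)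
    ((max (prim w) (23 ^ 18)) ^ 5 * (D ^ 2) ^ 9)

def okM : Bool :=
  ((List.range 100).all fun w => chkM w (hintC w) (1000000 - 2 * sumUb (hintC w) (w - hintC w))) &&
   Nat.ble ((36 * 16 ^ 100 * 1000000000000 + 12 * 1000000 ^ 2) ^ 9) (prim 100 ^ 5 * (1000000 ^ 2) ^ 9)

theorem okM_true : okM = true := by decide +kernel

theorem hintC_le (w : ℕ) : hintC w ≤ w := by
  unfold hintC; split_ifs <;> omega

theorem prim_succ (k : ℕ) : prim (k + 1) = prim k * lpr k := rfl

theorem prim_tail2 (j : ℕ) : prim 100 * 547 ^ j ≤ prim (100 + j) := by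
  induction j with
  | zero => simp
  | succ j ih =>
    rw [← add_assoc, prim_succ (100 + j), pow_succ, ← mul_assoc, lpr_tail (Nat.le_add_right 100 j)]
    exact Nat.mul_le_mul_right _ ih

theorem okM_tail_aux (B X P Q M Z u v : ℕ) (h3 : (36 * X * M + B) ^ 9 ≤ P ^ 5 * Z)
    (h1 : 1 ≤ u) (huv : u ^ 9 ≤ v ^ 5) (hQ : P * v ≤ Q) :
    (36 * (X * u) * (1 + 2 * 0) ^ 2 * M + B) ^ 9 ≤ Q ^ 5 * Z := by
  have ha : 36 * (X * u) * (1 + 2 * 0) ^ 2 * M + B ≤ (36 * X * M + B) * u := by nlinarith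
  refine (Nat.pow_le_pow_left ha 9).trans ?_
  rw [mul_pow]
  calc (36 * X * M + B) ^ 9 * u ^ 9 ≤ (P ^ 5 * Z) * v ^ 5 := Nat.mul_le_mul h3 huv
    _ = (P * v) ^ 5 * Z := by ring
    _ ≤ _ := Nat.mul_le_mul_right _ (Nat.pow_le_pow_left hQ 5)

theorem okM_tail (j Q : ℕ) (hQ : prim 100 * 547 ^ j ≤ Q) :
    (36 * 16 ^ (100 + j) * (1 + 2 * 0) ^ 2 * 1000000000000 + 12 * 1000000 ^ 2) ^ 9 ≤
      Q ^ 5 * (1000000 ^ 2) ^ 9 := by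
  have h := okM_true
  rw [okM, Bool.and_eq_true] at h
  have h3 := Nat.le_of_ble_eq_true h.2
  have h1 : 1 ≤ 16 ^ j := Nat.one_le_pow _ _ (by norm_num)
  have hj : (16 ^ j) ^ 9 ≤ (547 ^ j) ^ 5 := by
    rw [← pow_mul, ← pow_mul, mul_comm j 9, mul_comm j 5, pow_mul, pow_mul]
    exact Nat.pow_le_pow_left (by norm_num) j
  rw [pow_add]
  exact okM_tail_aux _ _ _ _ _ _ _ _ h3 h1 hj hQ

section
variable {K L : Type} [Field K] [Field L] [Fintype K] [Fintype L] [Algebra K L] {n : ℕ}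

theorem genM (hn0 : 18 ≤ n) (hn : Fintype.card L = Fintype.card K ^ n) (hq : 23 ≤ Fintype.card K)
    {f : RatFunc L} (hf : f ∈ Upsilon L 3 2) :
    ∃ α : L, IsPrimitiveElem α ∧ IsNormalElem K n α ∧ IsPrimitiveElem (ratEval f α) := by
  obtain ⟨hpr, hprim⟩ := primeFactors_props (L := L)
  have hQ0 : 23 ^ 18 ≤ Fintype.card L := by
    rw [hn]; exact (Nat.pow_le_pow_left hq 18).trans (Nat.pow_le_pow_right (by omega) hn0)
  set T := (Fintype.card L - 1).primeFactors with hT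
  set w := T.card with hw
  rcases Nat.lt_or_ge w 100 with hw30 | hw30
  · have h := okM_true
    rw [okM, Bool.and_eq_true, List.all_eq_true] at h
    have h5 := h.1 w (List.mem_range.2 hw30)
    have hcw := hintC_le w
    rw [chkM, Bool.and_eq_true] at h5
    obtain ⟨h6, h7⟩ := h5
    have h6 := Nat.le_of_ble_eq_true h6
    have h7 := Nat.le_of_ble_eq_true h7
    obtain ⟨C, S, hd, hu, hCc, hSc, hs⟩ := prime_split hpr (hintC w) (w - hintC w) (by omega)
    refine modeM (by omega) hn hq hf (hintC w) (w - hintC w) C S hd hu hCc.le hSc.le _ _ hs h6 (by omega) ?_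
    exact h7.trans (Nat.mul_le_mul_right _ (Nat.pow_le_pow_left (max_le hprim hQ0) 5))
  · obtain ⟨j, hj⟩ := Nat.exists_eq_add_of_le hw30
    refine modeM (by omega) hn hq hf w 0 T ∅ (by simp) (by rw [Finset.union_empty]) le_rfl le_rfl 0 1000000
      (by simp) (by norm_num) (by norm_num) ?_
    rw [hj]
    exact okM_tail j _ ((prim_tail2 j).trans (hj ▸ hprim))
end


theorem okN_3 : okN (3740000000 ^ 3) 3 1 = true := by decide +kernel
theorem okN_4 : okN (39100000 ^ 4) 4 1 = true := by decide +kernel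
theorem okN_5 : okN (2500000 ^ 5) 5 2 = true := by decide +kernel
theorem okN_6 : okN (59 ^ 6) 6 101695 = true := by decide +kernel
theorem okN_7 : okN (43 ^ 7) 7 162791 = true := by decide +kernel
theorem okN_8 : okN (31 ^ 8) 8 258065 = true := by decide +kernel
theorem okN_9 : okN (29 ^ 9) 9 310345 = true := by decide +kernel
theorem okN_10 : okN (25 ^ 10) 10 400000 = true := by decide +kernel
theorem okN_11 : okN (23 ^ 11) 11 478261 = true := by decide +kernel
theorem okN_12 : okN (23 ^ 12) 12 521740 = true := by decide +kernel
theorem okN_13 : okN (23 ^ 13) 13 565218 = true := by decide +kernel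
theorem okN_14 : okN (23 ^ 14) 14 608696 = true := by decide +kernel
theorem okN_15 : okN (23 ^ 15) 15 652174 = true := by decide +kernel
theorem okN_16 : okN (23 ^ 16) 16 695653 = true := by decide +kernel
theorem okN_17 : okN (23 ^ 17) 17 739131 = true := by decide +kernel
end PartD3

open Polynomial

def smallP (N : ℕ) : List ℕ := PL.filter (fun p => N % p == 0)

def ub1 (p : ℕ) : ℕ := 1000000 / p + 1

/-- Numerical certificate for an explicit pair; `sb` bounds the number of prime factors `≥ 547`. -/
def chkP (q n b E c sb : ℕ) : Bool :=
  Nat.ble ((q ^ n - 1) / Nat.gcd (q ^ n - 1) ((smallP (q ^ n - 1)).prod ^ 40) + 1) (547 ^ (sb + 1)) &&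
  chkD (q ^ n) b c (((smallP (q ^ n - 1)).drop c).length + sb)
    (1000000 - (E + 2 * ((((smallP (q ^ n - 1)).drop c).map ub1).sum + sb * 1829)))
where
  chkD (Q b c k D : ℕ) : Bool :=
    Nat.ble 1 D && Nat.ble (36 * 16 ^ c * (1 + 2 * k + b) ^ 2 * 1000000000000 + 12 * D ^ 2) (Q * D ^ 2)

def okP (q n b E : ℕ) : Bool :=
  (List.range 9).any fun c => (List.range 5).any fun sb => chkP q n b E c sb

theorem PL_nodup : PL.Nodup := by decide +kernel

theorem PL_range : ∀ p ∈ PL, 0 < p ∧ p < 547 := by decide +kernel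

theorem inv_le_ub1 {p : ℕ} (hp : 0 < p) : (1 / p : ℝ) ≤ ub1 p / 1000000 := by
  have h0 : (0:ℝ) < p := by exact_mod_cast hp
  rw [div_le_div_iff₀ h0 (by norm_num)]
  have h3 : 1000000 ≤ ub1 p * p := by
    unfold ub1
    have := Nat.lt_div_mul_add (a := 1000000) hp
    rw [add_mul, one_mul]; omega
  have h4 : (1000000:ℝ) ≤ ub1 p * p := by exact_mod_cast h3
  linarith

theorem list_ub {l : List ℕ} (hl : ∀ p ∈ l, 0 < p) :
    (l.map (fun p : ℕ => (1 / p : ℝ))).sum ≤ ((l.map ub1).sum : ℕ) / 1000000 := by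
  induction l with
  | nil => simp
  | cons a l ih =>
    simp only [List.map_cons, List.sum_cons]
    push_cast
    rw [add_div]
    have h1 := inv_le_ub1 (hl a (by simp))
    have h2 := ih fun p hp => hl p (by simp [hp])
    push_cast at h2
    linarith

theorem big_dvd {N p : ℕ} (hp : p.Prime) (h547 : 547 ≤ p) (hpN : p ∣ N) :
    p ∣ N / Nat.gcd N ((smallP N).prod ^ 40) := by
  have h1 : N = Nat.gcd N ((smallP N).prod ^ 40) * (N / Nat.gcd N ((smallP N).prod ^ 40)) :=
    (Nat.mul_div_cancel' (Nat.gcd_dvd_left _ _)).symm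
  rw [h1] at hpN
  rcases hp.dvd_mul.1 hpN with h | h
  · exfalso
    have h2 := hp.dvd_of_dvd_pow (h.trans (Nat.gcd_dvd_right _ _))
    obtain ⟨r, hr, hpr⟩ := (hp.prime.dvd_prod_iff).1 h2
    have hr' := PL_range r (List.mem_filter.1 hr).1
    have := Nat.le_of_dvd hr'.1 hpr
    omega
  · exact h

theorem big_card {N sb : ℕ} (hN : 0 < N)
    (h : N / Nat.gcd N ((smallP N).prod ^ 40) < 547 ^ (sb + 1)) :
    (N.primeFactors.filter (fun p => 547 ≤ p)).card ≤ sb := by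
  set B := N.primeFactors.filter (fun p => 547 ≤ p) with hB
  have hdvd : ∏ p ∈ B, p ∣ N / Nat.gcd N ((smallP N).prod ^ 40) := by
    apply Finset.prod_primes_dvd
    · intro p hp
      exact (Nat.prime_of_mem_primeFactors (Finset.mem_filter.1 hp).1).prime
    · intro p hp
      have := Finset.mem_filter.1 hp
      exact big_dvd (Nat.prime_of_mem_primeFactors this.1) this.2 (Nat.dvd_of_mem_primeFactors this.1)
  have hpos : 0 < N / Nat.gcd N ((smallP N).prod ^ 40) :=
    Nat.div_pos (Nat.le_of_dvd hN (Nat.gcd_dvd_left _ _)) (Nat.gcd_pos_of_pos_left _ hN)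
  have h1 := Nat.le_of_dvd hpos hdvd
  have h2 : 547 ^ B.card ≤ ∏ p ∈ B, p := by
    apply Finset.pow_card_le_prod
    intro p hp
    exact (Finset.mem_filter.1 hp).2
  have h3 := (h2.trans h1).trans_lt h
  have := (Nat.pow_lt_pow_iff_right (a := 547) (by norm_num)).1 h3
  omega

theorem explicit_split {N sb c : ℕ} (hN : 0 < N)
    (h : N / Nat.gcd N ((smallP N).prod ^ 40) < 547 ^ (sb + 1)) :
    ∃ C S : Finset ℕ, Disjoint C S ∧ C ∪ S = N.primeFactors ∧ C.card ≤ c ∧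
      S.card ≤ ((smallP N).drop c).length + sb ∧
      ∑ p ∈ S, (1 / p : ℝ) ≤ ((((smallP N).drop c).map ub1).sum + sb * 1829 : ℕ) / 1000000 := by
  classical
  set B := N.primeFactors.filter (fun p => 547 ≤ p) with hB
  have hBc : B.card ≤ sb := big_card hN h
  set C := N.primeFactors.filter (fun p => p ∈ (smallP N).take c) with hC
  set M := ((smallP N).drop c).toFinset with hM
  have hnd : ((smallP N).drop c).Nodup := (PL_nodup.filter _).sublist (List.drop_sublist _ _)
  have hSsub : N.primeFactors \ C ⊆ M ∪ B := by
    intro p hp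
    rw [Finset.mem_sdiff] at hp
    obtain ⟨hp1, hp2⟩ := hp
    rw [Finset.mem_union]
    rcases Nat.lt_or_ge p 547 with h5 | h5
    · left
      have hp3 : p ∈ smallP N := by
        rw [smallP, List.mem_filter]
        refine ⟨prime_mem_PL (Nat.prime_of_mem_primeFactors hp1) h5, ?_⟩
        simpa using Nat.mod_eq_zero_of_dvd (Nat.dvd_of_mem_primeFactors hp1)
      rw [← List.take_append_drop c (smallP N), List.mem_append] at hp3
      rcases hp3 with hp3 | hp3
      · exact absurd (Finset.mem_filter.2 ⟨hp1, hp3⟩) hp2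
      · exact List.mem_toFinset.2 hp3
    · right; exact Finset.mem_filter.2 ⟨hp1, h5⟩
  have hMpos : ∀ p ∈ (smallP N).drop c, 0 < p := fun p hp =>
    (PL_range p (List.mem_filter.1 (List.mem_of_mem_drop hp)).1).1
  refine ⟨C, N.primeFactors \ C, Finset.disjoint_sdiff, ?_, ?_, ?_, ?_⟩
  · exact Finset.union_sdiff_of_subset (Finset.filter_subset _ _)
  · have : C ⊆ ((smallP N).take c).toFinset := by
      intro p hp
      exact List.mem_toFinset.2 (Finset.mem_filter.1 hp).2
    exact (Finset.card_le_card this).trans ((List.toFinset_card_le _).trans (List.length_take_le _ _))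
  · refine (Finset.card_le_card hSsub).trans ((Finset.card_union_le _ _).trans ?_)
    exact Nat.add_le_add (List.toFinset_card_le _) hBc
  · have h1 : ∑ p ∈ N.primeFactors \ C, (1 / p : ℝ) ≤ ∑ p ∈ M, (1 / p : ℝ) + ∑ p ∈ B, (1 / p : ℝ) := by
      refine (Finset.sum_le_sum_of_subset_of_nonneg hSsub fun _ _ _ => by positivity).trans ?_
      rw [← Finset.sum_union_inter]
      exact le_add_of_nonneg_right (Finset.sum_nonneg fun _ _ => by positivity)
    have h2 : ∑ p ∈ M, (1 / p : ℝ) ≤ ((((smallP N).drop c).map ub1).sum : ℕ) / 1000000 := by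
      rw [hM, List.sum_toFinset _ hnd]
      exact list_ub hMpos
    have h3 : ∑ p ∈ B, (1 / p : ℝ) ≤ sb * (1829 / 1000000) := by
      have h4 : ∀ p ∈ B, (1 / p : ℝ) ≤ 1829 / 1000000 := by
        intro p hp
        have h5 : (547:ℝ) ≤ p := by exact_mod_cast (Finset.mem_filter.1 hp).2
        exact (one_div_le_one_div_of_le (by norm_num) h5).trans (by norm_num)
      refine (Finset.sum_le_card_nsmul _ _ _ h4).trans ?_
      rw [nsmul_eq_mul]
      have : (B.card : ℝ) ≤ sb := by exact_mod_cast hBc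
      exact mul_le_mul_of_nonneg_right this (by norm_num)
    rw [Nat.cast_add, Nat.cast_mul, add_div]
    have h6 : ((sb : ℝ) * ((1829 : ℕ) : ℝ)) / 1000000 = sb * (1829 / 1000000) := by push_cast; ring
    rw [h6]
    linarith

section
variable {K L : Type} [Field K] [Field L] [Fintype K] [Fintype L] [Algebra K L] {n : ℕ}

theorem genP' (hn0 : 0 < n) (hn : Fintype.card L = Fintype.card K ^ n)
    {f : RatFunc L} (hf : f ∈ Upsilon L 3 2) (q b E : ℕ) (hq : Fintype.card K = q)
    (F : Finset K[X]) (hF : ∀ g, g ∈ F ↔ (g.Monic ∧ Irreducible g ∧ g ∣ X ^ n - 1)) (hb : F.card ≤ b)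
    (hFE : ∑ g ∈ F, (1 / (Fintype.card K : ℝ) ^ g.natDegree) ≤ E / 1000000)
    (hok : okP q n b E = true) :
    ∃ α : L, IsPrimitiveElem α ∧ IsNormalElem K n α ∧ IsPrimitiveElem (ratEval f α) := by
  rw [okP, List.any_eq_true] at hok
  obtain ⟨c, -, hok⟩ := hok
  rw [List.any_eq_true] at hok
  obtain ⟨sb, -, hok⟩ := hok
  rw [chkP, chkP.chkD, Bool.and_eq_true, Bool.and_eq_true] at hok
  obtain ⟨h1, h2, h3⟩ := hok
  have h1 := Nat.le_of_ble_eq_true h1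
  have h2 := Nat.le_of_ble_eq_true h2
  have h3 := Nat.le_of_ble_eq_true h3
  have hLq : Fintype.card L = q ^ n := by rw [hn, hq]
  have hL1 : 1 < Fintype.card L := Fintype.one_lt_card
  rw [← hLq] at h1 h2 h3
  obtain ⟨C, S, hd, hu, hCc, hSc, hs⟩ := explicit_split (c := c) (by omega) (Nat.lt_of_succ_le h1)
  exact modeN hn0 hn hf b E c _ F hF hb hFE C S hd hu hCc hSc _ _ hs h2 (by omega) h3

theorem genP (hn0 : 0 < n) (hn : Fintype.card L = Fintype.card K ^ n)
    {f : RatFunc L} (hf : f ∈ Upsilon L 3 2) (q : ℕ) (hq : Fintype.card K = q)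
    (hok : okP q n n (n * 1000000 / q + 1) = true) :
    ∃ α : L, IsPrimitiveElem α ∧ IsNormalElem K n α ∧ IsPrimitiveElem (ratEval f α) := by
  obtain ⟨F, hF, hFn, hFE⟩ := factor_finset_bounds (K := K) hn0
  have hq0 : 0 < q := hq ▸ Fintype.card_pos
  refine genP' hn0 hn hf q n _ hq F hF hFn (hFE.trans (loss_le hq0 hq.ge ?_)) hok
  have := Nat.lt_div_mul_add (a := n * 1000000) hq0
  rw [add_mul, one_mul]; omega

theorem factor_23 (hK : Fintype.card K = 23) {g : K[X]} (hg : g.Monic) (hg1 : g.natDegree = 1)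
    (hd : g ∣ X ^ 6 - 1) : g = X + C 1 ∨ g = X + C (-1) := by
  have hgX : g = X + C (g.coeff 0) := hg.eq_X_add_C hg1
  set a := g.coeff 0 with ha
  have hroot : (-a) ^ 6 = 1 := by
    have h1 : (X ^ 6 - 1 : K[X]).eval (-a) = 0 := by
      obtain ⟨r, hr⟩ := hd
      rw [hr, eval_mul, hgX]; simp
    simp at h1
    linear_combination h1
  have ha6 : a ^ 6 = 1 := by linear_combination hroot
  have ha0 : a ≠ 0 := by rintro h0; rw [h0] at ha6; simp at ha6
  have h22 : a ^ 22 = 1 := by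
    have := FiniteField.pow_card_sub_one_eq_one a ha0
    rwa [hK] at this
  have h2 : a ^ 2 = 1 := by
    have h24 : a ^ 24 = 1 := by rw [show 24 = 6 * 4 by norm_num, pow_mul, ha6, one_pow]
    have : a ^ 24 = a ^ 22 * a ^ 2 := by ring
    rw [h24, h22, one_mul] at this
    exact this.symm
  rcases sq_eq_sq_iff_eq_or_eq_neg.1 (h2.trans (one_pow 2).symm) with h | h
  · left; rw [hgX, h]
  · right; rw [hgX, h]

theorem gen_23_6 (hn : Fintype.card L = Fintype.card K ^ 6) (hK : Fintype.card K = 23)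
    {f : RatFunc L} (hf : f ∈ Upsilon L 3 2) :
    ∃ α : L, IsPrimitiveElem α ∧ IsNormalElem K 6 α ∧ IsPrimitiveElem (ratEval f α) := by
  classical
  obtain ⟨F, hF, hFd⟩ := exists_factor_finset K (n := 6) (by norm_num)
  set A := F.filter (fun g => g.natDegree = 1) with hA
  set B := F.filter (fun g => ¬ g.natDegree = 1) with hB
  have hAB : A.card + B.card = F.card := Finset.card_filter_add_card_filter_not _
  have hAc : A.card ≤ 2 := by
    have : A ⊆ {X + C 1, X + C (-1)} := by
      intro g hg
      have hg := Finset.mem_filter.1 hg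
      have hg' := (hF g).1 hg.1
      have := factor_23 hK hg'.1 hg.2 hg'.2.2
      simpa using this
    exact (Finset.card_le_card this).trans Finset.card_le_two
  have hB2 : ∀ g ∈ B, 2 ≤ g.natDegree := by
    intro g hg
    have hg := Finset.mem_filter.1 hg
    have := ((hF g).1 hg.1).2.1.natDegree_pos
    omega
  have hdeg : A.card + 2 * B.card ≤ 6 := by
    refine le_trans ?_ hFd
    rw [← Finset.sum_filter_add_sum_filter_not F (fun g => g.natDegree = 1)]
    refine Nat.add_le_add ?_ ?_
    · rw [Finset.card_eq_sum_ones]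
      exact Finset.sum_le_sum fun g hg => (Finset.mem_filter.1 hg).2.ge
    · rw [mul_comm, ← smul_eq_mul]
      exact Finset.card_nsmul_le_sum _ _ _ hB2
  have hsum : ∑ g ∈ F, (1 / (Fintype.card K : ℝ) ^ g.natDegree) ≤ (90738 : ℕ) / 1000000 := by
    rw [← Finset.sum_filter_add_sum_filter_not F (fun g => g.natDegree = 1), hK]
    have h1 : ∑ g ∈ A, (1 / ((23:ℕ) : ℝ) ^ g.natDegree) ≤ A.card • (1 / 23 : ℝ) := by
      apply Finset.sum_le_card_nsmul
      intro g hg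
      rw [(Finset.mem_filter.1 hg).2]; norm_num
    have h2 : ∑ g ∈ B, (1 / ((23:ℕ) : ℝ) ^ g.natDegree) ≤ B.card • (1 / 529 : ℝ) := by
      apply Finset.sum_le_card_nsmul
      intro g hg
      refine one_div_le_one_div_of_le (by norm_num) ?_
      calc (529:ℝ) = ((23:ℕ) : ℝ) ^ 2 := by norm_num
        _ ≤ _ := pow_le_pow_right₀ (by norm_num) (hB2 g hg)
    rw [nsmul_eq_mul] at h1 h2
    have h3 : (A.card : ℝ) ≤ 2 := by exact_mod_cast hAc
    have h4 : (A.card : ℝ) + 2 * B.card ≤ 6 := by exact_mod_cast hdeg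
    push_cast
    push_cast at h1 h2
    linarith
  exact genP' (by norm_num) hn hf 23 4 90738 hK F hF (by omega) hsum (by decide +kernel)
end

theorem okP_6 : ∀ q ∈ List.range' 24 35, okP q 6 6 (6 * 1000000 / q + 1) = true := by decide +kernel
theorem okP_7 : ∀ q ∈ List.range' 23 20, okP q 7 7 (7 * 1000000 / q + 1) = true := by decide +kernel
theorem okP_8 : ∀ q ∈ List.range' 23 8, okP q 8 8 (8 * 1000000 / q + 1) = true := by decide +kernel
theorem okP_9 : ∀ q ∈ List.range' 23 6, okP q 9 9 (9 * 1000000 / q + 1) = true := by decide +kernel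
theorem okP_10 : ∀ q ∈ List.range' 23 2, okP q 10 10 (10 * 1000000 / q + 1) = true := by decide +kernel

theorem stmt6 (q n : ℕ) (hq : IsPrimePow q) (hn : 3 ≤ n)
    (h : (3740000000 ≤ q ∧ n = 3) ∨ (39100000 ≤ q ∧ n = 4) ∨
         (2500000 ≤ q ∧ n = 5) ∨ (23 ≤ q ∧ 6 ≤ n)) :
    memB 3 2 q n := by
  intro K L _ _ _ _ _ hK hL f hf
  have hc : Fintype.card L = Fintype.card K ^ n := by rw [hK, hL]
  rcases h with ⟨hq, rfl⟩ | ⟨hq, rfl⟩ | ⟨hq, rfl⟩ | ⟨hq, hn6⟩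
  · exact genN (by norm_num) hc hf 3740000000 1 (by norm_num) (hK ▸ hq) (by norm_num) okN_3
  · exact genN (by norm_num) hc hf 39100000 1 (by norm_num) (hK ▸ hq) (by norm_num) okN_4
  · exact genN (by norm_num) hc hf 2500000 2 (by norm_num) (hK ▸ hq) (by norm_num) okN_5
  rcases Nat.lt_or_ge n 18 with hn18 | hn18
  swap
  · exact genM hn18 hc (hK ▸ hq) hf
  have hn0 : 0 < n := by omega
  clear hn
  interval_cases n
  · rcases Nat.lt_or_ge q 59 with h | h
    · rcases Nat.eq_or_lt_of_le hq with h1 | h1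
      · exact gen_23_6 hc (hK.trans h1.symm) hf
      · exact genP hn0 hc hf q hK (okP_6 q (by rw [List.mem_range'_1]; omega))
    · exact genN hn0 hc hf 59 101695 (by norm_num) (hK ▸ h) (by norm_num) okN_6
  · rcases Nat.lt_or_ge q 43 with h | h
    · exact genP hn0 hc hf q hK (okP_7 q (by rw [List.mem_range'_1]; omega))
    · exact genN hn0 hc hf 43 162791 (by norm_num) (hK ▸ h) (by norm_num) okN_7
  · rcases Nat.lt_or_ge q 31 with h | h
    · exact genP hn0 hc hf q hK (okP_8 q (by rw [List.mem_range'_1]; omega))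
    · exact genN hn0 hc hf 31 258065 (by norm_num) (hK ▸ h) (by norm_num) okN_8
  · rcases Nat.lt_or_ge q 29 with h | h
    · exact genP hn0 hc hf q hK (okP_9 q (by rw [List.mem_range'_1]; omega))
    · exact genN hn0 hc hf 29 310345 (by norm_num) (hK ▸ h) (by norm_num) okN_9
  · rcases Nat.lt_or_ge q 25 with h | h
    · exact genP hn0 hc hf q hK (okP_10 q (by rw [List.mem_range'_1]; omega))
    · exact genN hn0 hc hf 25 400000 (by norm_num) (hK ▸ h) (by norm_num) okN_10
  · exact genN hn0 hc hf 23 478261 (by norm_num) (hK ▸ hq) (by norm_num) okN_11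
  · exact genN hn0 hc hf 23 521740 (by norm_num) (hK ▸ hq) (by norm_num) okN_12
  · exact genN hn0 hc hf 23 565218 (by norm_num) (hK ▸ hq) (by norm_num) okN_13
  · exact genN hn0 hc hf 23 608696 (by norm_num) (hK ▸ hq) (by norm_num) okN_14
  · exact genN hn0 hc hf 23 652174 (by norm_num) (hK ▸ hq) (by norm_num) okN_15
  · exact genN hn0 hc hf 23 695653 (by norm_num) (hK ▸ hq) (by norm_num) okN_16
  · exact genN hn0 hc hf 23 739131 (by norm_num) (hK ▸ hq) (by norm_num) okN_17
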